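/- arXiv:2410.06421 — 2 statements merged into one kernel-verified Lean document; each statement's English description precedes it below -/
import Mathlib

section
/- Let H be a graph with at least one edge and let n ≥ v_H + 2. Then the H-space of the complete graph K_n is given by: C_H(K_n) = C(K_n) if H is Eulerian and e_H is odd; C_H(K_n) = C(K_n) ∩ D(K_n) if H is Eulerian and e_H is even; C_H(K_n) = E(K_n) if H is not Eulerian and e_H is odd; and C_H(K_n) = D(K_n) if H is not Eulerian and e_H is even. -/
open Finset SimpleGraph Filter Topology

noncomputable section
open scoped Classical

namespace RG

variable {α β V : Type*}

/-- The number of edges of a graph. -/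
def eCount (H : SimpleGraph α) : ℕ := Nat.card ↥H.edgeSet

/-- The number of automorphisms of a graph. -/
def autCount (H : SimpleGraph α) : ℕ := Nat.card (H ≃g H)

/-- Every vertex has even degree. -/
def IsEulerianGraph (H : SimpleGraph α) : Prop :=
  ∀ v, Even (Nat.card ↥(H.neighborSet v))

/-- Vectors in the ambient 𝔽₂ edge space on the vertex type `V`. -/
abbrev EdgeVec (V : Type*) := Sym2 V → ZMod 2

/-- Indicator vector of a set of edges. -/
def setVec (s : Set (Sym2 V)) : EdgeVec V := fun e => if e ∈ s then 1 else 0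

/-- The support (set of edges) of an edge-space vector. -/
def suppSet (f : EdgeVec V) : Set (Sym2 V) := {e | f e ≠ 0}

/-- The number of edges of an edge-space vector. -/
def wt (f : EdgeVec V) : ℕ := Nat.card ↥(suppSet f)

/-- The edge space `E(G)`: the span of the indicators of single edges of `G`,
i.e. all vectors supported on `E(G)`. -/
def edgeSpace (G : SimpleGraph V) : Submodule (ZMod 2) (EdgeVec V) :=
  Submodule.span (ZMod 2) {f | ∃ e ∈ G.edgeSet, f = setVec {e}}

/-- The mod-2 degree of the vertex `v` in an edge-space vector. -/
def parityMap [Fintype V] [DecidableEq V] (v : V) : EdgeVec V →ₗ[ZMod 2] ZMod 2 where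
  toFun f := ∑ w ∈ Finset.univ.erase v, f s(v, w)
  map_add' f g := by simp [Finset.sum_add_distrib]
  map_smul' c f := by simp [Finset.mul_sum, mul_sub]

/-- The cycle space `C(G)`: members of `E(G)` in which every vertex has even degree. -/
def cycleSpace [Fintype V] [DecidableEq V] (G : SimpleGraph V) :
    Submodule (ZMod 2) (EdgeVec V) :=
  edgeSpace G ⊓ ⨅ v : V, LinearMap.ker (parityMap v)

/-- The mod-2 total number of edges of an edge-space vector. -/
def totalMap [Fintype V] [DecidableEq V] : EdgeVec V →ₗ[ZMod 2] ZMod 2 where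
  toFun f := ∑ e, f e
  map_add' f g := by simp [Finset.sum_add_distrib]
  map_smul' c f := by simp [Finset.mul_sum, mul_sub]

/-- The space `D(G)` of even-size members of `E(G)`. -/
def dSpace [Fintype V] [DecidableEq V] (G : SimpleGraph V) :
    Submodule (ZMod 2) (EdgeVec V) :=
  edgeSpace G ⊓ LinearMap.ker (totalMap (V := V))

/-- The `H`-space `C_H(G)`: the span of the (indicators of the edge sets of) copies of `H`
in `G`. -/
def hSpace (H : SimpleGraph α) (G : SimpleGraph V) : Submodule (ZMod 2) (EdgeVec V) :=
  Submodule.span (ZMod 2)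
    {f | ∃ K : G.Subgraph, Nonempty (H ≃g K.coe) ∧ f = setVec K.edgeSet}

/-- `W_H(G)`, the natural candidate value of `C_H(G)`. -/
def wSpace [Fintype V] [DecidableEq V] (H : SimpleGraph α) (G : SimpleGraph V) :
    Submodule (ZMod 2) (EdgeVec V) :=
  if IsEulerianGraph H then
    if Odd (eCount H) then cycleSpace G else cycleSpace G ⊓ dSpace G
  else
    if Odd (eCount H) then edgeSpace G else dSpace G

/-- `G ∈ T_H` : the `H`-space equals its natural value. -/
def memT [Fintype V] [DecidableEq V] (H : SimpleGraph α) (G : SimpleGraph V) : Prop :=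
  hSpace H G = wSpace H G

/-- `G ∈ Q_H` : every edge of `G` lies in a copy of `H`. -/
def memQ (H : SimpleGraph α) (G : SimpleGraph V) : Prop :=
  ∀ e ∈ G.edgeSet, ∃ K : G.Subgraph, Nonempty (H ≃g K.coe) ∧ e ∈ K.edgeSet

/-- The standard 𝔽₂ inner product `⟨f,g⟩ = |f ∩ g| mod 2`. -/
def ip [Fintype V] [DecidableEq V] (f g : EdgeVec V) : ZMod 2 := ∑ e, f e * g e

/-- The orthogonal complement of `S` inside the edge space of `G`. -/
def perpIn [Fintype V] [DecidableEq V] (G : SimpleGraph V)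
    (S : Submodule (ZMod 2) (EdgeVec V)) : Set (EdgeVec V) :=
  {f | f ∈ edgeSpace G ∧ ∀ g ∈ S, ip f g = 0}

/-- The probability that the Erdős–Rényi random graph `G_{n,p}` lies in the set `A`. -/
def erProb (n : ℕ) (p : ℝ) (A : Set (SimpleGraph (Fin n))) : ℝ :=
  ∑ s ∈ (⊤ : SimpleGraph (Fin n)).edgeFinset.powerset,
    if SimpleGraph.fromEdgeSet (↑s) ∈ A then
      p ^ s.card * (1 - p) ^ ((⊤ : SimpleGraph (Fin n)).edgeFinset.card - s.card)
    else 0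

/-- `(e-1)/(v-2)` when `v ≥ 3`, and `0` otherwise. -/
def density2 (v e : ℕ) : ℝ := if 3 ≤ v then ((e : ℝ) - 1) / ((v : ℝ) - 2) else 0

/-- The 2-density `d₂(H)`. -/
def d2 (H : SimpleGraph α) : ℝ := density2 (Nat.card α) (eCount H)

/-- The 2-density of a subgraph. -/
def subDensity2 {H : SimpleGraph α} (K : H.Subgraph) : ℝ :=
  density2 (Nat.card ↥K.verts) (Nat.card ↥K.edgeSet)

/-- The maximum 2-density `m₂(H)`. -/
def m2 (H : SimpleGraph α) : ℝ := sSup {x : ℝ | ∃ K : H.Subgraph, x = subDensity2 K}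

/-- `H` is strictly 2-balanced. -/
def Strictly2Balanced (H : SimpleGraph α) : Prop :=
  3 ≤ Nat.card α ∧ ∀ K : H.Subgraph, K ≠ ⊤ → subDensity2 K < d2 H

/-- `ϱ(H) = Σ_{(a,b)} 1/aut(H;a,b) = 2·e_H/aut(H)`. -/
def rho (H : SimpleGraph α) : ℝ := 2 * (eCount H : ℝ) / (autCount H : ℝ)

/-- The sharp threshold `p*_H(n)` for `Q_H`. -/
def pStar (H : SimpleGraph α) (n : ℕ) : ℝ :=
  (n : ℝ) ^ (-(1 / m2 H)) *
    ((2 - 1 / m2 H) * (rho H)⁻¹ * Real.log n) ^ (1 / ((eCount H : ℝ) - 1))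

/-- `Λ^p = ϱ(H)·(n-2)_{v_H-2}·p^{e_H-1}`, the expected number of copies of `H` on a
fixed edge. -/
def Lambda (H : SimpleGraph α) (n : ℕ) (p : ℝ) : ℝ :=
  rho H * ((n - 2).descFactorial (Nat.card α - 2) : ℝ) * p ^ (eCount H - 1)

/-- `H` is isomorphic neither to the two-edge path nor to the triangle. -/
def NotPathOrTriangle (H : SimpleGraph α) : Prop :=
  ¬ Nonempty (H ≃g SimpleGraph.pathGraph 3) ∧ ¬ Nonempty (H ≃g (⊤ : SimpleGraph (Fin 3)))

/-! ### Bridges -/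

/-- `G` together with the edge `xy`. -/
def bridgeHost (G : SimpleGraph V) (x y : V) : SimpleGraph V :=
  G ⊔ SimpleGraph.fromEdgeSet {s(x, y)}

/-- A copy of `H` in `G ∪ {xy}` containing the edge `xy`; such copies correspond to the
`xy`-bridges `K - xy` of `G`. -/
def IsBridgeCopy (H : SimpleGraph α) (G : SimpleGraph V) (x y : V)
    (K : (bridgeHost G x y).Subgraph) : Prop :=
  Nonempty (H ≃g K.coe) ∧ s(x, y) ∈ K.edgeSet

/-- `τ_G(x,y)`: the number of `xy`-bridges in `G`. -/
def tauB (H : SimpleGraph α) (G : SimpleGraph V) (x y : V) : ℕ :=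
  Nat.card {K : (bridgeHost G x y).Subgraph // IsBridgeCopy H G x y K}

/-- `σ_G(x,y)`: the maximum size of a family of internally disjoint `xy`-bridges in `G`. -/
def sigmaB (H : SimpleGraph α) (G : SimpleGraph V) (x y : V) : ℕ :=
  sSup {m | ∃ T : Finset ((bridgeHost G x y).Subgraph),
    (∀ K ∈ T, IsBridgeCopy H G x y K) ∧
    (∀ K ∈ T, ∀ K' ∈ T, K ≠ K' → (K.verts ∩ K'.verts : Set V) ⊆ {x, y}) ∧ T.card = m}

/-- An `S`-central `xy`-bridge: the bridge contains an odd number of edges of `S`, at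
least one of which misses `{x,y}`. -/
def IsCentralBridge (H : SimpleGraph α) (G : SimpleGraph V) (S : Set (Sym2 V)) (x y : V)
    (K : (bridgeHost G x y).Subgraph) : Prop :=
  IsBridgeCopy H G x y K ∧
  Odd (Nat.card {e : Sym2 V // e ∈ K.edgeSet ∧ e ≠ s(x, y) ∧ e ∈ S}) ∧
  ∃ e ∈ K.edgeSet, e ∈ S ∧ x ∉ e ∧ y ∉ e

/-- `σ_G(xy; S)`: the maximum size of a family of internally disjoint `S`-central
`xy`-bridges in `G`. -/
def sigmaCentral (H : SimpleGraph α) (G : SimpleGraph V) (S : Set (Sym2 V)) (x y : V) : ℕ :=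
  sSup {m | ∃ T : Finset ((bridgeHost G x y).Subgraph),
    (∀ K ∈ T, IsCentralBridge H G S x y K) ∧
    (∀ K ∈ T, ∀ K' ∈ T, K ≠ K' → (K.verts ∩ K'.verts : Set V) ⊆ {x, y}) ∧ T.card = m}

/-! ### Extensions `[W,Z]` -/

/-- The adjacency relation of the pair `[W,Z]` in `F`: edges of `F[Z]` which do not lie
inside `W`. -/
def PairAdj (F : SimpleGraph β) (W Z : Set β) (a b : ↥Z) : Prop :=
  F.Adj (a : β) (b : β) ∧ ¬((a : β) ∈ W ∧ (b : β) ∈ W)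

/-- `v(W,Z)`: the number of internal vertices of `[W,Z]`. -/
def vWZ (W Z : Set β) : ℕ := Nat.card ↥(Z \ W)

/-- `e(W,Z)`: the number of edges of `[W,Z]`. -/
def eWZ (F : SimpleGraph β) (W Z : Set β) : ℕ :=
  Nat.card {q : Sym2 β // q ∈ F.edgeSet ∧ (∀ a ∈ q, a ∈ Z) ∧ ¬(∀ a ∈ q, a ∈ W)}

/-- `d(W,Z) = e(W,Z)/v(W,Z)`. -/
def dWZ (F : SimpleGraph β) (W Z : Set β) : ℝ := (eWZ F W Z : ℝ) / (vWZ W Z : ℝ)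

/-- `[W,Z]` is strictly balanced. -/
def StrictlyBalancedWZ (F : SimpleGraph β) (W Z : Set β) : Prop :=
  ∀ Y : Set β, W ⊂ Y → Y ⊂ Z → dWZ F W Y < dWZ F W Z

/-- `m(W,Z) = max{d(W,Y) : W ⊊ Y ⊆ Z}`. -/
def mWZ (F : SimpleGraph β) (W Z : Set β) : ℝ :=
  sSup {x : ℝ | ∃ Y : Set β, W ⊂ Y ∧ Y ⊆ Z ∧ x = dWZ F W Y}

/-- `aut[W,Z]`: the number of automorphisms of `[W,Z]` fixing `W` pointwise. -/
def autWZ (F : SimpleGraph β) (W Z : Set β) : ℕ :=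
  Nat.card {γ : ↥Z ≃ ↥Z // (∀ w : ↥Z, (w : β) ∈ W → γ w = w) ∧
    ∀ a b : ↥Z, PairAdj F W Z a b ↔ PairAdj F W Z (γ a) (γ b)}

/-- `μ_p(W,Z) = n^{v(W,Z)}·p^{e(W,Z)}/aut[W,Z]`. -/
def muWZ (F : SimpleGraph β) (W Z : Set β) (n : ℕ) (p : ℝ) : ℝ :=
  (n : ℝ) ^ (vWZ W Z) * p ^ (eWZ F W Z) / (autWZ F W Z : ℝ)

/-- A `[W,Z]`-extension on the tuple `x` in `G`. -/
def IsExt (F : SimpleGraph β) (W Z : Set β) (G : SimpleGraph V) (x : ↥W → V)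
    (ψ : ↥Z → V) : Prop :=
  Function.Injective ψ ∧
  (∀ (w : ↥Z) (hw : (w : β) ∈ W), ψ w = x ⟨(w : β), hw⟩) ∧
  ∀ a b : ↥Z, PairAdj F W Z a b → G.Adj (ψ a) (ψ b)

/-- The data (internal vertex image, edge image) of an extension; two extensions are
equivalent (give the same copy) iff they have the same data. -/
def extData (F : SimpleGraph β) (W Z : Set β) (ψ : ↥Z → V) : Set V × Set (Sym2 V) :=
  (ψ '' {z : ↥Z | (z : β) ∉ W},
   {q | ∃ a b : ↥Z, PairAdj F W Z a b ∧ q = s(ψ a, ψ b)})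

/-- The set of copies of `[W,Z]` on `x` in `G`. -/
def copySet (F : SimpleGraph β) (W Z : Set β) (G : SimpleGraph V) (x : ↥W → V) :
    Set (Set V × Set (Sym2 V)) :=
  {d | ∃ ψ : ↥Z → V, IsExt F W Z G x ψ ∧ extData F W Z ψ = d}

/-- `τ_{[W,Z]}(G,X)`: the number of copies of `[W,Z]` on `x` in `G`. -/
def tauExt (F : SimpleGraph β) (W Z : Set β) (G : SimpleGraph V) (x : ↥W → V) : ℕ :=
  Nat.card ↥(copySet F W Z G x)

/-- `σ_{[W,Z]}(G,X)`: the maximum size of a family of internally disjoint copies of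
`[W,Z]` on `x` in `G`. -/
def sigmaExt (F : SimpleGraph β) (W Z : Set β) (G : SimpleGraph V) (x : ↥W → V) : ℕ :=
  sSup {m | ∃ T : Finset (Set V × Set (Sym2 V)),
    (↑T : Set (Set V × Set (Sym2 V))) ⊆ copySet F W Z G x ∧
    (∀ d ∈ T, ∀ d' ∈ T, d ≠ d' → d.1 ∩ d'.1 = ∅) ∧ T.card = m}

/-- `φ(x) = (1+x)log(1+x) - x` for `x > -1`, with `φ(-1) = 1`. -/
def phiFn (x : ℝ) : ℝ := if x = -1 then 1 else (1 + x) * Real.log (1 + x) - x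


section aux

variable {V : Type*} [Fintype V] [DecidableEq V]

lemma aux_decomp {M : Type*} [AddCommGroup M] [Module (ZMod 2) M]
    (hV : 4 ≤ Fintype.card V) (g : V → V → M) (gs : ∀ x y, g x y = g y x)
    (hg : ∀ x y z w, x ≠ y → x ≠ z → x ≠ w → y ≠ z → y ≠ w → z ≠ w →
      g x y + g z y + g x w + g z w = 0) :
    ∃ (h : V → M) (c : M), ∀ x y, x ≠ y → g x y = h x + h y + c := by
  have two : ∀ m : M, m + m = 0 := fun m => ZModModule.add_self m
  have ex : ∀ x y z : V, ∃ w, w ≠ x ∧ w ≠ y ∧ w ≠ z := by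
    intro x y z
    obtain ⟨w, hw⟩ : ∃ w, w ∉ ({x, y, z} : Finset V) := by
      by_contra! hc
      have h1 : Fintype.card V ≤ 3 := by
        rw [← Finset.card_univ]
        calc _ ≤ ({x, y, z} : Finset V).card := Finset.card_le_card fun a _ => hc a
          _ ≤ 3 := Finset.card_le_three
      omega
    simp only [Finset.mem_insert, Finset.mem_singleton, not_or] at hw
    exact ⟨w, hw.1, hw.2.1, hw.2.2⟩
  have key : ∀ x z y w, y ≠ x → y ≠ z → w ≠ x → w ≠ z → g x y + g z y = g x w + g z w := by
    intro x z y w h1 h2 h3 h4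
    by_cases hxz : x = z
    · subst hxz; rw [two, two]
    by_cases hyw : y = w
    · rw [hyw]
    have := hg x y z w h1.symm hxz h3.symm h2 hyw h4.symm
    have h5 := two (g x w + g z w)
    rw [add_assoc] at this
    exact (eq_neg_of_add_eq_zero_left this).trans (eq_neg_of_add_eq_zero_left h5).symm
  choose ch hch using fun x z => ex x z z
  have hd : ∃ d : V → V → M, ∀ x z y, y ≠ x → y ≠ z → d x z = g x y + g z y :=
    ⟨fun x z => g x (ch x z) + g z (ch x z),
      fun x z y h1 h2 => key x z _ _ (hch x z).1 (hch x z).2.1 h1 h2⟩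
  obtain ⟨d, hd⟩ := hd
  have dd : ∀ x y z, d x z = d x y + d y z := by
    intro x y z
    obtain ⟨w, h1, h2, h3⟩ := ex x y z
    rw [hd x z w h1 h3, hd x y w h1 h2, hd y z w h2 h3]
    calc g x w + g z w = g x w + g z w + (g y w + g y w) := by rw [two, add_zero]
      _ = _ := by abel
  have dg : ∀ x z y, y ≠ x → y ≠ z → g x y = d x z + g z y := by
    intro x z y h1 h2
    rw [hd x z y h1 h2, add_assoc, two, add_zero]
  obtain ⟨p⟩ : Nonempty V := Fintype.card_pos_iff.mp (by omega)
  obtain ⟨q, hq, -⟩ := ex p p p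
  have main : ∀ x y, x ≠ y → y ≠ p → g x y = d x p + d y p + (d p q + g q p) := by
    intro x y hxy hyp
    rw [dg x p y hxy.symm hyp, gs p y, dg y q p hyp.symm hq.symm, dd y p q]
    abel
  refine ⟨fun x => d x p, d p q + g q p, fun x y hxy => ?_⟩
  by_cases hy : y = p
  · rw [gs, main y x hxy.symm (by rw [← hy]; exact hxy)]
    simp only []
    abel
  · exact main x y hxy hy

lemma setVec_single (e : Sym2 V) : setVec {e} = (Pi.single e 1 : EdgeVec V) := by
  funext x
  by_cases h : x = e
  · subst h; simp [setVec]
  · simp [setVec, h]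

lemma parity_single (v : V) (e : Sym2 V) (he : ¬ e.IsDiag) :
    parityMap v (Pi.single e 1) = if v ∈ e then 1 else 0 := by
  induction e with
  | h x y =>
  simp only [Sym2.mk_isDiag_iff] at he
  change ∑ w ∈ Finset.univ.erase v, (Pi.single s(x, y) 1 : EdgeVec V) s(v, w) = _
  by_cases hx : v = x
  · subst hx
    rw [Finset.sum_eq_single y]
    · simp
    · intro b _ hb
      rw [Pi.single_eq_of_ne]
      simp only [ne_eq, Sym2.eq_iff]; grind
    · intro h; simp at h; exact absurd h.symm he
  by_cases hy : v = y
  · subst hy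
    rw [Finset.sum_eq_single x]
    · simp [Sym2.eq_swap]
    · intro b _ hb
      rw [Pi.single_eq_of_ne]
      simp only [ne_eq, Sym2.eq_iff]; grind
    · intro h; simp at h; exact absurd h he
  · rw [if_neg (by simp [hx, hy])]
    apply Finset.sum_eq_zero
    intro b _
    rw [Pi.single_eq_of_ne]
    simp only [ne_eq, Sym2.eq_iff]; grind

lemma total_single (e : Sym2 V) :
    totalMap (Pi.single e 1 : EdgeVec V) = 1 := by
  change ∑ x, (Pi.single e 1 : EdgeVec V) x = 1
  simp

lemma formula {M : Type*} [AddCommGroup M] [Module (ZMod 2) M]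
    (L : EdgeVec V →ₗ[ZMod 2] M) (h : V → M) (c : M)
    (hL : ∀ x y, x ≠ y → L (Pi.single s(x, y) 1) = h x + h y + c)
    (f : EdgeVec V) (hf : f ∈ edgeSpace (⊤ : SimpleGraph V)) :
    L f = ∑ v, parityMap v f • h v + totalMap f • c := by
  unfold edgeSpace at hf
  induction hf using Submodule.span_induction with
  | mem f hf =>
    obtain ⟨e, he, rfl⟩ := hf
    rw [setVec_single]
    induction e with
    | h x y =>
    have hxy : x ≠ y := by simpa using he
    rw [hL x y hxy, total_single, one_smul]
    congr 1
    have : ∀ v, (parityMap v (Pi.single s(x, y) 1 : EdgeVec V)) • h v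
        = if v ∈ ({x, y} : Finset V) then h v else 0 := by
      intro v
      rw [parity_single v _ (by simpa using hxy)]
      by_cases hv : v ∈ s(x, y)
      · rw [if_pos hv, if_pos (by simpa using hv), one_smul]
      · rw [if_neg hv, if_neg (by simpa using hv), zero_smul]
    rw [Finset.sum_congr rfl fun v _ => this v, Finset.sum_ite_mem, Finset.univ_inter,
      Finset.sum_pair hxy]
  | zero => simp
  | add f g _ _ h1 h2 =>
    rw [map_add, h1, h2]
    simp only [map_add, add_smul, Finset.sum_add_distrib]
    abel
  | smul a f _ h1 =>
    rw [map_smul, h1]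
    simp only [map_smul, smul_add, Finset.smul_sum, smul_assoc]

/-- The vector of a copy of `H` given by a map of vertices. -/
def copyVec [Fintype α] (H : SimpleGraph α) (φ : α → V) : EdgeVec V :=
  ∑ e ∈ H.edgeFinset, Pi.single (e.map φ) 1

lemma copyVec_eq [Fintype α] (H : SimpleGraph α) (φ : α → V) (hφ : Function.Injective φ) :
    copyVec H φ = setVec (Sym2.map φ '' H.edgeSet) := by
  funext x
  simp only [copyVec, Finset.sum_apply, setVec]
  by_cases hx : x ∈ Sym2.map φ '' H.edgeSet
  · rw [if_pos hx]
    obtain ⟨e, he, rfl⟩ := hx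
    rw [Finset.sum_eq_single e]
    · simp
    · intro b _ hb
      rw [Pi.single_eq_of_ne]
      exact fun h => hb (Sym2.map.injective hφ h).symm
    · intro h; simp at h; exact absurd he h
  · rw [if_neg hx]
    apply Finset.sum_eq_zero
    intro e he
    rw [Pi.single_eq_of_ne]
    rintro rfl
    exact hx ⟨e, by simpa using he, rfl⟩

lemma copy_nondiag [Fintype α] (H : SimpleGraph α) (φ : α → V) (hφ : Function.Injective φ)
    (e : Sym2 α) (he : e ∈ H.edgeFinset) : ¬ (e.map φ).IsDiag := by
  induction e with
  | h x y =>
    have : H.Adj x y := by simpa using he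
    simpa using fun h => this.ne (hφ h)

lemma copy_mem_edge [Fintype α] (H : SimpleGraph α) (φ : α → V) (hφ : Function.Injective φ) :
    copyVec H φ ∈ edgeSpace (⊤ : SimpleGraph V) := by
  refine Submodule.sum_mem _ fun e he => Submodule.subset_span ⟨e.map φ, ?_, ?_⟩
  · simpa using copy_nondiag H φ hφ e he
  · rw [setVec_single]

lemma total_copy [Fintype α] (H : SimpleGraph α) (φ : α → V) :
    totalMap (copyVec H φ) = (eCount H : ZMod 2) := by
  simp only [copyVec, map_sum, total_single, eCount]
  simp [SimpleGraph.edgeFinset, Nat.card_eq_fintype_card]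

lemma parity_copy [Fintype α] (H : SimpleGraph α) (φ : α → V) (hφ : Function.Injective φ)
    (v : V) : parityMap v (copyVec H φ) =
      ∑ u, if φ u = v then (Nat.card (H.neighborSet u) : ZMod 2) else 0 := by
  simp only [copyVec, map_sum]
  rw [Finset.sum_congr rfl fun e he => parity_single v _ (copy_nondiag H φ hφ e he)]
  by_cases hv : ∃ u, φ u = v
  · obtain ⟨u, rfl⟩ := hv
    rw [Finset.sum_eq_single u (fun b _ hb => if_neg fun h => hb (hφ h)) (by simp), if_pos rfl]
    have : ∀ e : Sym2 α, φ u ∈ e.map φ ↔ u ∈ e := by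
      intro e
      simp only [Sym2.mem_map]
      exact ⟨fun ⟨a, h1, h2⟩ => hφ h2 ▸ h1, fun h => ⟨u, h, rfl⟩⟩
    simp only [this, Finset.sum_boole]
    rw [Nat.card_eq_fintype_card, SimpleGraph.card_neighborSet_eq_degree,
      ← SimpleGraph.card_incidenceFinset_eq_degree, SimpleGraph.incidenceFinset_eq_filter]
  · push Not at hv
    simp only [hv, if_false, Finset.sum_const_zero]
    apply Finset.sum_eq_zero
    intro e _
    rw [if_neg]
    simp only [Sym2.mem_map, not_exists, not_and]
    exact fun a _ => hv a

lemma hSpace_eq [Fintype α] (H : SimpleGraph α) :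
    hSpace H (⊤ : SimpleGraph V) =
      Submodule.span (ZMod 2) {f | ∃ φ : α → V, Function.Injective φ ∧ f = copyVec H φ} := by
  unfold hSpace
  congr 1
  ext f
  constructor
  · rintro ⟨K, ⟨i⟩, rfl⟩
    have hinj : Function.Injective (fun a => (i a : V)) :=
      Subtype.val_injective.comp i.injective
    refine ⟨fun a => (i a : V), hinj, ?_⟩
    rw [copyVec_eq _ _ hinj]
    congr 1
    ext e
    induction e with
    | h x y =>
    constructor
    · intro h
      have h : K.Adj x y := h
      refine ⟨s(i.symm ⟨x, K.edge_vert h⟩, i.symm ⟨y, K.edge_vert h.symm⟩), ?_, by simp⟩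
      rw [SimpleGraph.mem_edgeSet, i.symm.map_adj_iff]
      simpa using h
    · rintro ⟨e, he, h2⟩
      rw [← h2]
      induction e with
      | h a b =>
      have := i.map_adj_iff.mpr he
      simpa using this
  · rintro ⟨φ, hφ, rfl⟩
    let k : Copy H (⊤ : SimpleGraph V) :=
      ⟨⟨φ, fun h => by simpa using fun h' => h.ne (hφ h')⟩, hφ⟩
    refine ⟨k.toSubgraph, ⟨k.isoToSubgraph⟩, ?_⟩
    rw [copyVec_eq _ _ hφ]
    congr 1
    ext e
    induction e with
    | h x y =>
    simp [Copy.toSubgraph, k]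

lemma exists_place [Fintype α] (hn : Fintype.card α + 2 ≤ Fintype.card V) (a b : α) (hab : a ≠ b)
    (x y z w : V) (h1 : x ≠ y) (h2 : x ≠ z) (h3 : x ≠ w) (h4 : y ≠ z) (h5 : y ≠ w) (h6 : z ≠ w) :
    ∃ φ : α → V, Function.Injective φ ∧ φ a = x ∧ φ b = y ∧ ∀ u, φ u ≠ z ∧ φ u ≠ w := by
  obtain ⟨Ψ⟩ : Nonempty (α ⊕ Fin 2 ↪ V) :=
    Function.Embedding.nonempty_of_card_le (by simpa using hn)
  let e1 : Fin 4 ↪ V := ⟨![Ψ (.inl a), Ψ (.inl b), Ψ (.inr 0), Ψ (.inr 1)], by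
    intro i j; fin_cases i <;> fin_cases j <;> simp [hab, hab.symm]⟩
  let e2 : Fin 4 ↪ V := ⟨![x, y, z, w], by
    intro i j; fin_cases i <;> fin_cases j <;> simp [*, Ne.symm, h1.symm, h2.symm, h3.symm, h4.symm, h5.symm, h6.symm]⟩
  have := Equiv.Perm.isMultiplyPretransitive V 4
  obtain ⟨g, hg⟩ := MulAction.exists_smul_eq (Equiv.Perm V) e1 e2
  have hg' : ∀ i, g (e1 i) = e2 i := fun i => by rw [← hg]; rfl
  have g0 : g (Ψ (.inl a)) = x := hg' 0
  have g1 : g (Ψ (.inl b)) = y := hg' 1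
  have g2 : g (Ψ (.inr 0)) = z := hg' 2
  have g3 : g (Ψ (.inr 1)) = w := hg' 3
  refine ⟨fun u => g (Ψ (.inl u)), ?_, g0, g1, ?_⟩
  · intro u v h; simpa using h
  · intro u
    rw [← g2, ← g3]
    simp

lemma four_cycle [Fintype α] (H : SimpleGraph α) (hn : Fintype.card α + 2 ≤ Fintype.card V)
    (a b : α) (hab : H.Adj a b) {M : Type*} [AddCommGroup M] [Module (ZMod 2) M]
    (L : EdgeVec V →ₗ[ZMod 2] M)
    (hL : ∀ φ : α → V, Function.Injective φ → L (copyVec H φ) = 0)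
    (x y z w : V) (h1 : x ≠ y) (h2 : x ≠ z) (h3 : x ≠ w) (h4 : y ≠ z) (h5 : y ≠ w) (h6 : z ≠ w) :
    L (Pi.single s(x, y) 1) + L (Pi.single s(z, y) 1) + L (Pi.single s(x, w) 1)
      + L (Pi.single s(z, w) 1) = 0 := by
  have two : ∀ m : M, m + m = 0 := fun m => ZModModule.add_self m
  obtain ⟨φ, hφ, ha, hb, hu⟩ := exists_place hn a b hab.ne x y z w h1 h2 h3 h4 h5 h6
  set σ := Equiv.swap x z with hσ
  set τ := Equiv.swap y w with hτ
  have e0 := hL φ hφ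
  have e1 := hL (fun u => σ (φ u)) (σ.injective.comp hφ)
  have e2 := hL (fun u => τ (φ u)) (τ.injective.comp hφ)
  have e3 := hL (fun u => σ (τ (φ u))) (σ.injective.comp (τ.injective.comp hφ))
  have hs : ∀ u, u ≠ a → σ (φ u) = φ u := fun u hne =>
    Equiv.swap_apply_of_ne_of_ne (fun h => hne (hφ (h.trans ha.symm))) (hu u).1
  have ht : ∀ u, u ≠ b → τ (φ u) = φ u := fun u hne =>
    Equiv.swap_apply_of_ne_of_ne (fun h => hne (hφ (h.trans hb.symm))) (hu u).2
  have hsw : σ w = w := Equiv.swap_apply_of_ne_of_ne h3.symm h6.symm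
  have hsa : σ (φ a) = z := by rw [ha]; exact Equiv.swap_apply_left _ _
  have htb : τ (φ b) = w := by rw [hb]; exact Equiv.swap_apply_left _ _
  have tot : L (copyVec H φ) + L (copyVec H fun u => σ (φ u)) + L (copyVec H fun u => τ (φ u))
     + L (copyVec H fun u => σ (τ (φ u))) = 0 := by rw [e0, e1, e2, e3]; simp
  simp only [copyVec, map_sum] at tot
  rw [← Finset.sum_add_distrib, ← Finset.sum_add_distrib, ← Finset.sum_add_distrib,
    Finset.sum_eq_single s(a, b)] at tot
  · simp only [Sym2.map_mk] at tot
    rw [hs b hab.ne.symm, ht a hab.ne, hsa, htb, hsw, ha, hb] at tot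
    exact tot
  · intro e he hne
    have hor : (∀ u ∈ e, u ≠ a) ∨ (∀ u ∈ e, u ≠ b) := by
      induction e with
      | h p q => 
        have hpq : H.Adj p q := by simpa using he
        have := hpq.ne
        simp only [Sym2.mem_iff, ne_eq, Sym2.eq_iff] at hne ⊢
        grind
    rcases hor with hor | hor
    · have q1 : Sym2.map (fun u => σ (φ u)) e = Sym2.map φ e :=
        Sym2.map_congr fun u hu' => hs u (hor u hu')
      have q2 : Sym2.map (fun u => σ (τ (φ u))) e = Sym2.map (fun u => τ (φ u)) e := by
        refine Sym2.map_congr fun u hu' => ?_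
        by_cases hub : u = b
        · rw [hub, htb, hsw]
        · rw [ht u hub, hs u (hor u hu')]
      rw [q1, q2, two, zero_add, two]
    · have q1 : Sym2.map (fun u => τ (φ u)) e = Sym2.map φ e :=
        Sym2.map_congr fun u hu' => ht u (hor u hu')
      have q2 : Sym2.map (fun u => σ (τ (φ u))) e = Sym2.map (fun u => σ (φ u)) e :=
        Sym2.map_congr fun u hu' => by rw [ht u (hor u hu')]
      rw [q1, q2]
      calc _ = (L (Pi.single (e.map φ) 1) + L (Pi.single (e.map φ) 1)) +
            (L (Pi.single (e.map (fun u => σ (φ u))) 1)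
              + L (Pi.single (e.map (fun u => σ (φ u))) 1)) := by abel
        _ = 0 := by rw [two, two, add_zero]
  · intro h
    exact absurd (by simpa using hab) h

lemma sum_parity [Fintype α] (H : SimpleGraph α) (φ : α → V) (hφ : Function.Injective φ)
    {M : Type*} [AddCommGroup M] [Module (ZMod 2) M] (h : V → M) :
    ∑ v, parityMap v (copyVec H φ) • h v =
      ∑ u, (Nat.card (H.neighborSet u) : ZMod 2) • h (φ u) := by
  simp only [parity_copy H φ hφ, Finset.sum_smul, ite_smul, zero_smul]
  rw [Finset.sum_comm]
  simp

/-- The structure of linear maps killing all copies of `H`. -/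
lemma structure_lemma [Fintype α] (H : SimpleGraph α)
    (hn : Fintype.card α + 2 ≤ Fintype.card V)
    (a b : α) (hab : H.Adj a b) {M : Type*} [AddCommGroup M] [Module (ZMod 2) M]
    (L : EdgeVec V →ₗ[ZMod 2] M)
    (hL : ∀ φ : α → V, Function.Injective φ → L (copyVec H φ) = 0) :
    ∃ (h : V → M) (c : M), (∀ f ∈ edgeSpace (⊤ : SimpleGraph V),
        L f = ∑ v, parityMap v f • h v + totalMap f • c) ∧
      (¬ IsEulerianGraph H → ∀ v, h v = 0) ∧ (Odd (eCount H) → c = 0) := by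
  have two : ∀ m : M, m + m = 0 := fun m => ZModModule.add_self m
  have hα : 1 < Fintype.card α := Fintype.one_lt_card_iff.mpr ⟨a, b, hab.ne⟩
  obtain ⟨φ0⟩ : Nonempty (α ↪ V) := Function.Embedding.nonempty_of_card_le (by omega)
  have fin : ∀ (h : V → M) (c : M), (∀ f ∈ edgeSpace (⊤ : SimpleGraph V),
        L f = ∑ v, parityMap v f • h v + totalMap f • c) →
        (∑ u, (Nat.card (H.neighborSet u) : ZMod 2) • h (φ0 u) = 0) → 
        (Odd (eCount H) → c = 0) := by
    intro h c hf h0 hodd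
    have := hf _ (copy_mem_edge H φ0 φ0.injective)
    rw [hL _ φ0.injective, sum_parity _ _ φ0.injective, h0, total_copy,
      ZMod.natCast_eq_one_iff_odd.mpr hodd, one_smul, zero_add] at this
    exact this.symm
  obtain ⟨h, c, hc⟩ := aux_decomp (by omega) (fun x y : V => L (Pi.single s(x, y) 1))
    (fun x y => by rw [Sym2.eq_swap]) (four_cycle H hn a b hab L hL)
  have hF := formula L h c hc
  by_cases hEu : IsEulerianGraph H
  · refine ⟨h, c, hF, fun hne => absurd hEu hne, fin h c hF ?_⟩
    apply Finset.sum_eq_zero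
    intro u _
    rw [ZMod.natCast_eq_zero_iff_even.mpr (hEu u), zero_smul]
  · have hcon : ∀ x z, x ≠ z → h x = h z := by
      intro x z hxz
      unfold IsEulerianGraph at hEu
      push Not at hEu
      obtain ⟨u, hu⟩ := hEu
      rw [Nat.not_even_iff_odd] at hu
      obtain ⟨u', hu'⟩ : ∃ u', u' ≠ u := Fintype.exists_ne_of_one_lt_card hα u
      obtain ⟨y, hy⟩ : ∃ y, y ∉ ({x, z} : Finset V) := by
        by_contra! hcc
        have : Fintype.card V ≤ 2 := by
          rw [← Finset.card_univ]
          exact (Finset.card_le_card fun a _ => hcc a).trans Finset.card_le_two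
        omega
      obtain ⟨w, hw⟩ : ∃ w, w ∉ ({x, z, y} : Finset V) := by
        by_contra! hcc
        have : Fintype.card V ≤ 3 := by
          rw [← Finset.card_univ]
          exact (Finset.card_le_card fun a _ => hcc a).trans Finset.card_le_three
        omega
      simp only [Finset.mem_insert, Finset.mem_singleton, not_or] at hy hw
      obtain ⟨φ, hφ, ha, -, hzw⟩ := exists_place hn u u' hu'.symm x y z w (Ne.symm hy.1) hxz
        (Ne.symm hw.1) hy.2 (Ne.symm hw.2.2) (Ne.symm hw.2.1)
      have hψ : Function.Injective fun u => Equiv.swap x z (φ u) :=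
        (Equiv.swap x z).injective.comp hφ
      have p1 := hF _ (copy_mem_edge H φ hφ)
      have p2 := hF _ (copy_mem_edge H _ hψ)
      rw [hL _ hφ, sum_parity _ _ hφ, total_copy] at p1
      rw [hL _ hψ, sum_parity _ _ hψ, total_copy] at p2
      have p3 := add_right_cancel (p1.symm.trans p2)
      rw [← Finset.add_sum_erase _ _ (Finset.mem_univ u),
        ← Finset.add_sum_erase (a := u) _ _ (Finset.mem_univ u)] at p3
      have p4 : ∀ v ∈ Finset.univ.erase u, (Nat.card (H.neighborSet v) : ZMod 2) • 
          h (Equiv.swap x z (φ v)) = (Nat.card (H.neighborSet v) : ZMod 2) • h (φ v) := by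
        intro v hv
        rw [Equiv.swap_apply_of_ne_of_ne _ (hzw v).1]
        intro hh
        exact (Finset.ne_of_mem_erase hv) (hφ (hh.trans ha.symm))
      rw [Finset.sum_congr rfl p4] at p3
      have p5 := add_right_cancel p3
      rw [ha, Equiv.swap_apply_left, ZMod.natCast_eq_one_iff_odd.mpr hu, one_smul,
        one_smul] at p5
      exact p5
    have hc' : ∀ x y : V, x ≠ y → L (Pi.single s(x, y) 1) = (0 : V → M) x + (0 : V → M) y + c := by
      intro x y hxy
      rw [hc x y hxy, hcon x y hxy, two]
      simp
    have hF' := formula L 0 c hc'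
    exact ⟨0, c, hF', fun _ _ => rfl, fin 0 c hF' (by simp)⟩

end aux

/-- Theorem 1.1: for any graph `H` with at least one edge and
`n ≥ v_H + 2`, the `H`-space of `K_n` equals its natural value. -/
theorem stmt0 {α : Type*} [Fintype α] (H : SimpleGraph α) (hE : 1 ≤ eCount H)
    (n : ℕ) (hn : Nat.card α + 2 ≤ n) :
    hSpace H (⊤ : SimpleGraph (Fin n)) =
      (if IsEulerianGraph H then
        (if Odd (eCount H) then cycleSpace (⊤ : SimpleGraph (Fin n))
         else cycleSpace (⊤ : SimpleGraph (Fin n)) ⊓ dSpace (⊤ : SimpleGraph (Fin n)))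
      else
        (if Odd (eCount H) then edgeSpace (⊤ : SimpleGraph (Fin n))
         else dSpace (⊤ : SimpleGraph (Fin n)))) := by
  obtain ⟨e0, he0⟩ : H.edgeSet.Nonempty := by
    by_contra hne
    rw [Set.not_nonempty_iff_eq_empty] at hne
    simp [eCount, hne] at hE
  obtain ⟨a, b, hab⟩ : ∃ a b, H.Adj a b := by
    induction e0 with
    | h a b => exact ⟨a, b, he0⟩
  have hn' : Fintype.card α + 2 ≤ Fintype.card (Fin n) := by
    simpa [Nat.card_eq_fintype_card] using hn
  set S := hSpace H (⊤ : SimpleGraph (Fin n)) with hS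
  have hS' := hSpace_eq (V := Fin n) H
  rw [← hS] at hS'
  have hmem : ∀ φ : α → Fin n, Function.Injective φ → copyVec H φ ∈ S := fun φ hφ => by
    rw [hS']; exact Submodule.subset_span ⟨φ, hφ, rfl⟩
  obtain ⟨h, c, hF, h0, c0⟩ := structure_lemma (V := Fin n) H hn' a b hab S.mkQ
    (fun φ hφ => by simpa using hmem φ hφ)
  have hE1 : S ≤ edgeSpace (⊤ : SimpleGraph (Fin n)) := by
    rw [hS', Submodule.span_le]
    rintro f ⟨φ, hφ, rfl⟩
    exact copy_mem_edge H φ hφ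
  have hC : IsEulerianGraph H → S ≤ cycleSpace (⊤ : SimpleGraph (Fin n)) := by
    intro hEu
    refine le_inf hE1 (le_iInf fun v => ?_)
    rw [hS', Submodule.span_le]
    rintro f ⟨φ, hφ, rfl⟩
    rw [SetLike.mem_coe, LinearMap.mem_ker, parity_copy H φ hφ]
    apply Finset.sum_eq_zero
    intro u _
    rw [ZMod.natCast_eq_zero_iff_even.mpr (hEu u), ite_self]
  have hD : ¬ Odd (eCount H) → S ≤ dSpace (⊤ : SimpleGraph (Fin n)) := by
    intro hev
    refine le_inf hE1 ?_
    rw [hS', Submodule.span_le]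
    rintro f ⟨φ, hφ, rfl⟩
    rw [SetLike.mem_coe, LinearMap.mem_ker, total_copy,
      ZMod.natCast_eq_zero_iff_even.mpr (Nat.not_odd_iff_even.mp hev)]
  have hback : ∀ f ∈ edgeSpace (⊤ : SimpleGraph (Fin n)),
      ((∀ v, parityMap v f = 0) ∨ ¬ IsEulerianGraph H) →
      (totalMap f = 0 ∨ Odd (eCount H)) → f ∈ S := by
    intro f hf h1 h2
    rw [← Submodule.Quotient.mk_eq_zero, ← Submodule.mkQ_apply, hF f hf]
    have q1 : ∑ v, parityMap v f • h v = 0 := by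
      apply Finset.sum_eq_zero
      intro v _
      rcases h1 with h1 | h1
      · rw [h1 v, zero_smul]
      · rw [h0 h1 v, smul_zero]
    have q2 : totalMap f • c = 0 := by
      rcases h2 with h2 | h2
      · rw [h2, zero_smul]
      · rw [c0 h2, smul_zero]
    rw [q1, q2, add_zero]
  have hcyc : ∀ f ∈ cycleSpace (⊤ : SimpleGraph (Fin n)), ∀ v, parityMap v f = 0 := by
    intro f hf v
    exact (Submodule.mem_iInf _).mp hf.2 v
  by_cases hEu : IsEulerianGraph H
  · rw [if_pos hEu]
    by_cases ho : Odd (eCount H)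
    · rw [if_pos ho]
      exact le_antisymm (hC hEu) fun f hf => hback f hf.1 (Or.inl (hcyc f hf)) (Or.inr ho)
    · rw [if_neg ho]
      exact le_antisymm (le_inf (hC hEu) (hD ho)) fun f hf =>
        hback f hf.1.1 (Or.inl (hcyc f hf.1)) (Or.inl hf.2.2)
  · rw [if_neg hEu]
    by_cases ho : Odd (eCount H)
    · rw [if_pos ho]
      exact le_antisymm hE1 fun f hf => hback f hf (Or.inr hEu) (Or.inr ho)
    · rw [if_neg ho]
      exact le_antisymm (hD ho) fun f hf => hback f hf.1 (Or.inr hEu) (Or.inl hf.2)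

end RG
end
end

section
/- Let H be a fixed strictly 2-balanced graph other than the two-edge path and the triangle, let c > 0 be fixed, and let p = p(n) ∈ [0,1] satisfy p(n)·n^{1/m₂(H)} → ∞. Then w.h.p. the random graph G = G_{n,p(n)} satisfies: either C_H(G) = W_H(G), or there exists X ∈ C_H^⊥(G) ∖ W_H^⊥(G) with |X| < c·n²·p(n). -/
open Finset SimpleGraph Filter Topology

noncomputable section
open scoped Classical

namespace RG

variable {α β V : Type*}

section ProbPart

/-- Expectation of `F` over a random subset of `E` in which each element is kept with
probability `p` independently. -/
def EX {ι : Type*} (E : Finset ι) (p : ℝ) (F : Finset ι → ℝ) : ℝ :=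
  ∑ s ∈ E.powerset, p ^ s.card * (1 - p) ^ (E.card - s.card) * F s

lemma EX_congr {ι : Type*} {E : Finset ι} {p : ℝ} {F G : Finset ι → ℝ}
    (h : ∀ s ⊆ E, F s = G s) : EX E p F = EX E p G :=
  Finset.sum_congr rfl fun s hs => by rw [h s (Finset.mem_powerset.1 hs)]

lemma EX_mono {ι : Type*} {E : Finset ι} {p : ℝ} (h0 : 0 ≤ p) (h1 : p ≤ 1)
    {F G : Finset ι → ℝ} (h : ∀ s ⊆ E, F s ≤ G s) : EX E p F ≤ EX E p G :=
  Finset.sum_le_sum fun s hs => by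
    have := h s (Finset.mem_powerset.1 hs)
    have h2 : 0 ≤ 1 - p := by linarith
    gcongr

lemma EX_add {ι : Type*} (E : Finset ι) (p : ℝ) (F G : Finset ι → ℝ) :
    EX E p (fun s => F s + G s) = EX E p F + EX E p G := by
  simp [EX, mul_add, Finset.sum_add_distrib]

lemma EX_sub {ι : Type*} (E : Finset ι) (p : ℝ) (F G : Finset ι → ℝ) :
    EX E p (fun s => F s - G s) = EX E p F - EX E p G := by
  simp [EX, mul_sub, Finset.sum_sub_distrib]

lemma EX_mul {ι : Type*} (E : Finset ι) (p : ℝ) (c : ℝ) (F : Finset ι → ℝ) :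
    EX E p (fun s => c * F s) = c * EX E p F := by
  simp only [EX, Finset.mul_sum]
  exact Finset.sum_congr rfl fun s _ => by ring

lemma EX_sum {ι κ : Type*} (E : Finset ι) (p : ℝ) (I : Finset κ) (F : κ → Finset ι → ℝ) :
    EX E p (fun s => ∑ i ∈ I, F i s) = ∑ i ∈ I, EX E p (F i) := by
  simp only [EX, Finset.mul_sum]
  rw [Finset.sum_comm]

lemma EX_empty {ι : Type*} (p : ℝ) (F : Finset ι → ℝ) : EX ∅ p F = F ∅ := by
  simp [EX]

lemma EX_insert {ι : Type*} [DecidableEq ι] {E : Finset ι} {a : ι} (ha : a ∉ E) (p : ℝ)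
    (F : Finset ι → ℝ) :
    EX (insert a E) p F = (1 - p) * EX E p F + p * EX E p (fun s => F (insert a s)) := by
  unfold EX
  rw [Finset.sum_powerset_insert ha, Finset.mul_sum, Finset.mul_sum]
  congr 1
  · refine Finset.sum_congr rfl fun s hs => ?_
    have hs' := Finset.card_le_card (Finset.mem_powerset.1 hs)
    rw [Finset.card_insert_of_notMem ha, Nat.sub_add_comm hs', pow_succ]
    ring
  · refine Finset.sum_congr rfl fun s hs => ?_
    have has : a ∉ s := fun h => ha (Finset.mem_powerset.1 hs h)
    rw [Finset.card_insert_of_notMem ha, Finset.card_insert_of_notMem has,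
      Nat.add_sub_add_right, pow_succ]
    ring

lemma EX_const {ι : Type*} [DecidableEq ι] (E : Finset ι) (p : ℝ) (c : ℝ) :
    EX E p (fun _ => c) = c := by
  induction E using Finset.induction_on with
  | empty => exact EX_empty p _
  | insert a E ha ih => rw [EX_insert ha, ih]; ring

lemma EX_nonneg {ι : Type*} {E : Finset ι} {p : ℝ} (h0 : 0 ≤ p) (h1 : p ≤ 1)
    {F : Finset ι → ℝ} (h : ∀ s ⊆ E, 0 ≤ F s) : 0 ≤ EX E p F :=
  Finset.sum_nonneg fun s hs => by
    have := h s (Finset.mem_powerset.1 hs)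
    have h2 : 0 ≤ 1 - p := by linarith
    positivity

/-- Two-round exposure. -/
lemma EX_union {ι : Type*} [DecidableEq ι] (E : Finset ι) {p p1 p2 : ℝ}
    (hp : 1 - p = (1 - p1) * (1 - p2)) (F : Finset ι → ℝ) :
    EX E p F = EX E p1 (fun s1 => EX E p2 (fun s2 => F (s1 ∪ s2))) := by
  induction E using Finset.induction_on generalizing F with
  | empty => simp [EX_empty]
  | insert a E ha ih =>
    rw [EX_insert ha, EX_insert ha]
    simp only [EX_insert ha, Finset.union_insert, Finset.insert_union, Finset.insert_idem]
    rw [EX_add, EX_mul, EX_mul, EX_add, EX_mul, EX_mul, ih F, ih (fun s => F (insert a s))]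
    have : p = 1 - (1 - p1) * (1 - p2) := by linarith
    rw [this]; ring

/-- Exponential moment bound for the size of the intersection with a fixed set. -/
lemma EX_exp_le {ι : Type*} [DecidableEq ι] (E M : Finset ι) {p z : ℝ} (h0 : 0 ≤ p) (h1 : p ≤ 1)
    (hz : 1 ≤ z) :
    EX E p (fun s => z ^ (s ∩ M).card) ≤ Real.exp ((z - 1) * p * M.card) := by
  have key : EX E p (fun s => z ^ (s ∩ M).card) ≤ Real.exp ((z - 1) * p * (E ∩ M).card) := by
    induction E using Finset.induction_on with
    | empty => simp [EX_empty]
    | insert a E ha ih =>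
      rw [EX_insert ha]
      by_cases haM : a ∈ M
      · have e1 : EX E p (fun s => z ^ (insert a s ∩ M).card)
            = z * EX E p (fun s => z ^ (s ∩ M).card) := by
          rw [← EX_mul]
          refine EX_congr fun s hs => ?_
          have : a ∉ s ∩ M := fun h => ha (hs (Finset.mem_inter.1 h).1)
          rw [Finset.insert_inter_of_mem haM, Finset.card_insert_of_notMem this, pow_succ]
          ring
        have hn : a ∉ E ∩ M := fun h => ha (Finset.mem_inter.1 h).1
        rw [e1, Finset.insert_inter_of_mem haM, Finset.card_insert_of_notMem hn]
        push_cast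
        have e2 : (z - 1) * p * (((E ∩ M).card : ℝ) + 1)
          = (z - 1) * p + (z - 1) * p * ((E ∩ M).card : ℝ) := by ring
        rw [e2, Real.exp_add]
        have e3 : (z - 1) * p + 1 ≤ Real.exp ((z - 1) * p) := Real.add_one_le_exp _
        have e4 : 0 ≤ EX E p (fun s => z ^ (s ∩ M).card) :=
          EX_nonneg h0 h1 fun s _ => by positivity
        calc (1 - p) * EX E p (fun s => z ^ (s ∩ M).card)
              + p * (z * EX E p (fun s => z ^ (s ∩ M).card))
            = ((z - 1) * p + 1) * EX E p (fun s => z ^ (s ∩ M).card) := by ring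
          _ ≤ _ := mul_le_mul e3 ih e4 (Real.exp_pos _).le
      · simp only [Finset.insert_inter_of_notMem haM]
        calc _ = EX E p (fun s => z ^ (s ∩ M).card) := by ring
          _ ≤ _ := ih
  refine key.trans (Real.exp_le_exp.2 ?_)
  have : ((E ∩ M).card : ℝ) ≤ M.card := by
    exact_mod_cast Finset.card_le_card Finset.inter_subset_right
  have h2 : 0 ≤ (z - 1) * p := mul_nonneg (by linarith) h0
  exact mul_le_mul_of_nonneg_left this h2

/-- Upper tail for the size of the intersection with a fixed set. -/
lemma EX_tail {ι : Type*} [DecidableEq ι] (E M : Finset ι) {p k : ℝ} (h0 : 0 ≤ p) (h1 : p ≤ 1) :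
    EX E p (fun s => if k ≤ ((s ∩ M).card : ℝ) then 1 else 0)
      ≤ Real.exp (2 * p * M.card - k) := by
  have h := EX_exp_le E M h0 h1 (z := Real.exp 1) (Real.one_le_exp (by norm_num))
  have h2 : EX E p (fun s => if k ≤ ((s ∩ M).card : ℝ) then 1 else 0)
      ≤ Real.exp (-k) * EX E p (fun s => (Real.exp 1) ^ (s ∩ M).card) := by
    rw [← EX_mul]
    refine EX_mono h0 h1 fun s _ => ?_
    rw [← Real.exp_nat_mul, mul_one, ← Real.exp_add]
    split_ifs with hk
    · exact Real.one_le_exp (by linarith)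
    · positivity
  refine h2.trans ?_
  calc _ ≤ Real.exp (-k) * Real.exp ((Real.exp 1 - 1) * p * M.card) := by gcongr
    _ = Real.exp (-k + (Real.exp 1 - 1) * p * M.card) := by rw [Real.exp_add]
    _ ≤ _ := by
      apply Real.exp_le_exp.2
      have h3 : Real.exp 1 - 1 ≤ 2 := by linarith [Real.exp_one_lt_d9]
      have h4 : 0 ≤ p * M.card := by positivity
      nlinarith

lemma EX_single {ι : Type*} [DecidableEq ι] {E : Finset ι} {a : ι} (ha : a ∈ E) (p : ℝ)
    (F : Finset ι → ℝ) (hF : ∀ s, F (insert a s) = F s) :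
    EX E p (fun s => (if a ∈ s then 1 else 0) * F s) = p * EX E p F := by
  obtain ⟨E', ha', rfl⟩ : ∃ E', a ∉ E' ∧ insert a E' = E :=
    ⟨E.erase a, Finset.notMem_erase a E, Finset.insert_erase ha⟩
  rw [EX_insert ha', EX_insert ha']
  simp only [hF, Finset.mem_insert_self, if_true, one_mul]
  have : EX E' p (fun s => (if a ∈ s then 1 else 0) * F s) = EX E' p (fun _ => 0) :=
    EX_congr fun s hs => by
      have : a ∉ s := fun h => ha' (hs h)
      simp [this]
  rw [this, EX_const]; ring

lemma EX_indep {ι : Type*} [DecidableEq ι] {E : Finset ι} (p : ℝ) (T : Finset ι) (hT : T ⊆ E)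
    (F : Finset ι → ℝ) (hF : ∀ a ∈ T, ∀ s, F (insert a s) = F s) :
    EX E p (fun s => (if T ⊆ s then 1 else 0) * F s) = p ^ T.card * EX E p F := by
  induction T using Finset.induction_on with
  | empty => simp
  | insert a T ha ih =>
    have h1 := EX_single (E := E) (a := a) (hT (Finset.mem_insert_self a T)) p
      (fun s => (if T ⊆ s then 1 else 0) * F s) (fun s => by
        simp only [hF a (Finset.mem_insert_self a T) s, Finset.subset_insert_iff_of_notMem ha])
    rw [ih (fun x hx => hT (Finset.mem_insert_of_mem hx))
      (fun b hb => hF b (Finset.mem_insert_of_mem hb))] at h1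
    rw [Finset.card_insert_of_notMem ha, pow_succ, mul_comm (p ^ T.card) p, mul_assoc, ← h1]
    refine EX_congr fun s _ => ?_
    by_cases h : a ∈ s <;> by_cases h' : T ⊆ s <;> simp [Finset.insert_subset_iff, h, h']

lemma EX_subset {ι : Type*} [DecidableEq ι] {E : Finset ι} (p : ℝ) (T : Finset ι) (hT : T ⊆ E) :
    EX E p (fun s => (if T ⊆ s then 1 else 0)) = p ^ T.card := by
  have := EX_indep p T hT (fun _ => 1) (fun _ _ _ => rfl)
  simpa [EX_const] using this

/-- Harris' inequality, for an increasing and a decreasing function. -/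
lemma EX_harris {ι : Type*} [Fintype ι] [DecidableEq ι] (E : Finset ι) {p : ℝ} (h0 : 0 ≤ p)
    (h1 : p ≤ 1) (F G : Finset ι → ℝ) (hF0 : ∀ s, 0 ≤ F s) (hF : Monotone F)
    (hG : Antitone G) (hG1 : ∀ s, G s ≤ 1) :
    EX E p (fun s => F s * G s) ≤ EX E p F * EX E p G := by
  have h2 : 0 ≤ 1 - p := by linarith
  let μ : Finset ι → ℝ := fun s =>
    if s ⊆ E then p ^ s.card * (1 - p) ^ (E.card - s.card) else 0
  have hsum : ∀ f : Finset ι → ℝ, ∑ s, μ s * f s = EX E p f := by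
    intro f
    unfold EX
    rw [← Finset.sum_subset (Finset.subset_univ E.powerset)]
    · refine Finset.sum_congr rfl fun s hs => ?_
      simp only [μ, if_pos (Finset.mem_powerset.1 hs)]
    · intro s _ hs
      simp only [μ, if_neg (fun h => hs (Finset.mem_powerset.2 h)), zero_mul]
  have hμ0 : 0 ≤ μ := fun s => by
    show 0 ≤ μ s
    simp only [μ]; split_ifs <;> positivity
  have hμ : ∀ a b, μ a * μ b ≤ μ (a ⊓ b) * μ (a ⊔ b) := by
    intro a b
    by_cases ha : a ⊆ E
    · by_cases hb : b ⊆ E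
      · have hi : a ⊓ b ⊆ E := Finset.inter_subset_left.trans ha
        have hu : a ⊔ b ⊆ E := Finset.union_subset ha hb
        simp only [μ, if_pos ha, if_pos hb, if_pos hi, if_pos hu]
        have hc : (a ⊓ b).card + (a ⊔ b).card = a.card + b.card :=
          Finset.card_inter_add_card_union a b
        have e1 := Finset.card_le_card ha
        have e2 := Finset.card_le_card hb
        have e3 := Finset.card_le_card hi
        have e4 := Finset.card_le_card hu
        apply le_of_eq
        calc _ = p ^ (a.card + b.card) * (1 - p) ^ (E.card - a.card + (E.card - b.card)) := by
              rw [pow_add, pow_add]; ring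
          _ = p ^ ((a ⊓ b).card + (a ⊔ b).card)
              * (1 - p) ^ (E.card - (a ⊓ b).card + (E.card - (a ⊔ b).card)) := by
              rw [hc]; congr 2; omega
          _ = _ := by rw [pow_add, pow_add]; ring
      · have : μ b = 0 := by simp only [μ, if_neg hb]
        rw [this, mul_zero]; exact mul_nonneg (hμ0 _) (hμ0 _)
    · have : μ a = 0 := by simp only [μ, if_neg ha]
      rw [this, zero_mul]; exact mul_nonneg (hμ0 _) (hμ0 _)
  have := fkg (μ := μ) (f := F) (g := fun s => 1 - G s) hμ0 hF0
    (fun s => by show 0 ≤ 1 - G s; linarith [hG1 s]) hF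
    (fun a b hab => by have := hG hab; show 1 - G a ≤ 1 - G b; linarith) hμ
  rw [hsum, hsum, hsum] at this
  have e0 : ∑ s, μ s = 1 := by
    have := hsum (fun _ => 1)
    simpa [EX_const] using this
  have e1 : EX E p (fun s => 1 - G s) = 1 - EX E p G := by rw [EX_sub, EX_const]
  have e2 : EX E p (fun s => F s * (1 - G s)) = EX E p F - EX E p (fun s => F s * G s) := by
    rw [← EX_sub]; exact EX_congr fun s _ => by ring
  rw [e0, e1, e2] at this
  linarith

end ProbPart

section JansonPart

lemma one_sub_sum_le_prod' {κ : Type*} (B : Finset κ) (a : κ → ℝ)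
    (h0 : ∀ j ∈ B, 0 ≤ a j) (h1 : ∀ j ∈ B, a j ≤ 1) :
    1 - ∑ j ∈ B, a j ≤ ∏ j ∈ B, (1 - a j) := by
  induction B using Finset.induction_on with
  | empty => simp
  | insert i B hi ih =>
    rw [Finset.sum_insert hi, Finset.prod_insert hi]
    have ih' := ih (fun j hj => h0 j (Finset.mem_insert_of_mem hj))
      (fun j hj => h1 j (Finset.mem_insert_of_mem hj))
    have e0 := h0 i (Finset.mem_insert_self i B)
    have e1 := h1 i (Finset.mem_insert_self i B)
    have e2 : ∏ j ∈ B, (1 - a j) ≤ 1 := Finset.prod_le_one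
      (fun j hj => by linarith [h1 j (Finset.mem_insert_of_mem hj)])
      (fun j hj => by linarith [h0 j (Finset.mem_insert_of_mem hj)])
    nlinarith

/-- Indicator of `T ⊆ s`. -/
def chi {ι : Type*} [DecidableEq ι] (T s : Finset ι) : ℝ := if T ⊆ s then 1 else 0

lemma chi_nonneg {ι : Type*} [DecidableEq ι] (T s : Finset ι) : 0 ≤ chi T s := by
  unfold chi; split_ifs <;> norm_num

lemma chi_le_one {ι : Type*} [DecidableEq ι] (T s : Finset ι) : chi T s ≤ 1 := by
  unfold chi; split_ifs <;> norm_num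

lemma chi_mono {ι : Type*} [DecidableEq ι] (T : Finset ι) : Monotone (chi T) := by
  intro a b hab
  unfold chi
  split_ifs with h1 h2 h2
  · exact le_rfl
  · exact absurd (h1.trans hab) h2
  · norm_num
  · exact le_rfl

lemma chi_union {ι : Type*} [DecidableEq ι] (T T' s : Finset ι) :
    chi (T ∪ T') s = chi T s * chi T' s := by
  unfold chi
  by_cases h : T ⊆ s <;> by_cases h' : T' ⊆ s <;> simp [Finset.union_subset_iff, h, h']

lemma prod_chi_anti {ι κ : Type*} [DecidableEq ι] (I : Finset κ) (T : κ → Finset ι) {l : ℝ}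
    (hl0 : 0 ≤ l) (hl1 : l ≤ 1) :
    Antitone (fun s => ∏ i ∈ I, (1 - l * chi (T i) s)) := by
  intro a b hab
  refine Finset.prod_le_prod (fun i _ => ?_) (fun i _ => ?_)
  · have := chi_le_one (T i) b
    have := chi_nonneg (T i) b
    nlinarith
  · have := chi_mono (T i) hab
    nlinarith

lemma prod_chi_nonneg {ι κ : Type*} [DecidableEq ι] (I : Finset κ) (T : κ → Finset ι) {l : ℝ}
    (hl0 : 0 ≤ l) (hl1 : l ≤ 1) (s : Finset ι) :
    0 ≤ ∏ i ∈ I, (1 - l * chi (T i) s) :=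
  Finset.prod_nonneg fun i _ => by
    have := chi_le_one (T i) s
    have := chi_nonneg (T i) s
    nlinarith

lemma prod_chi_le_one {ι κ : Type*} [DecidableEq ι] (I : Finset κ) (T : κ → Finset ι) {l : ℝ}
    (hl0 : 0 ≤ l) (hl1 : l ≤ 1) (s : Finset ι) :
    ∏ i ∈ I, (1 - l * chi (T i) s) ≤ 1 :=
  Finset.prod_le_one (fun i _ => by
    have := chi_le_one (T i) s
    have := chi_nonneg (T i) s
    nlinarith) fun i _ => by
    have := chi_nonneg (T i) s
    nlinarith

/-- The pair term in Janson's inequality. -/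
def jD {ι : Type*} [DecidableEq ι] (p : ℝ) (T T' : Finset ι) : ℝ :=
  if Disjoint T T' then 0 else p ^ (T ∪ T').card

lemma jD_nonneg {ι : Type*} [DecidableEq ι] {p : ℝ} (h0 : 0 ≤ p) (T T' : Finset ι) :
    0 ≤ jD p T T' := by
  unfold jD; split_ifs <;> positivity

lemma janson_step {ι κ : Type*} [Fintype ι] [DecidableEq ι] {E : Finset ι} {p : ℝ}
    (h0 : 0 ≤ p) (h1 : p ≤ 1) (I : Finset κ) (T : κ → Finset ι) (U : Finset ι)
    (hT : ∀ i, T i ⊆ E) (hU : U ⊆ E) {l : ℝ} (hl0 : 0 ≤ l) (hl1 : l ≤ 1) :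
    EX E p (fun s => ∏ i ∈ I, (1 - l * chi (T i) s)) *
        (p ^ U.card - l * ∑ j ∈ I, jD p U (T j)) ≤
      EX E p (fun s => chi U s * ∏ i ∈ I, (1 - l * chi (T i) s)) := by
  have hR : 0 ≤ EX E p (fun s => chi U s * ∏ i ∈ I, (1 - l * chi (T i) s)) :=
    EX_nonneg h0 h1 fun s _ => mul_nonneg (chi_nonneg _ _) (prod_chi_nonneg I T hl0 hl1 s)
  have hP : 0 ≤ EX E p (fun s => ∏ i ∈ I, (1 - l * chi (T i) s)) :=
    EX_nonneg h0 h1 fun s _ => prod_chi_nonneg I T hl0 hl1 s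
  by_cases hb : 0 ≤ p ^ U.card - l * ∑ j ∈ I, jD p U (T j)
  swap
  · exact (mul_nonpos_of_nonneg_of_nonpos hP (not_le.1 hb).le).trans hR
  set C := I.filter (fun j => Disjoint U (T j)) with hC
  set B := I.filter (fun j => ¬ Disjoint U (T j)) with hB
  have hprod : ∀ s, ∏ i ∈ I, (1 - l * chi (T i) s) =
      (∏ i ∈ C, (1 - l * chi (T i) s)) * ∏ i ∈ B, (1 - l * chi (T i) s) := fun s =>
    (Finset.prod_filter_mul_prod_filter_not I _ _).symm
  have hsum : ∑ j ∈ I, jD p U (T j) = ∑ j ∈ B, p ^ (U ∪ T j).card := by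
    rw [hB, Finset.sum_filter]
    refine Finset.sum_congr rfl fun j _ => ?_
    unfold jD
    by_cases h : Disjoint U (T j) <;> simp [h]
  have hle : EX E p (fun s => ∏ i ∈ I, (1 - l * chi (T i) s)) ≤
      EX E p (fun s => ∏ i ∈ C, (1 - l * chi (T i) s)) :=
    EX_mono h0 h1 fun s _ => by
      rw [hprod s]
      exact mul_le_of_le_one_right (prod_chi_nonneg C T hl0 hl1 s) (prod_chi_le_one B T hl0 hl1 s)
  have hind : EX E p (fun s => chi U s * ∏ i ∈ C, (1 - l * chi (T i) s)) =
      p ^ U.card * EX E p (fun s => ∏ i ∈ C, (1 - l * chi (T i) s)) := by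
    refine EX_indep p U hU _ fun a ha s => ?_
    refine Finset.prod_congr rfl fun j hj => ?_
    have hd : Disjoint U (T j) := (Finset.mem_filter.1 hj).2
    have hna : a ∉ T j := Finset.disjoint_left.1 hd ha
    simp only [chi, Finset.subset_insert_iff_of_notMem hna]
  have hpt : EX E p (fun s => chi U s * ∏ i ∈ C, (1 - l * chi (T i) s)) -
      l * ∑ j ∈ B, EX E p (fun s => chi (U ∪ T j) s * ∏ i ∈ C, (1 - l * chi (T i) s)) ≤
      EX E p (fun s => chi U s * ∏ i ∈ I, (1 - l * chi (T i) s)) := by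
    rw [← EX_sum, ← EX_mul, ← EX_sub]
    refine EX_mono h0 h1 fun s _ => ?_
    rw [hprod s]
    have e1 := one_sub_sum_le_prod' B (fun j => l * chi (T j) s)
      (fun j _ => mul_nonneg hl0 (chi_nonneg _ _))
      (fun j _ => by have := chi_le_one (T j) s; have := chi_nonneg (T j) s; nlinarith)
    have e2 : 0 ≤ chi U s * ∏ i ∈ C, (1 - l * chi (T i) s) :=
      mul_nonneg (chi_nonneg _ _) (prod_chi_nonneg C T hl0 hl1 s)
    have e3 : l * ∑ j ∈ B, chi (U ∪ T j) s * ∏ i ∈ C, (1 - l * chi (T i) s) =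
        (chi U s * ∏ i ∈ C, (1 - l * chi (T i) s)) * ∑ j ∈ B, l * chi (T j) s := by
      rw [Finset.mul_sum, Finset.mul_sum]
      refine Finset.sum_congr rfl fun j _ => ?_
      rw [chi_union]; ring
    rw [e3]
    nlinarith [mul_le_mul_of_nonneg_left e1 e2]
  have hhar : ∀ j ∈ B, EX E p (fun s => chi (U ∪ T j) s * ∏ i ∈ C, (1 - l * chi (T i) s)) ≤
      p ^ (U ∪ T j).card * EX E p (fun s => ∏ i ∈ C, (1 - l * chi (T i) s)) := by
    intro j _
    have := EX_harris E h0 h1 (chi (U ∪ T j)) (fun s => ∏ i ∈ C, (1 - l * chi (T i) s))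
      (chi_nonneg _) (chi_mono _) (prod_chi_anti C T hl0 hl1) (prod_chi_le_one C T hl0 hl1)
    have e : EX E p (chi (U ∪ T j)) = p ^ (U ∪ T j).card :=
      EX_subset p _ (Finset.union_subset hU (hT j))
    rwa [e] at this
  calc _ ≤ EX E p (fun s => ∏ i ∈ C, (1 - l * chi (T i) s)) *
        (p ^ U.card - l * ∑ j ∈ I, jD p U (T j)) := mul_le_mul_of_nonneg_right hle hb
    _ = EX E p (fun s => chi U s * ∏ i ∈ C, (1 - l * chi (T i) s)) -
      l * ∑ j ∈ B, p ^ (U ∪ T j).card * EX E p (fun s => ∏ i ∈ C, (1 - l * chi (T i) s)) := by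
        rw [hind, hsum, ← Finset.sum_mul]; ring
    _ ≤ _ := by
        refine le_trans ?_ hpt
        have := Finset.sum_le_sum hhar
        nlinarith [mul_le_mul_of_nonneg_left this hl0]

lemma janson_aux {ι κ : Type*} [Fintype ι] [DecidableEq ι] {E : Finset ι} {p : ℝ}
    (h0 : 0 ≤ p) (h1 : p ≤ 1) (I : Finset κ) (T : κ → Finset ι)
    (hT : ∀ i, T i ⊆ E) {l : ℝ} (hl0 : 0 ≤ l) (hl1 : l ≤ 1) :
    EX E p (fun s => ∏ i ∈ I, (1 - l * chi (T i) s)) ≤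
      Real.exp (-(l * ∑ i ∈ I, p ^ (T i).card) +
        l ^ 2 * ∑ i ∈ I, ∑ j ∈ I, jD p (T i) (T j)) := by
  induction I using Finset.induction_on with
  | empty => simp [EX_const]
  | insert i I hi ih =>
    have hs := janson_step h0 h1 I T (T i) hT (hT i) hl0 hl1
    set P := EX E p (fun s => ∏ i ∈ I, (1 - l * chi (T i) s)) with hPdef
    have hP : 0 ≤ P := EX_nonneg h0 h1 fun s _ => prod_chi_nonneg I T hl0 hl1 s
    have e1 : EX E p (fun s => ∏ k ∈ insert i I, (1 - l * chi (T k) s)) =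
        P - l * EX E p (fun s => chi (T i) s * ∏ k ∈ I, (1 - l * chi (T k) s)) := by
      rw [hPdef, ← EX_mul, ← EX_sub]
      refine EX_congr fun s _ => ?_
      rw [Finset.prod_insert hi]; ring
    rw [e1]
    set b := p ^ (T i).card - l * ∑ j ∈ I, jD p (T i) (T j) with hb
    have e2 : P - l * EX E p (fun s => chi (T i) s * ∏ k ∈ I, (1 - l * chi (T k) s)) ≤
        P * (-(l * b) + 1) := by nlinarith [mul_le_mul_of_nonneg_left hs hl0]
    have e3 : P * (-(l * b) + 1) ≤ P * Real.exp (-(l * b)) :=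
      mul_le_mul_of_nonneg_left (Real.add_one_le_exp _) hP
    refine e2.trans (e3.trans ?_)
    refine (mul_le_mul_of_nonneg_right ih (Real.exp_pos _).le).trans ?_
    rw [← Real.exp_add]
    apply Real.exp_le_exp.2
    rw [Finset.sum_insert hi, Finset.sum_insert hi, Finset.sum_insert hi]
    have e4 : ∑ k ∈ I, ∑ j ∈ insert i I, jD p (T k) (T j) ≥
        ∑ k ∈ I, ∑ j ∈ I, jD p (T k) (T j) :=
      Finset.sum_le_sum fun k _ => Finset.sum_le_sum_of_subset_of_nonneg
        (Finset.subset_insert i I) fun j _ _ => jD_nonneg h0 _ _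
    have e5 := jD_nonneg h0 (T i) (T i)
    have hl2 : 0 ≤ l ^ 2 := by positivity
    rw [hb]
    nlinarith [mul_le_mul_of_nonneg_left e4 hl2, mul_nonneg hl2 e5]

/-- Janson's inequality. -/
lemma janson {ι κ : Type*} [Fintype ι] [DecidableEq ι] {E : Finset ι} {p : ℝ}
    (h0 : 0 ≤ p) (h1 : p ≤ 1) (I : Finset κ) (T : κ → Finset ι)
    (hT : ∀ i, T i ⊆ E) (hne : ∀ i ∈ I, (T i).Nonempty) {D : ℝ} (hD0 : 0 < D)
    (hD : ∑ i ∈ I, ∑ j ∈ I, jD p (T i) (T j) ≤ D) :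
    EX E p (fun s => if ∃ i ∈ I, T i ⊆ s then 0 else 1) ≤
      Real.exp (-((∑ i ∈ I, p ^ (T i).card) ^ 2 / (4 * D))) := by
  set m := ∑ i ∈ I, p ^ (T i).card with hm
  have hm0 : 0 ≤ m := Finset.sum_nonneg fun i _ => by positivity
  have hmD : m ≤ D := by
    refine le_trans (Finset.sum_le_sum fun i hi => ?_) hD
    have : p ^ (T i).card = jD p (T i) (T i) := by
      unfold jD
      rw [if_neg, Finset.union_self]
      rw [disjoint_self]
      exact (hne i hi).ne_empty
    rw [this]
    exact Finset.single_le_sum (f := fun j => jD p (T i) (T j))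
      (fun j _ => jD_nonneg h0 _ _) hi
  have hl0 : 0 ≤ m / (2 * D) := by positivity
  have hl1 : m / (2 * D) ≤ 1 := by
    rw [div_le_one (by positivity)]; linarith
  have h := janson_aux h0 h1 I T hT hl0 hl1
  refine le_trans (EX_mono h0 h1 fun s _ => ?_) (h.trans (Real.exp_le_exp.2 ?_))
  · split_ifs with hex
    · exact prod_chi_nonneg I T hl0 hl1 s
    · apply le_of_eq
      symm
      refine Finset.prod_eq_one fun i hi => ?_
      have : ¬ T i ⊆ s := fun hh => hex ⟨i, hi, hh⟩
      simp [chi, this]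
  · rw [← hm]
    have e : (m / (2 * D)) ^ 2 * ∑ i ∈ I, ∑ j ∈ I, jD p (T i) (T j) ≤ (m / (2 * D)) ^ 2 * D :=
      mul_le_mul_of_nonneg_left hD (by positivity)
    have e2 : -(m / (2 * D) * m) + (m / (2 * D)) ^ 2 * D = -(m ^ 2 / (4 * D)) := by
      field_simp; ring
    linarith

end JansonPart

section EmbedPart

/-- The edges of `H` as a finset. -/
def HE {α : Type*} [Fintype α] (H : SimpleGraph α) : Finset (Sym2 α) :=
  Finset.univ.filter (fun q => q ∈ H.edgeSet)

lemma mem_HE {α : Type*} [Fintype α] {H : SimpleGraph α} {q : Sym2 α} :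
    q ∈ HE H ↔ q ∈ H.edgeSet := by simp [HE]

lemma eCount_eq {α : Type*} [Fintype α] (H : SimpleGraph α) : eCount H = (HE H).card := by
  unfold eCount
  exact Nat.subtype_card _ fun q => mem_HE

/-- The number of edges of `H` inside `S`. -/
def eIn {α : Type*} [Fintype α] (H : SimpleGraph α) (S : Finset α) : ℕ :=
  ((HE H).filter (fun q => ∀ a ∈ q, a ∈ S)).card

lemma subDensity2_le {α : Type*} [Fintype α] {H : SimpleGraph α} (hH : Strictly2Balanced H)
    (K : H.Subgraph) : subDensity2 K ≤ d2 H := by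
  by_cases hK : K = ⊤
  · subst hK
    apply le_of_eq
    unfold subDensity2 d2 eCount
    simp
  · exact (hH.2 K hK).le

lemma m2_eq {α : Type*} [Fintype α] {H : SimpleGraph α} (hH : Strictly2Balanced H) :
    m2 H = d2 H := by
  unfold m2
  apply le_antisymm
  · refine csSup_le ⟨subDensity2 (⊤ : H.Subgraph), ⊤, rfl⟩ ?_
    rintro x ⟨K, rfl⟩
    exact subDensity2_le hH K
  · apply le_csSup
    · refine ⟨d2 H, ?_⟩
      rintro x ⟨K, rfl⟩
      exact subDensity2_le hH K
    · refine ⟨⊤, ?_⟩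
      unfold subDensity2 d2 eCount
      simp

lemma d2_pos {α : Type*} [Fintype α] {H : SimpleGraph α} (hH : Strictly2Balanced H) :
    0 < d2 H := by
  have h3 := hH.1
  have hne : (⊥ : H.Subgraph) ≠ ⊤ := by
    intro h
    have h2 : (⊥ : H.Subgraph).verts = (⊤ : H.Subgraph).verts := by rw [h]
    simp only [Subgraph.verts_bot, Subgraph.verts_top] at h2
    have : Nat.card (∅ : Set α) = Nat.card (Set.univ : Set α) := by rw [h2]
    simp at this
    rw [Nat.card_eq_fintype_card] at h3
    omega
  have := hH.2 ⊥ hne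
  unfold subDensity2 density2 at this
  simpa using this

lemma bal {α : Type*} [Fintype α] {H : SimpleGraph α} (hH : Strictly2Balanced H)
    (S : Finset α) (hS : 2 ≤ S.card) : (eIn H S : ℝ) - 1 ≤ d2 H * ((S.card : ℝ) - 2) := by
  rcases Nat.eq_or_lt_of_le hS with h2 | h3
  · obtain ⟨x, y, hxy, rfl⟩ := Finset.card_eq_two.1 h2.symm
    have : eIn H {x, y} ≤ 1 := by
      unfold eIn
      rw [Finset.card_le_one]
      have key : ∀ q ∈ (HE H).filter (fun q => ∀ a ∈ q, a ∈ ({x, y} : Finset α)),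
          q = s(x, y) := by
        intro q hq
        induction q with
        | h u w =>
          rw [Finset.mem_filter, mem_HE, SimpleGraph.mem_edgeSet] at hq
          have hu := hq.2 u (by simp)
          have hw := hq.2 w (by simp)
          have huw := hq.1.ne
          simp only [Finset.mem_insert, Finset.mem_singleton] at hu hw
          rcases hu with rfl | rfl <;> rcases hw with rfl | rfl
          · exact absurd rfl huw
          · rfl
          · exact Sym2.eq_swap
          · exact absurd rfl huw
      intro q hq q' hq'
      rw [key q hq, key q' hq']
    have h1 : (eIn H {x, y} : ℝ) ≤ 1 := by exact_mod_cast this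
    rw [← h2]; push_cast; linarith
  · have hd := subDensity2_le hH ((⊤ : H.Subgraph).induce (S : Set α))
    unfold subDensity2 density2 at hd
    have hv : Nat.card ((⊤ : H.Subgraph).induce (S : Set α)).verts = S.card := by
      simp
    have he : Nat.card ((⊤ : H.Subgraph).induce (S : Set α)).edgeSet = eIn H S := by
      unfold eIn
      refine Nat.subtype_card _ fun q => ?_
      induction q with
      | h u w =>
        rw [Finset.mem_filter, mem_HE, SimpleGraph.mem_edgeSet, Subgraph.mem_edgeSet,
          Subgraph.induce_adj]
        simp
        tauto
    rw [hv, he, if_pos (by omega)] at hd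
    have : (0 : ℝ) < (S.card : ℝ) - 2 := by
      have : (3 : ℝ) ≤ S.card := by exact_mod_cast h3
      linarith
    rwa [div_le_iff₀ this] at hd

lemma two_le_HE {α : Type*} [Fintype α] {H : SimpleGraph α} (hH : Strictly2Balanced H) :
    2 ≤ (HE H).card := by
  have h := d2_pos hH
  have h3 := hH.1
  unfold d2 density2 at h
  rw [if_pos h3, eCount_eq] at h
  have h4 : (0 : ℝ) < (Nat.card α : ℝ) - 2 := by
    have : (3 : ℝ) ≤ Nat.card α := by exact_mod_cast h3
    linarith
  have h5 := (div_pos_iff_of_pos_right h4).1 h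
  have : (1 : ℝ) < (HE H).card := by linarith
  exact_mod_cast this

lemma half_le_d2 {α : Type*} [Fintype α] {H : SimpleGraph α} (hH : Strictly2Balanced H) :
    1 / 2 ≤ d2 H := by
  obtain ⟨q, hq, q', hq', hne⟩ := Finset.one_lt_card.1 (two_le_HE hH)
  induction q with
  | h a b =>
  induction q' with
  | h x y =>
    set S : Finset α := {a, b, x, y} with hS
    have hab : a ≠ b := (mem_HE.1 hq : H.Adj a b).ne
    have hc : S.card ≤ 4 := Finset.card_le_four
    have hc2 : 2 ≤ S.card := by
      have : ({a, b} : Finset α) ⊆ S := by intro z; simp [hS]; tauto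
      have h := Finset.card_le_card this
      rwa [Finset.card_pair hab] at h
    have he : 2 ≤ eIn H S := by
      unfold eIn
      refine Finset.one_lt_card.2 ⟨s(a, b), ?_, s(x, y), ?_, hne⟩
      · rw [Finset.mem_filter]; exact ⟨hq, by simp [hS]⟩
      · rw [Finset.mem_filter]; exact ⟨hq', by simp [hS]⟩
    have h := bal hH S hc2
    have e1 : (2 : ℝ) ≤ eIn H S := by exact_mod_cast he
    have e2 : (S.card : ℝ) ≤ 4 := by exact_mod_cast hc
    have e3 := d2_pos hH
    nlinarith

/-- Image of a set of edges under a vertex map. -/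
def TF {α V : Type*} [DecidableEq V] (F : Finset (Sym2 α)) (ψ : α → V) : Finset (Sym2 V) :=
  F.image (Sym2.map ψ)

lemma TF_card {α V : Type*} [DecidableEq V] (F : Finset (Sym2 α)) {ψ : α → V}
    (hψ : Function.Injective ψ) : (TF F ψ).card = F.card :=
  Finset.card_image_of_injective _ (Sym2.map.injective hψ)

/-- The vertices mapped by `ψ'` into the range of `ψ`. -/
def ovS {α V : Type*} [Fintype α] (ψ ψ' : α → V) : Finset α :=
  Finset.univ.filter (fun u => ψ' u ∈ Set.range ψ)

lemma sum_ov {α V : Type*} [Fintype α] [Fintype V] (ψ : α → V) :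
    ∑ ψ' : α → V, (Fintype.card V : ℝ) ^ (ovS ψ ψ').card ≤
      (((Fintype.card α : ℝ) + 1) * Fintype.card V) ^ Fintype.card α := by
  set N : ℝ := (Fintype.card V : ℝ) with hN
  have e1 : ∀ ψ' : α → V, N ^ (ovS ψ ψ').card =
      ∏ u : α, (if ψ' u ∈ Set.range ψ then N else 1) := by
    intro ψ'
    rw [Finset.prod_ite]
    simp [ovS]
  have e2 : ∑ ψ' : α → V, N ^ (ovS ψ ψ').card =
      (∑ w : V, (if w ∈ Set.range ψ then N else 1)) ^ Fintype.card α := by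
    rw [Finset.sum_congr rfl fun ψ' _ => e1 ψ', ← Finset.card_univ, ← Finset.prod_const,
      Finset.prod_univ_sum, Fintype.piFinset_univ]
  rw [e2]
  have hN0 : 0 ≤ N := by positivity
  apply pow_le_pow_left₀ (Finset.sum_nonneg fun w _ => by split_ifs <;> positivity)
  rw [Finset.sum_ite]
  have e3 : ((Finset.univ.filter (fun w => w ∈ Set.range ψ)).card : ℝ) ≤ Fintype.card α := by
    have : Finset.univ.filter (fun w => w ∈ Set.range ψ) ⊆ Finset.univ.image ψ := by
      intro w; simp
    have h := (Finset.card_le_card this).trans Finset.card_image_le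
    rw [Finset.card_univ] at h
    exact_mod_cast h
  have e4 : ((Finset.univ.filter (fun w => w ∉ Set.range ψ)).card : ℝ) ≤ N := by
    have := Finset.card_filter_le (Finset.univ : Finset V) (fun w => w ∉ Set.range ψ)
    rw [Finset.card_univ] at this
    rw [hN]
    exact_mod_cast this
  simp only [Finset.sum_const, nsmul_eq_mul, mul_one]
  nlinarith

lemma inter_card_le {α V : Type*} [Fintype α] [DecidableEq V] (F : Finset (Sym2 α))
    {ψ ψ' : α → V} (hψ' : Function.Injective ψ') :
    (TF F ψ ∩ TF F ψ').card ≤ (F.filter (fun q => ∀ a ∈ q, a ∈ ovS ψ ψ')).card := by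
  rw [← TF_card _ hψ']
  apply Finset.card_le_card
  intro e he
  rw [Finset.mem_inter] at he
  obtain ⟨q, hq, rfl⟩ := Finset.mem_image.1 he.2
  obtain ⟨q', hq', hqq⟩ := Finset.mem_image.1 he.1
  refine Finset.mem_image.2 ⟨q, Finset.mem_filter.2 ⟨hq, fun a ha => ?_⟩, rfl⟩
  have : ψ' a ∈ Sym2.map ψ q' := by rw [hqq]; exact Sym2.mem_map.2 ⟨a, ha, rfl⟩
  obtain ⟨b, _, hb⟩ := Sym2.mem_map.1 this
  simp only [ovS, Finset.mem_filter, Finset.mem_univ, true_and]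
  exact ⟨b, hb⟩

/-- Janson's inequality for families of images of a fixed edge set. -/
lemma janson_embed {α V : Type*} [Fintype α] [Fintype V] [DecidableEq V] {E : Finset (Sym2 V)}
    {p : ℝ} (h0 : 0 < p) (h1 : p ≤ 1) (F : Finset (Sym2 α)) (hF : F.Nonempty)
    (I : Finset (α → V)) (hI : ∀ ψ ∈ I, Function.Injective ψ) (hE : ∀ ψ ∈ I, TF F ψ ⊆ E)
    (L : ℝ) (hL : 0 < L) (hV : 0 < Fintype.card V)
    (hpair : ∀ ψ ∈ I, ∀ ψ' ∈ I, ¬ Disjoint (TF F ψ) (TF F ψ') →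
      p ^ (TF F ψ ∪ TF F ψ').card ≤ L * (Fintype.card V : ℝ) ^ (ovS ψ ψ').card) :
    EX E p (fun s => if ∃ ψ ∈ I, TF F ψ ⊆ s then 0 else 1) ≤
      Real.exp (-((I.card : ℝ) * p ^ (2 * F.card) /
        (4 * L * (((Fintype.card α : ℝ) + 1) * Fintype.card V) ^ Fintype.card α))) := by
  rcases I.eq_empty_or_nonempty with rfl | hIne
  · simp [EX_const]
  have hNr : (0 : ℝ) < Fintype.card V := by exact_mod_cast hV
  set C : ℝ := (((Fintype.card α : ℝ) + 1) * Fintype.card V) ^ Fintype.card α with hC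
  have hC0 : 0 < C := by positivity
  have hIc : (0 : ℝ) < I.card := by exact_mod_cast hIne.card_pos
  have hsum : ∑ ψ ∈ I, ∑ ψ' ∈ I, jD p (TF F ψ) (TF F ψ') ≤ I.card * (L * C) := by
    rw [← nsmul_eq_mul, ← Finset.sum_const]
    refine Finset.sum_le_sum fun ψ hψ => ?_
    calc ∑ ψ' ∈ I, jD p (TF F ψ) (TF F ψ')
        ≤ ∑ ψ' ∈ I, L * (Fintype.card V : ℝ) ^ (ovS ψ ψ').card := by
          refine Finset.sum_le_sum fun ψ' hψ' => ?_
          unfold jD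
          split_ifs with hd
          · positivity
          · exact hpair ψ hψ ψ' hψ' hd
      _ ≤ ∑ ψ' : α → V, L * (Fintype.card V : ℝ) ^ (ovS ψ ψ').card :=
          Finset.sum_le_sum_of_subset_of_nonneg (Finset.subset_univ I)
            fun _ _ _ => by positivity
      _ = L * ∑ ψ' : α → V, (Fintype.card V : ℝ) ^ (ovS ψ ψ').card := by rw [Finset.mul_sum]
      _ ≤ L * C := mul_le_mul_of_nonneg_left (sum_ov ψ) hL.le
  let T : I → Finset (Sym2 V) := fun ψ => TF F ψ.1
  have hsum' : ∑ ψ ∈ I.attach, ∑ ψ' ∈ I.attach, jD p (T ψ) (T ψ') ≤ I.card * (L * C) := by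
    refine le_trans (le_of_eq ?_) hsum
    rw [← Finset.sum_attach I]
    refine Finset.sum_congr rfl fun ψ _ => ?_
    rw [← Finset.sum_attach I]
  have h := janson h0.le h1 I.attach T (fun ψ => hE ψ.1 ψ.2)
    (fun ψ _ => by exact hF.image _) (D := I.card * (L * C)) (by positivity) hsum'
  have hmu : ∑ ψ ∈ I.attach, p ^ (T ψ).card = I.card * p ^ F.card := by
    rw [Finset.sum_congr rfl (g := fun _ => p ^ F.card)]
    · simp
    · intro ψ _
      show p ^ (TF F ψ.1).card = _
      rw [TF_card F (hI ψ.1 ψ.2)]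
  rw [hmu] at h
  have e1 : (I.card * p ^ F.card : ℝ) ^ 2 / (4 * (I.card * (L * C))) =
      (I.card : ℝ) * p ^ (2 * F.card) / (4 * L * C) := by
    rw [pow_mul' p 2 F.card]
    field_simp
  rw [e1] at h
  refine le_trans (le_of_eq (EX_congr fun s _ => ?_)) h
  have : (∃ ψ ∈ I, TF F ψ ⊆ s) ↔ ∃ i ∈ I.attach, T i ⊆ s := by
    constructor
    · rintro ⟨ψ, hψ, h⟩; exact ⟨⟨ψ, hψ⟩, Finset.mem_attach _ _, h⟩
    · rintro ⟨ψ, _, h⟩; exact ⟨ψ.1, ψ.2, h⟩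
  simp only [this]

end EmbedPart

section FamPart

lemma TF_sub {α V : Type*} [Fintype α] [DecidableEq V] {H : SimpleGraph α}
    {F : Finset (Sym2 α)} (hF : F ⊆ HE H) {ψ : α → V} (hψ : Function.Injective ψ)
    {E : Finset (Sym2 V)} (hE : ∀ q : Sym2 V, ¬ q.IsDiag → q ∈ E) : TF F ψ ⊆ E := by
  intro e he
  obtain ⟨q, hq, rfl⟩ := Finset.mem_image.1 he
  apply hE
  have h := mem_HE.1 (hF hq)
  induction q with
  | h u w =>
    rw [SimpleGraph.mem_edgeSet] at h
    rw [Sym2.map_mk, Sym2.mk_isDiag_iff]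
    exact fun hh => h.ne (hψ hh)

lemma rpow_aux {p d : ℝ} (h0 : 0 < p) (h1 : p ≤ 1) (i j : ℕ) (h : (i : ℝ) ≤ d * j) :
    (p ^ d) ^ j ≤ p ^ i := by
  rw [← Real.rpow_natCast, ← Real.rpow_natCast, ← Real.rpow_mul h0.le]
  exact Real.rpow_le_rpow_of_exponent_ge h0 h1 h

/-- Exponential bound for missing every member of a dense family of copies of `H`. -/
lemma fam2 {α V : Type*} [Fintype α] [Fintype V] [DecidableEq V] {H : SimpleGraph α}
    (hH : Strictly2Balanced H) {E : Finset (Sym2 V)} (hE : ∀ q : Sym2 V, ¬ q.IsDiag → q ∈ E)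
    {p : ℝ} (h0 : 0 < p) (h1 : p ≤ 1) (hV : 0 < Fintype.card V)
    (hΩ : 1 ≤ (Fintype.card V : ℝ) * p ^ (d2 H))
    (I : Finset (α → V)) (hI : ∀ ψ ∈ I, Function.Injective ψ) {γ : ℝ}
    (hγ : γ * (Fintype.card V : ℝ) ^ Fintype.card α ≤ I.card) :
    EX E p (fun s => if ∃ ψ ∈ I, TF (HE H) ψ ⊆ s then 0 else 1) ≤
      Real.exp (-(γ / (4 * ((Fintype.card α : ℝ) + 1) ^ Fintype.card α) *
        ((Fintype.card V : ℝ) ^ 2 * p))) := by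
  set N : ℝ := (Fintype.card V : ℝ) with hN
  set v := Fintype.card α with hv
  have hN0 : 0 < N := by rw [hN]; exact_mod_cast hV
  have hF : (HE H).Nonempty := Finset.card_pos.1 (by have := two_le_HE hH; omega)
  have h := janson_embed h0 h1 (HE H) hF I hI (fun ψ hψ => TF_sub (subset_refl _) (hI ψ hψ) hE)
    (p ^ (2 * (HE H).card) / (p * N ^ 2)) (by positivity) hV (by
      intro ψ hψ ψ' hψ' hnd
      set k := (ovS ψ ψ').card with hk
      have hcard : (TF (HE H) ψ ∪ TF (HE H) ψ').card + (TF (HE H) ψ ∩ TF (HE H) ψ').card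
          = 2 * (HE H).card := by
        rw [Finset.card_union_add_card_inter, TF_card _ (hI ψ hψ), TF_card _ (hI ψ' hψ')]; ring
      have hi := inter_card_le (HE H) (ψ := ψ) (hI ψ' hψ')
      set i := (TF (HE H) ψ ∩ TF (HE H) ψ').card with hidef
      have hi1 : 1 ≤ i := by
        rw [Finset.disjoint_iff_inter_eq_empty, ← Finset.card_eq_zero] at hnd
        omega
      have hk2 : 2 ≤ k := by
        have hpos : 0 < ((HE H).filter (fun q => ∀ a ∈ q, a ∈ ovS ψ ψ')).card := by omega
        obtain ⟨q, hq⟩ := Finset.card_pos.1 hpos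
        rw [Finset.mem_filter, mem_HE] at hq
        induction q with
        | h u w =>
          have huw := (hq.1 : H.Adj u w).ne
          have : ({u, w} : Finset α) ⊆ ovS ψ ψ' := by
            intro z hz
            apply hq.2
            simpa using hz
          have := Finset.card_le_card this
          rwa [Finset.card_pair huw] at this
      have hb := bal hH (ovS ψ ψ') hk2
      have hie : (i : ℝ) ≤ eIn H (ovS ψ ψ') := by exact_mod_cast hi
      have hpi : (p ^ d2 H) ^ (k - 2) ≤ p ^ (i - 1) := by
        apply rpow_aux h0 h1
        push_cast [hi1, hk2]
        linarith
      have hΩk : 1 ≤ (N * p ^ d2 H) ^ (k - 2) := one_le_pow₀ hΩ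
      rw [mul_pow] at hΩk
      have e1 : 1 ≤ N ^ (k - 2) * p ^ (i - 1) :=
        hΩk.trans (mul_le_mul_of_nonneg_left hpi (by positivity))
      have e2 : p ^ (2 * (HE H).card) =
          p ^ (TF (HE H) ψ ∪ TF (HE H) ψ').card * (p ^ (i - 1) * p) := by
        rw [← pow_succ, Nat.sub_add_cancel hi1, ← pow_add, hcard]
      have e3 : N ^ k = N ^ (k - 2) * N ^ 2 := by rw [← pow_add, Nat.sub_add_cancel hk2]
      rw [e2, e3]
      have e4 : p ^ (TF (HE H) ψ ∪ TF (HE H) ψ').card * (p ^ (i - 1) * p) / (p * N ^ 2) *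
          (N ^ (k - 2) * N ^ 2) =
          p ^ (TF (HE H) ψ ∪ TF (HE H) ψ').card * (N ^ (k - 2) * p ^ (i - 1)) := by
        field_simp
      rw [e4]
      exact le_mul_of_one_le_right (by positivity) e1)
  refine h.trans (Real.exp_le_exp.2 (neg_le_neg ?_))
  rw [← hN, ← hv, mul_pow]
  have e5 : (I.card : ℝ) * p ^ (2 * (HE H).card) /
      (4 * (p ^ (2 * (HE H).card) / (p * N ^ 2)) * (((v : ℝ) + 1) ^ v * N ^ v)) =
      I.card * (N ^ 2 * p) / (4 * ((v : ℝ) + 1) ^ v * N ^ v) := by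
    field_simp
  rw [e5, le_div_iff₀ (by positivity)]
  calc γ / (4 * ((v : ℝ) + 1) ^ v) * (N ^ 2 * p) * (4 * ((v : ℝ) + 1) ^ v * N ^ v)
      = (γ * N ^ v) * (N ^ 2 * p) := by field_simp
    _ ≤ _ := mul_le_mul_of_nonneg_right hγ (by positivity)

/-- Lower bound on the number of injections with two prescribed values. -/
lemma pinned_count {α V : Type*} [Fintype α] [Fintype V] {a b : α} (hab : a ≠ b)
    {x y : V} (hxy : x ≠ y) (hN : 2 * Fintype.card α ≤ Fintype.card V) :
    ((Fintype.card V : ℝ) / 2) ^ (Fintype.card α - 2) ≤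
      ((Finset.univ.filter (fun ψ : α → V => Function.Injective ψ ∧ ψ a = x ∧ ψ b = y)).card
        : ℝ) := by
  let A := {u : α // u ≠ a ∧ u ≠ b}
  let B := {w : V // w ≠ x ∧ w ≠ y}
  have cA : Fintype.card A = Fintype.card α - 2 := by
    have : Fintype.card A = (Finset.univ \ {a, b} : Finset α).card := by
      rw [Fintype.card_subtype]; congr 1; ext u; simp
    rw [this, Finset.card_sdiff_of_subset (Finset.subset_univ _), Finset.card_pair hab,
      Finset.card_univ]
  have cB : Fintype.card B = Fintype.card V - 2 := by
    have : Fintype.card B = (Finset.univ \ {x, y} : Finset V).card := by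
      rw [Fintype.card_subtype]; congr 1; ext u; simp
    rw [this, Finset.card_sdiff_of_subset (Finset.subset_univ _), Finset.card_pair hxy,
      Finset.card_univ]
  let ext : (A ↪ B) → (α → V) := fun φ u =>
    if ha : u = a then x else if hb : u = b then y else (φ ⟨u, ha, hb⟩).1
  have hcard : Fintype.card (A ↪ B) ≤
      (Finset.univ.filter (fun ψ : α → V => Function.Injective ψ ∧ ψ a = x ∧ ψ b = y)).card := by
    rw [← Finset.card_univ]
    refine Finset.card_le_card_of_injOn ext ?_ ?_
    · intro φ _
      simp only [Finset.coe_filter, Finset.mem_univ, true_and, Set.mem_setOf_eq]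
      refine ⟨?_, by simp [ext], by simp [ext, hab.symm]⟩
      intro u w huw
      simp only [ext] at huw
      by_cases hua : u = a
      · by_cases hwa : w = a
        · rw [hua, hwa]
        · by_cases hwb : w = b
          · simp [hua, hwa, hwb, hab.symm] at huw
            exact absurd huw hxy
          · simp [hua, hwa, hwb] at huw
            exact absurd huw.symm (φ ⟨w, hwa, hwb⟩).2.1
      · by_cases hub : u = b
        · by_cases hwa : w = a
          · simp [hub, hwa, hab.symm] at huw
            exact absurd huw.symm hxy
          · by_cases hwb : w = b
            · rw [hub, hwb]
            · simp [hub, hwa, hwb, hab.symm] at huw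
              exact absurd huw.symm (φ ⟨w, hwa, hwb⟩).2.2
        · by_cases hwa : w = a
          · simp [hua, hub, hwa] at huw
            exact absurd huw (φ ⟨u, hua, hub⟩).2.1
          · by_cases hwb : w = b
            · simp [hua, hub, hwb, hab.symm] at huw
              exact absurd huw (φ ⟨u, hua, hub⟩).2.2
            · simp only [dif_neg hua, dif_neg hub, dif_neg hwa, dif_neg hwb] at huw
              have := φ.injective (Subtype.ext huw)
              exact congrArg Subtype.val this
    · intro φ _ φ' _ h
      ext z
      have := congrFun h z.1
      simpa only [ext, dif_neg z.2.1, dif_neg z.2.2] using this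
  rw [Fintype.card_embedding_eq, cA, cB] at hcard
  have h2 := Nat.pow_sub_le_descFactorial (Fintype.card V - 2) (Fintype.card α - 2)
  have hα : 2 ≤ Fintype.card α := by
    have := Finset.card_le_univ ({a, b} : Finset α)
    rwa [Finset.card_pair hab] at this
  have h3 : (Fintype.card V : ℝ) / 2 ≤
      ((Fintype.card V - 2 + 1 - (Fintype.card α - 2) : ℕ) : ℝ) := by
    rw [div_le_iff₀ (by norm_num)]
    have : Fintype.card V ≤ (Fintype.card V - 2 + 1 - (Fintype.card α - 2)) * 2 := by omega
    exact_mod_cast this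
  calc ((Fintype.card V : ℝ) / 2) ^ (Fintype.card α - 2)
      ≤ ((Fintype.card V - 2 + 1 - (Fintype.card α - 2) : ℕ) : ℝ) ^ (Fintype.card α - 2) :=
        pow_le_pow_left₀ (by positivity) h3 _
    _ ≤ _ := by exact_mod_cast h2.trans hcard

/-- The probability that a pair is not covered. -/
lemma fam1 {α V : Type*} [Fintype α] [Fintype V] [DecidableEq V] {H : SimpleGraph α}
    (hH : Strictly2Balanced H) {E : Finset (Sym2 V)} (hE : ∀ q : Sym2 V, ¬ q.IsDiag → q ∈ E)
    {p : ℝ} (h0 : 0 < p) (h1 : p ≤ 1)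
    (hΩ : 1 ≤ (Fintype.card V : ℝ) * p ^ (d2 H)) {a b : α} (hab : H.Adj a b)
    {x y : V} (hxy : x ≠ y) (hNv : 2 * Fintype.card α ≤ Fintype.card V) :
    EX E p (fun s => if ∃ ψ : α → V, (Function.Injective ψ ∧ ψ a = x ∧ ψ b = y) ∧
        TF ((HE H).erase s(a, b)) ψ ⊆ s then 0 else 1) ≤
      Real.exp (-((Fintype.card V : ℝ) * p ^ (d2 H) /
        (4 * ((Fintype.card α : ℝ) + 1) ^ Fintype.card α * 2 ^ (Fintype.card α - 2)))) := by
  have hcnt0 := pinned_count hab.ne hxy hNv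
  set I := Finset.univ.filter (fun ψ : α → V => Function.Injective ψ ∧ ψ a = x ∧ ψ b = y)
    with hIdef
  have hcnt : ((Fintype.card V : ℝ) / 2) ^ (Fintype.card α - 2) ≤ (I.card : ℝ) := by
    convert hcnt0
  have hI : ∀ ψ ∈ I, Function.Injective ψ ∧ ψ a = x ∧ ψ b = y := fun ψ hψ =>
    (Finset.mem_filter.1 hψ).2
  set F := (HE H).erase s(a, b) with hFdef
  have habE : s(a, b) ∈ HE H := mem_HE.2 hab
  have hV : 0 < Fintype.card V := Fintype.card_pos_iff.2 ⟨x⟩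
  have hα : 2 ≤ Fintype.card α := by
    have := Finset.card_le_univ ({a, b} : Finset α)
    rwa [Finset.card_pair hab.ne] at this
  set N : ℝ := (Fintype.card V : ℝ) with hN
  set v := Fintype.card α with hv
  have hN0 : 0 < N := by rw [hN]; exact_mod_cast hV
  have hF : F.Nonempty := Finset.card_pos.1 (by
    have := two_le_HE hH
    rw [hFdef, Finset.card_erase_of_mem habE]; omega)
  set Ω := N * p ^ (d2 H) with hΩdef
  have hΩ0 : 0 < Ω := by linarith
  have h := janson_embed h0 h1 F hF I (fun ψ hψ => (hI ψ hψ).1)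
    (fun ψ hψ => TF_sub (Finset.erase_subset _ _) (hI ψ hψ).1 hE)
    (p ^ (2 * F.card) / (N ^ 2 * Ω)) (by positivity) hV (by
      intro ψ hψ ψ' hψ' hnd
      obtain ⟨i1, a1, b1⟩ := hI ψ hψ
      obtain ⟨i2, a2, b2⟩ := hI ψ' hψ'
      set k := (ovS ψ ψ').card with hk
      have haS : a ∈ ovS ψ ψ' := by simp [ovS, a2, ← a1]
      have hbS : b ∈ ovS ψ ψ' := by simp [ovS, b2, ← b1]
      have hcard : (TF F ψ ∪ TF F ψ').card + (TF F ψ ∩ TF F ψ').card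
          = 2 * F.card := by
        rw [Finset.card_union_add_card_inter, TF_card _ i1, TF_card _ i2]; ring
      have hi := inter_card_le F (ψ := ψ) i2
      have hfe : (F.filter (fun q => ∀ a ∈ q, a ∈ ovS ψ ψ')).card + 1 = eIn H (ovS ψ ψ') := by
        unfold eIn
        have hm : s(a, b) ∈ (HE H).filter (fun q => ∀ a ∈ q, a ∈ ovS ψ ψ') := by
          rw [Finset.mem_filter]
          refine ⟨habE, fun z hz => ?_⟩
          rcases Sym2.mem_iff.1 hz with rfl | rfl
          · exact haS
          · exact hbS
        rw [hFdef, Finset.filter_erase, Finset.card_erase_add_one hm]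
      set i := (TF F ψ ∩ TF F ψ').card with hidef
      have hi1 : 1 ≤ i := by
        rw [Finset.disjoint_iff_inter_eq_empty, ← Finset.card_eq_zero] at hnd
        omega
      have hk3 : 3 ≤ k := by
        have hpos : 0 < (F.filter (fun q => ∀ a ∈ q, a ∈ ovS ψ ψ')).card := by omega
        obtain ⟨q, hq⟩ := Finset.card_pos.1 hpos
        rw [Finset.mem_filter, hFdef, Finset.mem_erase, mem_HE] at hq
        by_contra hlt
        have hpair : ({a, b} : Finset α) = ovS ψ ψ' := by
          apply Finset.eq_of_subset_of_card_le
          · intro z hz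
            rcases Finset.mem_insert.1 hz with rfl | hz
            · exact haS
            · rw [Finset.mem_singleton] at hz; rw [hz]; exact hbS
          · rw [Finset.card_pair hab.ne]; omega
        induction q with
        | h u w =>
          have huw := (hq.1.2 : H.Adj u w).ne
          have hu := hq.2 u (by simp)
          have hw := hq.2 w (by simp)
          rw [← hpair] at hu hw
          simp only [Finset.mem_insert, Finset.mem_singleton] at hu hw
          apply hq.1.1
          rcases hu with rfl | rfl <;> rcases hw with rfl | rfl
          · exact absurd rfl huw
          · rfl
          · exact Sym2.eq_swap
          · exact absurd rfl huw
      have hk2 : 2 ≤ k := by omega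
      have hb := bal hH (ovS ψ ψ') hk2
      have hie : (i : ℝ) + 1 ≤ eIn H (ovS ψ ψ') := by exact_mod_cast (by omega)
      have hpi : (p ^ d2 H) ^ (k - 2) ≤ p ^ i := by
        apply rpow_aux h0 h1
        push_cast [hk2]
        linarith
      have hΩk : Ω ≤ (N * p ^ d2 H) ^ (k - 2) := le_self_pow₀ hΩ (by omega)
      rw [mul_pow] at hΩk
      have e1 : Ω ≤ N ^ (k - 2) * p ^ i :=
        hΩk.trans (mul_le_mul_of_nonneg_left hpi (by positivity))
      have e2 : p ^ (2 * F.card) = p ^ (TF F ψ ∪ TF F ψ').card * p ^ i := by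
        rw [← pow_add, hcard]
      have e3 : N ^ k = N ^ (k - 2) * N ^ 2 := by rw [← pow_add, Nat.sub_add_cancel hk2]
      rw [e2, e3]
      have e4 : p ^ (TF F ψ ∪ TF F ψ').card * p ^ i / (N ^ 2 * Ω) *
          (N ^ (k - 2) * N ^ 2) =
          p ^ (TF F ψ ∪ TF F ψ').card * ((N ^ (k - 2) * p ^ i) / Ω) := by
        field_simp
      rw [e4]
      exact le_mul_of_one_le_right (by positivity) ((one_le_div hΩ0).2 e1))
  have hset : ∀ s : Finset (Sym2 V), (∃ ψ : α → V, (Function.Injective ψ ∧ ψ a = x ∧ ψ b = y) ∧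
        TF F ψ ⊆ s) ↔ ∃ ψ ∈ I, TF F ψ ⊆ s := by
    intro s; simp [hIdef]
  simp only [hset]
  refine h.trans (Real.exp_le_exp.2 (neg_le_neg ?_))
  rw [← hN, ← hv, mul_pow]
  have e5 : (I.card : ℝ) * p ^ (2 * F.card) /
      (4 * (p ^ (2 * F.card) / (N ^ 2 * Ω)) * (((v : ℝ) + 1) ^ v * N ^ v)) =
      I.card * (N ^ 2 * Ω) / (4 * ((v : ℝ) + 1) ^ v * N ^ v) := by
    field_simp
  rw [e5, le_div_iff₀ (by positivity)]
  have e6 : N ^ v = N ^ (v - 2) * N ^ 2 := by rw [← pow_add, Nat.sub_add_cancel hα]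
  calc Ω / (4 * ((v : ℝ) + 1) ^ v * 2 ^ (v - 2)) * (4 * ((v : ℝ) + 1) ^ v * N ^ v)
      = (N / 2) ^ (v - 2) * (N ^ 2 * Ω) := by rw [e6, div_pow]; field_simp
    _ ≤ _ := mul_le_mul_of_nonneg_right hcnt (by positivity)

end FamPart


section LinPart

lemma mem_edgeSpace {V : Type*} [Fintype V] [DecidableEq V] {G : SimpleGraph V} {f : EdgeVec V} :
    f ∈ edgeSpace G ↔ ∀ e, f e ≠ 0 → e ∈ G.edgeSet := by
  constructor
  · intro h
    refine Submodule.span_induction (p := fun f _ => ∀ e, f e ≠ 0 → e ∈ G.edgeSet) ?_ ?_ ?_ ?_ h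
    · rintro x ⟨e, he, rfl⟩ e' h'
      by_cases hh : e' = e
      · rwa [hh]
      · simp [setVec, hh] at h'
    · intro e h; simp at h
    · intro x y _ _ hx hy e h
      by_cases h1 : x e = 0
      · apply hy; intro h2; apply h; simp [h1, h2]
      · exact hx e h1
    · intro a x _ hx e h
      apply hx; intro h2; apply h; simp [h2]
  · intro h
    have : f = ∑ e, f e • setVec {e} := by
      funext e'
      simp [setVec]
    rw [this]
    refine Submodule.sum_mem _ fun e _ => ?_
    by_cases hf : f e = 0
    · simp [hf]
    · exact Submodule.smul_mem _ _ (Submodule.subset_span ⟨e, h e hf, rfl⟩)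

/-- The lift of `g x + g y` to unordered pairs. -/
def gs {V : Type*} (g : V → ZMod 2) : Sym2 V → ZMod 2 :=
  Sym2.lift ⟨fun x y => g x + g y, fun _ _ => add_comm _ _⟩

@[simp] lemma gs_mk {V : Type*} (g : V → ZMod 2) (x y : V) : gs g s(x, y) = g x + g y := rfl

lemma gs_map {α V : Type*} (g : V → ZMod 2) (ψ : α → V) (e : Sym2 α) :
    gs g (Sym2.map ψ e) = gs (g ∘ ψ) e := by
  induction e using Sym2.ind with
  | _ x y => simp

lemma sum_gs {V : Type*} [Fintype V] [DecidableEq V] (f : EdgeVec V)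
    (hf : ∀ e : Sym2 V, e.IsDiag → f e = 0) (g : V → ZMod 2) :
    ∑ e, f e * gs g e = ∑ v, g v * ∑ w ∈ Finset.univ.erase v, f s(v, w) := by
  have h1 : ∀ e : Sym2 V, f e * gs g e = ∑ v, if v ∈ e then f e * g v else 0 := by
    intro e
    induction e using Sym2.ind with
    | _ x y =>
      by_cases hxy : x = y
      · subst hxy
        simp [hf s(x, x) (by simp)]
      · have : ∀ v, (if v ∈ s(x, y) then f s(x, y) * g v else 0) =
            (if v = x then f s(x, y) * g v else 0) + (if v = y then f s(x, y) * g v else 0) := by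
          intro v
          by_cases h1 : v = x
          · subst h1; simp [hxy]
          · simp [h1]
        simp only [this, Finset.sum_add_distrib]
        simp [mul_add]
  rw [Finset.sum_congr rfl (fun e _ => h1 e), Finset.sum_comm]
  refine Finset.sum_congr rfl fun v _ => ?_
  rw [Finset.mul_sum, ← Finset.sum_filter]
  have h2 : ∑ w ∈ Finset.univ.erase v, g v * f s(v, w) = ∑ w, g v * f s(v, w) := by
    rw [← Finset.add_sum_erase _ _ (Finset.mem_univ v), hf s(v, v) (by simp)]; simp
  rw [h2]
  have h3 : (Finset.univ.filter (fun e : Sym2 V => v ∈ e)) =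
      Finset.univ.image (fun w => s(v, w)) := by
    ext e
    simp only [Finset.mem_filter, Finset.mem_univ, true_and, Finset.mem_image]
    rw [Sym2.mem_iff_exists]
    exact ⟨fun ⟨w, h⟩ => ⟨w, h.symm⟩, fun ⟨w, h⟩ => ⟨w, h.symm⟩⟩
  rw [h3, Finset.sum_image]
  · exact Finset.sum_congr rfl fun w _ => mul_comm _ _
  · intro w _ w' _ h
    exact Sym2.congr_right.1 h

lemma setVec_TF_sum {α V : Type*} [Fintype α] [Fintype V] [DecidableEq V] {H : SimpleGraph α}
    {ψ : α → V} (hψ : Function.Injective ψ) (h : Sym2 V → ZMod 2) :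
    ∑ e ∈ TF (HE H) ψ, h e = ∑ e ∈ HE H, h (Sym2.map ψ e) := by
  unfold TF
  rw [Finset.sum_image]
  intro x _ y _ hxy
  exact Sym2.map.injective hψ hxy

lemma hand {α : Type*} [Fintype α] (H : SimpleGraph α) (g : α → ZMod 2) :
    ∑ e ∈ HE H, gs g e = ∑ u, g u * (Nat.card ↥(H.neighborSet u) : ZMod 2) := by
  have h := sum_gs (fun e => if e ∈ HE H then (1 : ZMod 2) else 0) (by
    intro e he
    rw [if_neg]
    intro h
    induction e using Sym2.ind with
    | _ x y =>
      have : H.Adj x y := mem_HE.1 h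
      simp at he
      exact this.ne he) g
  simp only [ite_mul, one_mul, zero_mul] at h
  rw [Finset.sum_ite_mem, Finset.univ_inter] at h
  rw [h]
  refine Finset.sum_congr rfl fun u _ => ?_
  congr 1
  rw [← Finset.sum_filter, Finset.sum_const, nsmul_eq_mul, mul_one, Nat.card_eq_fintype_card,
    SimpleGraph.card_neighborSet_eq_degree]
  congr 2
  ext w
  simp only [Finset.mem_filter, Finset.mem_erase, Finset.mem_univ, and_true,
    SimpleGraph.mem_neighborFinset]
  rw [mem_HE]
  simp only [SimpleGraph.mem_edgeSet]
  exact ⟨fun h => h.2, fun h => ⟨h.ne', h⟩⟩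

lemma copy_of_sub {α V : Type*} [Fintype α] [Fintype V] [DecidableEq V] {H : SimpleGraph α}
    {G : SimpleGraph V} {K : G.Subgraph} (hK : Nonempty (H ≃g K.coe)) :
    ∃ ψ : α → V, Function.Injective ψ ∧ ∀ e, e ∈ K.edgeSet ↔ e ∈ TF (HE H) ψ := by
  obtain ⟨φ⟩ := hK
  refine ⟨fun u => (φ u : V), fun x y h => φ.injective (Subtype.ext h), fun e => ?_⟩
  unfold TF
  induction e using Sym2.ind with
  | _ x y =>
    rw [Finset.mem_image]
    constructor
    · intro h
      have h' : K.Adj x y := h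
      obtain ⟨u, hu⟩ := φ.surjective ⟨x, h'.fst_mem⟩
      obtain ⟨w, hw⟩ := φ.surjective ⟨y, h'.snd_mem⟩
      refine ⟨s(u, w), mem_HE.2 ?_, by simp [hu, hw]⟩
      have : K.coe.Adj (φ u) (φ w) := by rw [hu, hw]; exact h'
      exact φ.map_adj_iff.1 this
    · rintro ⟨q, hq, hqe⟩
      induction q using Sym2.ind with
      | _ u w =>
        have h1 : H.Adj u w := mem_HE.1 hq
        have h2 : K.coe.Adj (φ u) (φ w) := φ.map_adj_iff.2 h1
        rw [← hqe]
        exact h2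

lemma sub_of_copy {α V : Type*} [Fintype α] [Fintype V] [DecidableEq V] {H : SimpleGraph α}
    {G : SimpleGraph V} {ψ : α → V} (hψ : Function.Injective ψ)
    (hG : ∀ e ∈ TF (HE H) ψ, e ∈ G.edgeSet) :
    ∃ K : G.Subgraph, Nonempty (H ≃g K.coe) ∧ ∀ e, e ∈ K.edgeSet ↔ e ∈ TF (HE H) ψ := by
  have hadj : ∀ u w, H.Adj u w → G.Adj (ψ u) (ψ w) := fun u w h =>
    hG s(ψ u, ψ w) (Finset.mem_image.2 ⟨s(u, w), mem_HE.2 h, rfl⟩)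
  let K : G.Subgraph :=
    { verts := Set.range ψ
      Adj := fun x y => ∃ u w, H.Adj u w ∧ ψ u = x ∧ ψ w = y
      adj_sub := by rintro x y ⟨u, w, h, rfl, rfl⟩; exact hadj u w h
      edge_vert := by rintro x y ⟨u, w, h, rfl, rfl⟩; exact ⟨u, rfl⟩
      symm := ⟨by rintro x y ⟨u, w, h, rfl, rfl⟩; exact ⟨w, u, h.symm, rfl, rfl⟩⟩ }
  refine ⟨K, ⟨⟨Equiv.ofInjective ψ hψ, ?_⟩⟩, ?_⟩
  · intro a b
    simp only [SimpleGraph.Subgraph.coe_adj, Equiv.ofInjective_apply]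
    constructor
    · rintro ⟨u, w, h, h1, h2⟩
      rwa [← hψ h1, ← hψ h2]
    · intro h
      exact ⟨a, b, h, rfl, rfl⟩
  · intro e
    unfold TF
    rw [Finset.mem_image]
    induction e using Sym2.ind with
    | _ x y =>
      constructor
      · rintro ⟨u, w, h, rfl, rfl⟩
        exact ⟨s(u, w), mem_HE.2 h, rfl⟩
      · rintro ⟨q, hq, hqe⟩
        induction q using Sym2.ind with
        | _ u w =>
          rw [← hqe]
          exact ⟨u, w, mem_HE.1 hq, rfl, rfl⟩

lemma setVec_TF {α V : Type*} [Fintype α] [Fintype V] [DecidableEq V] {H : SimpleGraph α}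
    {ψ : α → V} {S : Set (Sym2 V)} (hS : ∀ e, e ∈ S ↔ e ∈ TF (HE H) ψ) (h : Sym2 V → ZMod 2) :
    ∑ e, setVec S e * h e = ∑ e ∈ TF (HE H) ψ, h e := by
  unfold setVec
  simp only [hS, ite_mul, one_mul, zero_mul]
  rw [Finset.sum_ite_mem, Finset.univ_inter]

lemma perp_copy {α V : Type*} [Fintype α] [Fintype V] [DecidableEq V] {H : SimpleGraph α}
    {G : SimpleGraph V} {X : EdgeVec V} (hX : X ∈ perpIn G (hSpace H G))
    {ψ : α → V} (hψ : Function.Injective ψ)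
    (hG : ∀ e ∈ TF (HE H) ψ, e ∈ G.edgeSet) : ∑ e ∈ TF (HE H) ψ, X e = 0 := by
  obtain ⟨K, hK, hKe⟩ := sub_of_copy hψ hG
  have := hX.2 _ (Submodule.subset_span ⟨K, hK, rfl⟩)
  unfold ip at this
  rw [← setVec_TF hKe, ← this]
  exact Finset.sum_congr rfl fun e _ => mul_comm _ _

lemma diag_zero {V : Type*} [Fintype V] [DecidableEq V] {G : SimpleGraph V} {f : EdgeVec V}
    (hf : f ∈ edgeSpace G) (e : Sym2 V) (he : e.IsDiag) : f e = 0 := by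
  by_contra h
  exact G.not_isDiag_of_mem_edgeSet (mem_edgeSpace.1 hf e h) he

lemma hSpace_le {α V : Type*} [Fintype α] [Fintype V] [DecidableEq V] (H : SimpleGraph α)
    (G : SimpleGraph V) : hSpace H G ≤ wSpace H G := by
  refine Submodule.span_le.2 ?_
  rintro f ⟨K, hK, rfl⟩
  obtain ⟨ψ, hψ, hKe⟩ := copy_of_sub hK
  have hE : setVec K.edgeSet ∈ edgeSpace G := by
    rw [mem_edgeSpace]
    intro e he
    apply K.edgeSet_subset
    by_contra h
    simp [setVec, h] at he
  have hC : IsEulerianGraph H → setVec K.edgeSet ∈ cycleSpace G := by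
    intro hEul
    refine ⟨hE, ?_⟩
    rw [SetLike.mem_coe, Submodule.mem_iInf]
    intro v
    rw [LinearMap.mem_ker]
    have h1 := sum_gs (setVec K.edgeSet) (diag_zero hE) (Pi.single v 1)
    rw [setVec_TF hKe, setVec_TF_sum hψ] at h1
    simp only [gs_map] at h1
    rw [hand] at h1
    have h2 : ∀ u, ((Nat.card ↥(H.neighborSet u) : ℕ) : ZMod 2) = 0 := fun u =>
      (ZMod.natCast_eq_zero_iff_even).2 (hEul u)
    simp only [h2, mul_zero, Finset.sum_const_zero] at h1
    rw [Finset.sum_eq_single v] at h1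
    · rw [Pi.single_eq_same, one_mul] at h1
      exact h1.symm
    · intro b _ hb
      rw [Pi.single_eq_of_ne hb, zero_mul]
    · simp
  have hD : ¬ Odd (eCount H) → setVec K.edgeSet ∈ dSpace G := by
    intro hodd
    refine ⟨hE, ?_⟩
    rw [SetLike.mem_coe, LinearMap.mem_ker]
    have h1 := setVec_TF hKe (fun _ => 1)
    rw [setVec_TF_sum hψ, Finset.sum_const, ← eCount_eq] at h1
    simp only [mul_one, nsmul_eq_mul] at h1
    rw [(ZMod.natCast_eq_zero_iff_even).2 (Nat.not_odd_iff_even.1 hodd)] at h1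
    exact h1
  rw [SetLike.mem_coe]
  unfold wSpace
  split_ifs with h1 h2 h2
  · exact hC h1
  · exact ⟨hC h1, hD h2⟩
  · exact hE
  · exact hD h2

lemma exists_sep {α V : Type*} [Fintype α] [Fintype V] [DecidableEq V] {H : SimpleGraph α}
    {G : SimpleGraph V} (h : ¬ memT H G) :
    ∃ X ∈ perpIn G (hSpace H G), X ∉ perpIn G (wSpace H G) := by
  have hWE : wSpace H G ≤ edgeSpace G := by
    unfold wSpace
    split_ifs
    · exact inf_le_left
    · exact inf_le_left.trans inf_le_left
    · exact le_rfl
    · exact inf_le_left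
  have h1 : ∃ w ∈ wSpace H G, w ∉ hSpace H G := by
    by_contra! hh
    exact h (le_antisymm (hSpace_le H G) hh)
  obtain ⟨w, hw, hwn⟩ := h1
  obtain ⟨φ, hφw, hφ⟩ := Submodule.exists_le_ker_of_notMem hwn
  have key : ∀ f ∈ edgeSpace G,
      ip (fun e => if e ∈ G.edgeSet then φ (Pi.single e 1) else 0) f = φ f := by
    intro f hf
    unfold ip
    have : f = ∑ e, f e • (Pi.single e (1 : ZMod 2) : EdgeVec V) := by
      funext e'
      simp [Finset.sum_apply, Pi.single_apply]
    conv_rhs => rw [this, map_sum]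
    refine Finset.sum_congr rfl fun e _ => ?_
    rw [map_smul, smul_eq_mul]
    by_cases he : e ∈ G.edgeSet
    · simp only [if_pos he]; rw [mul_comm]
    · have : f e = 0 := by
        by_contra h2; exact he (mem_edgeSpace.1 hf e h2)
      simp [this]
  refine ⟨fun e => if e ∈ G.edgeSet then φ (Pi.single e 1) else 0, ⟨?_, ?_⟩, ?_⟩
  · rw [mem_edgeSpace]
    intro e he
    by_contra h2
    simp [h2] at he
  · intro f hf
    rw [key f (hWE (hSpace_le H G hf))]
    exact hφ hf
  · intro h2
    have h3 := h2.2 w hw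
    rw [key w (hWE hw)] at h3
    exact hφw h3

lemma Y_perp {α V : Type*} [Fintype α] [Fintype V] [DecidableEq V] {H : SimpleGraph α}
    {G : SimpleGraph V} {g : V → ZMod 2} {t : ZMod 2} (hg : IsEulerianGraph H ∨ g = 0)
    (ht : Odd (eCount H) → t = 0) :
    (fun e => if e ∈ G.edgeSet then gs g e + t else 0) ∈ perpIn G (wSpace H G) := by
  refine ⟨?_, ?_⟩
  · rw [mem_edgeSpace]
    intro e he
    by_contra h2
    simp [h2] at he
  · intro f hf
    have hE : f ∈ edgeSpace G := by
      unfold wSpace at hf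
      split_ifs at hf
      · exact hf.1
      · exact hf.1.1
      · exact hf
      · exact hf.1
    have e1 : ip (fun e => if e ∈ G.edgeSet then gs g e + t else 0) f =
        (∑ e, f e * gs g e) + t * ∑ e, f e := by
      unfold ip
      rw [Finset.mul_sum, ← Finset.sum_add_distrib]
      refine Finset.sum_congr rfl fun e _ => ?_
      by_cases he : e ∈ G.edgeSet
      · simp only [if_pos he]; ring
      · have : f e = 0 := by
          by_contra h2; exact he (mem_edgeSpace.1 hE e h2)
        simp [this]
    rw [e1]
    have e2 : ∑ e, f e * gs g e = 0 := by
      rw [sum_gs f (diag_zero hE)]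
      refine Finset.sum_eq_zero fun v _ => ?_
      rcases hg with hg | hg
      · have hC : f ∈ cycleSpace G := by
          unfold wSpace at hf
          rw [if_pos hg] at hf
          split_ifs at hf
          · exact hf
          · exact hf.1
        have := (Submodule.mem_iInf _).1 hC.2 v
        rw [LinearMap.mem_ker] at this
        have h3 : ∑ w ∈ Finset.univ.erase v, f s(v, w) = 0 := this
        rw [h3, mul_zero]
      · simp [hg]
    have e3 : t * ∑ e, f e = 0 := by
      by_cases ho : Odd (eCount H)
      · rw [ht ho, zero_mul]
      · have hD : f ∈ dSpace G := by
          unfold wSpace at hf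
          split_ifs at hf
          · exact hf.2
          · exact hf
        have h3 : ∑ e, f e = 0 := hD.2
        rw [h3, mul_zero]
    rw [e2, e3, add_zero]

lemma witness {α V : Type*} [Fintype α] [Fintype V] [DecidableEq V] {H : SimpleGraph α}
    {G : SimpleGraph V} {B : ℝ}
    (hgood : ∀ X ∈ perpIn G (hSpace H G), ∃ (g : V → ZMod 2) (t : ZMod 2),
      (IsEulerianGraph H ∨ g = 0) ∧ (Odd (eCount H) → t = 0) ∧
      ((Finset.univ.filter (fun e => e ∈ G.edgeSet ∧ X e ≠ gs g e + t)).card : ℝ) < B) :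
    memT H G ∨ ∃ X ∈ perpIn G (hSpace H G), X ∉ perpIn G (wSpace H G) ∧ (wt X : ℝ) < B := by
  by_cases h : memT H G
  · exact Or.inl h
  right
  obtain ⟨X, hX, hXn⟩ := exists_sep h
  obtain ⟨g, t, hg, ht, hB⟩ := hgood X hX
  have hY := Y_perp (G := G) hg ht
  set Y : EdgeVec V := fun e => if e ∈ G.edgeSet then gs g e + t else 0 with hYdef
  have ipadd : ∀ a b f : EdgeVec V, ip (a + b) f = ip a f + ip b f := by
    intro a b f
    unfold ip
    simp [add_mul, Finset.sum_add_distrib]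
  have hW : ∀ a b : EdgeVec V, ∀ S, a ∈ perpIn G S → b ∈ perpIn G S → a + b ∈ perpIn G S := by
    intro a b S ha hb
    refine ⟨Submodule.add_mem _ ha.1 hb.1, fun f hf => ?_⟩
    rw [ipadd, ha.2 f hf, hb.2 f hf, add_zero]
  refine ⟨X + Y, hW _ _ _ hX ⟨hY.1, fun f hf => hY.2 f (hSpace_le H G hf)⟩, ?_, ?_⟩
  · intro h2
    have h3 := hW _ _ _ h2 hY
    have h4 : X + Y + Y = X := by
      funext e
      have := CharTwo.add_self_eq_zero (Y e)
      simp only [Pi.add_apply, add_assoc, this, add_zero]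
    rw [h4] at h3
    exact hXn h3
  · refine lt_of_le_of_lt ?_ hB
    unfold wt
    rw [Nat.card_eq_fintype_card, Fintype.card_subtype]
    norm_cast
    refine Finset.card_le_card fun e he => ?_
    simp only [Finset.mem_filter, Finset.mem_univ, true_and] at he ⊢
    have hne : (X + Y) e ≠ 0 := he
    have heG : e ∈ G.edgeSet := mem_edgeSpace.1 (Submodule.add_mem _ hX.1 hY.1) e hne
    refine ⟨heG, fun h5 => hne ?_⟩
    rw [Pi.add_apply, h5, hYdef]
    simp only [if_pos heG]
    exact CharTwo.add_self_eq_zero _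

end LinPart


section StabPart

lemma exists_avoid {α M : Type*} [Fintype α] [Fintype M] [DecidableEq M] (S : Finset M)
    (h : Fintype.card α + S.card ≤ Fintype.card M) :
    ∃ ψ : α → M, Function.Injective ψ ∧ ∀ u, ψ u ∉ S := by
  have h1 : Fintype.card α ≤ Fintype.card {m : M // m ∉ S} := by
    have : Fintype.card {m : M // m ∉ S} = (Finset.univ \ S).card := by
      rw [Fintype.card_subtype]; congr 1; ext u; simp
    rw [this, Finset.card_sdiff_of_subset (Finset.subset_univ _), Finset.card_univ]
    omega
  obtain ⟨φ⟩ := Function.Embedding.nonempty_of_card_le h1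
  exact ⟨fun u => (φ u : M), fun x y hxy => φ.injective (Subtype.ext hxy), fun u => (φ u).2⟩

lemma four_cycle_s7 {α M : Type*} [Fintype α] [Fintype M] [DecidableEq M] {H : SimpleGraph α}
    (hM : Fintype.card α + 4 ≤ Fintype.card M) {u w : α} (huw : H.Adj u w)
    {f : Sym2 M → ZMod 2}
    (hf : ∀ ψ : α → M, Function.Injective ψ → ∑ e ∈ HE H, f (Sym2.map ψ e) = 0)
    {x x' b b' : M} (h1 : x ≠ x') (h2 : b ≠ b') (h3 : x ≠ b) (h4 : x ≠ b') (h5 : x' ≠ b)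
    (h6 : x' ≠ b') : f s(x, b) + f s(x', b) + f s(x, b') + f s(x', b') = 0 := by
  obtain ⟨ψ, hψ, hψS⟩ := exists_avoid (α := α) ({x, x', b, b'} : Finset M)
    ((Nat.add_le_add_left Finset.card_le_four _).trans hM)
  let Ψ : M → M → α → M := fun p q k => if k = u then p else if k = w then q else ψ k
  have hinj : ∀ p ∈ ({x, x'} : Finset M), ∀ q ∈ ({b, b'} : Finset M),
      Function.Injective (Ψ p q) := by
    intro p hp q hq k l hkl
    have hpq : p ≠ q := by
      simp only [Finset.mem_insert, Finset.mem_singleton] at hp hq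
      rcases hp with rfl | rfl <;> rcases hq with rfl | rfl <;> assumption
    have hpS : ∀ k, ψ k ≠ p := by
      intro k hk; apply hψS k; rw [hk]
      simp only [Finset.mem_insert, Finset.mem_singleton] at hp ⊢
      tauto
    have hqS : ∀ k, ψ k ≠ q := by
      intro k hk; apply hψS k; rw [hk]
      simp only [Finset.mem_insert, Finset.mem_singleton] at hq ⊢
      tauto
    simp only [Ψ] at hkl
    split_ifs at hkl with a1 a2 a3 a4 a5 a6 a7
    · rw [a1, a2]
    · exact absurd hkl hpq
    · exact absurd hkl.symm (hpS _)
    · exact absurd hkl hpq.symm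
    · rw [a4, a6]
    · exact absurd hkl.symm (hqS _)
    · exact absurd hkl (hpS _)
    · exact absurd hkl (hqS _)
    · exact hψ hkl
  have e1 := hf _ (hinj x (by simp) b (by simp))
  have e2 := hf _ (hinj x' (by simp) b (by simp))
  have e3 := hf _ (hinj x (by simp) b' (by simp))
  have e4 := hf _ (hinj x' (by simp) b' (by simp))
  have hsum : ∑ e ∈ HE H, (f (Sym2.map (Ψ x b) e) + f (Sym2.map (Ψ x' b) e) +
      f (Sym2.map (Ψ x b') e) + f (Sym2.map (Ψ x' b') e)) = 0 := by
    simp only [Finset.sum_add_distrib, e1, e2, e3, e4, add_zero]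
  rw [Finset.sum_eq_single s(u, w)] at hsum
  · simpa [Ψ, huw.ne'] using hsum
  · intro e he hne
    have z1 : ∀ a b : ZMod 2, a + b + a + b = 0 := by decide
    have z2 : ∀ a b : ZMod 2, a + a + b + b = 0 := by decide
    have z3 : ∀ a : ZMod 2, a + a + a + a = 0 := by decide
    induction e using Sym2.ind with
    | _ k l =>
      have hkl : k ≠ l := (show H.Adj k l from mem_HE.1 he).ne
      have hwu : w ≠ u := huw.ne'
      by_cases k1 : k = u
      · subst k1
        have l2 : l ≠ w := fun h => hne (by rw [h])
        simp only [Sym2.map_mk, Ψ, if_true, if_neg hkl.symm, if_neg l2]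
        exact z1 _ _
      · by_cases k2 : k = w
        · subst k2
          have l1 : l ≠ u := fun h => hne (by rw [h]; exact Sym2.eq_swap)
          simp only [Sym2.map_mk, Ψ, if_true, if_neg hwu, if_neg hkl.symm, if_neg l1]
          exact z2 _ _
        · by_cases l1 : l = u
          · subst l1
            simp only [Sym2.map_mk, Ψ, if_true, if_neg k1, if_neg k2]
            exact z1 _ _
          · by_cases l2 : l = w
            · subst l2
              simp only [Sym2.map_mk, Ψ, if_true, if_neg hwu, if_neg k1, if_neg k2]
              exact z2 _ _
            · simp only [Sym2.map_mk, Ψ, if_neg l1, if_neg l2, if_neg k1, if_neg k2]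
              exact z3 _
  · intro h; exact absurd (mem_HE.2 huw) h

lemma local_struct {α M : Type*} [Fintype α] [Fintype M] [DecidableEq M] {H : SimpleGraph α}
    (hM : Fintype.card α + 4 ≤ Fintype.card M) {u w : α} (huw : H.Adj u w)
    {f : Sym2 M → ZMod 2}
    (hf : ∀ ψ : α → M, Function.Injective ψ → ∑ e ∈ HE H, f (Sym2.map ψ e) = 0)
    {z a b x y : M} (hab : a ≠ b) (haz : a ≠ z) (hbz : b ≠ z) (hxy : x ≠ y) (hxz : x ≠ z)
    (hyz : y ≠ z) :
    f s(x, y) = (if IsEulerianGraph H then f s(z, x) + f s(z, y) else 0) +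
      (if Odd (eCount H) then 0 else f s(a, b) + f s(z, a) + f s(z, b)) := by
  let T : M → M → ZMod 2 := fun x y => f s(x, y) + f s(z, x) + f s(z, y)
  have Tsymm : ∀ x y, T x y = T y x := by
    intro x y
    simp only [T]
    rw [Sym2.eq_swap (a := x) (b := y)]; ring
  have T1 : ∀ x y y', x ≠ z → y ≠ z → y' ≠ z → x ≠ y → x ≠ y' → T x y = T x y' := by
    intro x y y' hx hy hy' hxy hxy'
    by_cases hyy : y = y'
    · rw [hyy]
    have := four_cycle_s7 hM huw hf (x := z) (x' := x) (b := y) (b' := y') hx.symm hyy hy.symm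
      hy'.symm hxy hxy'
    simp only [T]
    generalize f s(z, y) = A at *
    generalize f s(x, y) = B at *
    generalize f s(z, y') = C at *
    generalize f s(x, y') = D at *
    generalize f s(z, x) = E at *
    revert A B C D E
    decide
  have T2 : ∀ x y, x ≠ z → y ≠ z → x ≠ y → T x y = T a b := by
    intro x y hx hy hxy
    obtain ⟨c, hc⟩ : ∃ c, c ∉ ({z, x, a} : Finset M) := by
      by_contra! hcon
      have h1 : Fintype.card M ≤ ({z, x, a} : Finset M).card := by
        rw [← Finset.card_univ]
        exact Finset.card_le_card fun c _ => hcon c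
      have h2 : ({z, x, a} : Finset M).card ≤ 3 := Finset.card_le_three
      omega
    simp only [Finset.mem_insert, Finset.mem_singleton, not_or] at hc
    obtain ⟨c1, c2, c3⟩ := hc
    calc T x y = T x c := T1 x y c hx hy c1 hxy (Ne.symm c2)
      _ = T c x := Tsymm _ _
      _ = T c a := T1 c x a c1 hx haz c2 c3
      _ = T a c := Tsymm _ _
      _ = T a b := T1 a c b haz c1 hbz (Ne.symm c3) hab
  set t := T a b with ht
  have hfe : ∀ x y, x ≠ z → y ≠ z → x ≠ y → f s(x, y) = f s(z, x) + f s(z, y) + t := by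
    intro x y hx hy hxy
    rw [← T2 x y hx hy hxy]
    simp only [T]
    generalize f s(z, y) = A
    generalize f s(x, y) = B
    generalize f s(z, x) = C
    revert A B C
    decide
  set g : M → ZMod 2 := fun x => f s(z, x) with hg
  have hcopy : ∀ ψ : α → M, Function.Injective ψ → (∀ k, ψ k ≠ z) →
      ∑ k, g (ψ k) * (Nat.card ↥(H.neighborSet k) : ZMod 2) + (eCount H : ZMod 2) * t = 0 := by
    intro ψ hψ hz
    have h1 := hf ψ hψ
    have h2 : ∀ e ∈ HE H, f (Sym2.map ψ e) = gs (g ∘ ψ) e + t := by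
      intro e he
      induction e using Sym2.ind with
      | _ k l =>
        have hkl : k ≠ l := (show H.Adj k l from mem_HE.1 he).ne
        exact hfe _ _ (hz k) (hz l) (hψ.ne hkl)
    rw [Finset.sum_congr rfl h2, Finset.sum_add_distrib, hand, Finset.sum_const,
      nsmul_eq_mul, ← eCount_eq] at h1
    exact h1
  obtain ⟨ψ, hψ, hψz⟩ := exists_avoid (α := α) ({z} : Finset M) (by simp; omega)
  have hψz' : ∀ k, ψ k ≠ z := fun k => by simpa using hψz k
  rw [hfe x y hxz hyz hxy]
  by_cases hE : IsEulerianGraph H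
  · rw [if_pos hE]
    congr 1
    split_ifs with ho
    · have h1 := hcopy ψ hψ hψz'
      have h2 : ∀ k, ((Nat.card ↥(H.neighborSet k) : ℕ) : ZMod 2) = 0 := fun k =>
        (ZMod.natCast_eq_zero_iff_even).2 (hE k)
      simp only [h2, mul_zero, Finset.sum_const_zero, zero_add] at h1
      rwa [(ZMod.natCast_eq_one_iff_odd).2 ho, one_mul] at h1
    · rfl
  · rw [if_neg hE]
    have hE' : ∃ k, ¬ Even (Nat.card ↥(H.neighborSet k)) := by
      by_contra! hcon; exact hE hcon
    obtain ⟨k, hk⟩ := hE'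
    have hk1 : ((Nat.card ↥(H.neighborSet k) : ℕ) : ZMod 2) = 1 :=
      (ZMod.natCast_eq_one_iff_odd).2 (Nat.not_even_iff_odd.1 hk)
    have hgc : ∀ x x', x ≠ z → x' ≠ z → g x = g x' := by
      intro x x' hx hx'
      obtain ⟨ψ, hψ, hψS⟩ := exists_avoid (α := α) ({z, x, x'} : Finset M)
        ((Nat.add_le_add_left Finset.card_le_three _).trans (by omega))
      have hup : ∀ q, q ≠ z → q ∈ ({z, x, x'} : Finset M) →
          g q + ∑ l ∈ Finset.univ.erase k, g (ψ l) * (Nat.card ↥(H.neighborSet l) : ZMod 2) +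
            (eCount H : ZMod 2) * t = 0 := by
        intro q hq hqS
        have hne : ∀ l, ψ l ≠ q := fun l h => hψS l (h ▸ hqS)
        have hnz : ∀ l, ψ l ≠ z := fun l h => hψS l (by rw [h]; simp)
        have h1 := hcopy (Function.update ψ k q) (by
          intro i j hij
          by_cases hi : i = k
          · by_cases hj : j = k
            · rw [hi, hj]
            · rw [hi, Function.update_self, Function.update_of_ne hj] at hij
              exact absurd hij.symm (hne j)
          · by_cases hj : j = k
            · rw [hj, Function.update_self, Function.update_of_ne hi] at hij
              exact absurd hij (hne i)
            · rw [Function.update_of_ne hj, Function.update_of_ne hi] at hij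
              exact hψ hij) (by
          intro i
          by_cases hi : i = k
          · rw [hi, Function.update_self]; exact hq
          · rw [Function.update_of_ne hi]; exact hnz i)
        rw [← Finset.add_sum_erase _ _ (Finset.mem_univ k), Function.update_self, hk1,
          mul_one] at h1
        rw [← h1]
        congr 2
        refine Finset.sum_congr rfl fun l hl => ?_
        rw [Function.update_of_ne (Finset.ne_of_mem_erase hl)]
      have a1 := hup x hx (by simp)
      have a2 := hup x' hx' (by simp)
      rw [add_assoc] at a1 a2
      exact add_right_cancel (a1.trans a2.symm)
    have hzz : g x + g y = 0 := by
      rw [hgc x y hxz hyz]; exact CharTwo.add_self_eq_zero _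
    change g x + g y + t = 0 + _
    rw [hzz, zero_add, zero_add]
    split_ifs with ho
    · have h1 := hcopy ψ hψ hψz'
      rw [← hand H (fun k => g (ψ k)), Finset.sum_eq_zero, zero_add,
        (ZMod.natCast_eq_one_iff_odd).2 ho, one_mul] at h1
      · exact h1
      · intro e _
        induction e using Sym2.ind with
        | _ i j =>
          rw [gs_mk, hgc (ψ i) (ψ j) (hψz' i) (hψz' j)]
          exact CharTwo.add_self_eq_zero _
    · rfl

lemma card_comp_le {α M V : Type*} [Fintype α] [Fintype M] [Fintype V] [DecidableEq M]
    [DecidableEq V] {ψ : α → M}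
    (hψ : Function.Injective ψ) (O : Finset (α → V)) :
    (Finset.univ.filter (fun φ : M → V => φ ∘ ψ ∈ O)).card ≤
      O.card * Fintype.card V ^ (Fintype.card M - Fintype.card α) := by
  let C := {m : M // m ∉ Finset.univ.image ψ}
  have hC : Fintype.card C = Fintype.card M - Fintype.card α := by
    have : Fintype.card C = (Finset.univ \ Finset.univ.image ψ).card := by
      rw [Fintype.card_subtype]; congr 1; ext u; simp
    rw [this, Finset.card_sdiff_of_subset (Finset.subset_univ _), Finset.card_univ,
      Finset.card_image_of_injective _ hψ, Finset.card_univ]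
  have h1 : (O ×ˢ (Finset.univ : Finset (C → V))).card =
      O.card * Fintype.card V ^ (Fintype.card M - Fintype.card α) := by
    rw [Finset.card_product, Finset.card_univ, Fintype.card_fun, hC]
  rw [← h1]
  refine Finset.card_le_card_of_injOn (fun φ => (φ ∘ ψ, fun c => φ c.1)) ?_ ?_
  · intro φ hφ
    have := (Finset.mem_filter.1 hφ).2
    simp only [Finset.coe_product, Set.mem_prod, Finset.mem_coe]
    exact ⟨this, Finset.mem_univ _⟩
  · intro φ _ φ' _ h
    simp only [Prod.mk.injEq] at h
    funext m
    by_cases hm : m ∈ Finset.univ.image ψ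
    · obtain ⟨k, _, rfl⟩ := Finset.mem_image.1 hm
      exact congrFun h.1 k
    · exact congrFun h.2 ⟨m, hm⟩

lemma card_noninj_le {M V : Type*} [Fintype M] [Fintype V] [DecidableEq M] [DecidableEq V] :
    (Finset.univ.filter (fun φ : M → V => ¬ Function.Injective φ)).card ≤
      Fintype.card M ^ 2 * Fintype.card V ^ (Fintype.card M - 1) := by
  have h1 : (Finset.univ.filter (fun φ : M → V => ¬ Function.Injective φ)) ⊆
      (Finset.univ : Finset (M × M)).biUnion (fun q =>
        Finset.univ.filter (fun φ : M → V => φ q.1 = φ q.2 ∧ q.1 ≠ q.2)) := by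
    intro φ hφ
    have := (Finset.mem_filter.1 hφ).2
    simp only [Function.Injective] at this
    push Not at this
    obtain ⟨i, j, h, hij⟩ := this
    exact Finset.mem_biUnion.2 ⟨(i, j), Finset.mem_univ _,
      Finset.mem_filter.2 ⟨Finset.mem_univ _, h, hij⟩⟩
  refine (Finset.card_le_card h1).trans ?_
  refine (Finset.card_biUnion_le_card_mul _ _ (Fintype.card V ^ (Fintype.card M - 1)) ?_).trans ?_
  · rintro ⟨i, j⟩ _
    have hC : Fintype.card {m : M // m ≠ j} = Fintype.card M - 1 := by
      rw [Fintype.card_subtype_compl, Fintype.card_subtype_eq]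
    rw [← hC, ← Fintype.card_fun, ← Finset.card_univ]
    refine Finset.card_le_card_of_injOn (fun φ m => φ m.1) (fun _ _ => Finset.mem_coe.2
      (Finset.mem_univ _)) ?_
    intro φ hφ φ' hφ' h
    have a1 := (Finset.mem_filter.1 hφ).2
    have a2 := (Finset.mem_filter.1 hφ').2
    have key : ∀ m, m ≠ j → φ m = φ' m := fun m hm => congrFun h ⟨m, hm⟩
    funext m
    by_cases hm : m = j
    · rw [hm]
      have a3 : φ i = φ j := a1.1
      have a4 : φ' i = φ' j := a2.1
      rw [← a3, ← a4]
      exact key i a1.2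
    · exact key m hm
  · rw [Finset.card_univ, Fintype.card_prod, sq]

end StabPart


section StabPart2

lemma stability {α : Type*} [Fintype α] {H : SimpleGraph α} {u w : α} (huw : H.Adj u w)
    {η : ℝ} (hη : 0 < η) :
    ∃ γ : ℝ, 0 < γ ∧ ∃ n0 : ℕ, ∀ (V : Type) [Fintype V] [DecidableEq V], n0 ≤ Fintype.card V →
      ∀ f : Sym2 V → ZMod 2,
      ((Finset.univ.filter (fun ψ : α → V => Function.Injective ψ ∧
        ∑ e ∈ HE H, f (Sym2.map ψ e) = 1)).card : ℝ) < γ * (Fintype.card V : ℝ) ^ Fintype.card α →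
      ∃ (g : V → ZMod 2) (t : ZMod 2), (IsEulerianGraph H ∨ g = 0) ∧
        (Odd (eCount H) → t = 0) ∧
        ((Finset.univ.filter (fun e : Sym2 V => ¬ e.IsDiag ∧ f e ≠ gs g e + t)).card : ℝ) ≤
          η * (Fintype.card V : ℝ) ^ 2 := by
  set v := Fintype.card α with hv
  let R := Fin (v + 3)
  let M := R ⊕ Bool
  have hMc : Fintype.card M = v + 5 := by simp [M, R]
  set m := v + 5 with hm
  obtain ⟨n1, hn1⟩ := exists_nat_ge (2 * (m : ℝ) ^ 2 / η)
  refine ⟨η / (2 * (m : ℝ) ^ v), by positivity, n1 + 1, ?_⟩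
  intro V _ _ hV f hO
  set N := Fintype.card V with hN
  have hN1 : 1 ≤ N := by omega
  have hNpos : (0 : ℝ) < N := by exact_mod_cast hN1
  set O := Finset.univ.filter (fun ψ : α → V => Function.Injective ψ ∧
        ∑ e ∈ HE H, f (Sym2.map ψ e) = 1) with hOdef
  set B : Finset (M → V) := Finset.univ.filter (fun φ => ¬ Function.Injective φ) ∪
    (Finset.univ : Finset (α → M)).biUnion (fun ψ => if Function.Injective ψ then
      Finset.univ.filter (fun φ : M → V => φ ∘ ψ ∈ O) else ∅) with hB
  have hBcard : B.card ≤ m ^ 2 * N ^ (m - 1) + m ^ v * (O.card * N ^ 5) := by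
    refine (Finset.card_union_le _ _).trans (Nat.add_le_add ?_ ?_)
    · have := card_noninj_le (M := M) (V := V)
      rwa [hMc] at this
    · refine (Finset.card_biUnion_le_card_mul _ _ (O.card * N ^ 5) ?_).trans ?_
      · intro ψ _
        split_ifs with h
        · have := card_comp_le h O
          rw [hMc, ← hv, hm, Nat.add_sub_cancel_left] at this
          exact this
        · simp
      · rw [Finset.card_univ, Fintype.card_fun, hMc]
  have hBreal : (B.card : ℝ) ≤ (N : ℝ) ^ (v + 3) * (η * (N : ℝ) ^ 2) := by
    have h1 : (B.card : ℝ) ≤ (m : ℝ) ^ 2 * (N : ℝ) ^ (v + 4) +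
        (m : ℝ) ^ v * (O.card * (N : ℝ) ^ 5) := by
      have : m - 1 = v + 4 := by omega
      rw [this] at hBcard
      exact_mod_cast hBcard
    have h2 : (m : ℝ) ^ v * (O.card * (N : ℝ) ^ 5) ≤
        (m : ℝ) ^ v * ((η / (2 * (m : ℝ) ^ v) * (N : ℝ) ^ v) * (N : ℝ) ^ 5) := by
      gcongr
    have hmpos : (0 : ℝ) < m := by positivity
    have h3 : (m : ℝ) ^ v * ((η / (2 * (m : ℝ) ^ v) * (N : ℝ) ^ v) * (N : ℝ) ^ 5) =
        (N : ℝ) ^ (v + 3) * (η / 2 * (N : ℝ) ^ 2) := by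
      rw [pow_add]; field_simp
    have h4 : (m : ℝ) ^ 2 * (N : ℝ) ^ (v + 4) ≤ (N : ℝ) ^ (v + 3) * (η / 2 * (N : ℝ) ^ 2) := by
      have h5 : (m : ℝ) ^ 2 ≤ η / 2 * N := by
        have h6 : (n1 : ℝ) ≤ N := by exact_mod_cast (by omega : n1 ≤ N)
        have h7 := hn1.trans h6
        rw [div_le_iff₀ hη] at h7
        linarith
      calc (m : ℝ) ^ 2 * (N : ℝ) ^ (v + 4) ≤ (η / 2 * N) * (N : ℝ) ^ (v + 4) := by gcongr
        _ = _ := by ring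
    calc (B.card : ℝ) ≤ _ := h1
      _ ≤ (N : ℝ) ^ (v + 3) * (η / 2 * (N : ℝ) ^ 2) +
          (N : ℝ) ^ (v + 3) * (η / 2 * (N : ℝ) ^ 2) := by
          refine add_le_add h4 (h2.trans h3.le)
      _ = _ := by ring
  have hne : (Finset.univ : Finset (R → V)).Nonempty := by
    have : Nonempty V := Fintype.card_pos_iff.1 hN1
    exact Finset.univ_nonempty
  have hsum : ∑ ρ : R → V, ((Finset.univ.filter
      (fun σ : Bool → V => Sum.elim ρ σ ∈ B)).card : ℝ) ≤
      ∑ _ρ : R → V, η * (N : ℝ) ^ 2 := by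
    rw [Finset.sum_const, Finset.card_univ, Fintype.card_fun, nsmul_eq_mul]
    have e1 : Fintype.card R = v + 3 := by simp [R]
    rw [e1, ← hN]
    refine le_trans ?_ (hBreal.trans (by push_cast; exact le_rfl))
    rw [Finset.card_eq_sum_card_fiberwise (f := fun φ : M → V => φ ∘ Sum.inl)
      (t := Finset.univ) (fun _ _ => Finset.mem_coe.2 (Finset.mem_univ _))]
    push_cast
    refine Finset.sum_le_sum fun ρ _ => ?_
    norm_cast
    refine Finset.card_le_card_of_injOn (fun σ => Sum.elim ρ σ) ?_ ?_
    · intro σ hσ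
      have := (Finset.mem_filter.1 hσ).2
      exact Finset.mem_coe.2 (Finset.mem_filter.2 ⟨this, Sum.elim_comp_inl _ _⟩)
    · intro σ _ σ' _ h
      funext i
      exact congrFun h (Sum.inr i)
  obtain ⟨ρ, _, hρ⟩ := Finset.exists_le_of_sum_le hne hsum
  let z : R := ⟨0, by omega⟩
  let a : R := ⟨1, by omega⟩
  let b : R := ⟨2, by omega⟩
  have hab : a ≠ b := fun h => by have := congrArg Fin.val h; simp [a, b] at this
  have haz : a ≠ z := fun h => by have := congrArg Fin.val h; simp [a, z] at this
  have hbz : b ≠ z := fun h => by have := congrArg Fin.val h; simp [b, z] at this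
  refine ⟨fun x => if IsEulerianGraph H then f s(ρ z, x) else 0,
    if Odd (eCount H) then 0 else f s(ρ a, ρ b) + f s(ρ z, ρ a) + f s(ρ z, ρ b), ?_, ?_, ?_⟩
  · by_cases hE : IsEulerianGraph H
    · exact Or.inl hE
    · right; funext x; simp [hE]
  · intro ho; rw [if_pos ho]
  · refine le_trans ?_ hρ
    norm_cast
    refine le_trans (Finset.card_le_card ?_) (Finset.card_image_le (f := fun σ : Bool → V =>
      s(σ true, σ false)))
    intro e he
    obtain ⟨hd, hfe⟩ := (Finset.mem_filter.1 he).2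
    induction e using Sym2.ind with
    | _ x y =>
      refine Finset.mem_image.2 ⟨fun i => cond i x y, Finset.mem_filter.2
        ⟨Finset.mem_univ _, ?_⟩, rfl⟩
      by_contra hnb
      apply hfe
      set φ : M → V := Sum.elim ρ (fun i => cond i x y) with hφ
      rw [hB, Finset.mem_union, not_or] at hnb
      obtain ⟨n1, n2⟩ := hnb
      have hinj : Function.Injective φ := by
        by_contra hni
        exact n1 (Finset.mem_filter.2 ⟨Finset.mem_univ _, hni⟩)
      have heven : ∀ ψ : α → M, Function.Injective ψ →
          ∑ e ∈ HE H, (fun q => f (Sym2.map φ q)) (Sym2.map ψ e) = 0 := by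
        intro ψ hψ
        by_contra hne0
        apply n2
        refine Finset.mem_biUnion.2 ⟨ψ, Finset.mem_univ _, ?_⟩
        rw [if_pos hψ]
        refine Finset.mem_filter.2 ⟨Finset.mem_univ _, ?_⟩
        rw [hOdef]
        refine Finset.mem_filter.2 ⟨Finset.mem_univ _, hinj.comp hψ, ?_⟩
        have z1 : ∀ q : ZMod 2, q ≠ 0 → q = 1 := by decide
        have := z1 _ hne0
        simpa only [Sym2.map_map] using this
      have hl := local_struct (H := H) (M := M) (by rw [hMc]; omega) huw heven
        (z := Sum.inl z) (a := Sum.inl a) (b := Sum.inl b) (x := Sum.inr true)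
        (y := Sum.inr false) (f := fun q => f (Sym2.map φ q))
        (Sum.inl_injective.ne hab) (Sum.inl_injective.ne haz) (Sum.inl_injective.ne hbz)
        (Sum.inr_injective.ne (by decide)) Sum.inr_ne_inl Sum.inr_ne_inl
      simp only [Sym2.map_mk, hφ, Sum.elim_inl, Sum.elim_inr, cond_true, cond_false] at hl
      rw [hl, gs_mk]
      congr 1
      split_ifs <;> simp

end StabPart2


section RoundTwo

/-- The alternatives to be produced by the second round of exposure. -/
def Good {α V : Type*} [Fintype α] [Fintype V] [DecidableEq V] (H : SimpleGraph α)
    (f : Sym2 V → ZMod 2) (U : Finset (Sym2 V)) (K : ℝ) (s : Finset (Sym2 V)) : Prop :=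
  (∃ ψ : α → V, Function.Injective ψ ∧ ∑ e ∈ HE H, f (Sym2.map ψ e) = 1 ∧
    TF (HE H) ψ ⊆ s ∧ Disjoint (TF (HE H) ψ) U) ∨
  ∃ (g : V → ZMod 2) (t : ZMod 2), (IsEulerianGraph H ∨ g = 0) ∧ (Odd (eCount H) → t = 0) ∧
    ((s ∩ (U ∪ Finset.univ.filter (fun e : Sym2 V => ¬ e.IsDiag ∧ f e ≠ gs g e + t))).card : ℝ)
      < K

lemma kill {α V : Type*} [Fintype α] [Fintype V] [DecidableEq V] (H : SimpleGraph α)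
    (U : Finset (Sym2 V)) :
    (Finset.univ.filter (fun ψ : α → V => ¬ Disjoint (TF (HE H) ψ) U)).card ≤
      (HE H).card * (2 * U.card * Fintype.card V ^ (Fintype.card α - 2)) := by
  have h1 : (Finset.univ.filter (fun ψ : α → V => ¬ Disjoint (TF (HE H) ψ) U)) ⊆
      (HE H).biUnion (fun q => Finset.univ.filter (fun ψ : α → V => Sym2.map ψ q ∈ U)) := by
    intro ψ hψ
    have := (Finset.mem_filter.1 hψ).2
    rw [Finset.not_disjoint_iff] at this
    obtain ⟨e, he, heU⟩ := this
    obtain ⟨q, hq, rfl⟩ := Finset.mem_image.1 he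
    exact Finset.mem_biUnion.2 ⟨q, hq, Finset.mem_filter.2 ⟨Finset.mem_univ _, heU⟩⟩
  refine (Finset.card_le_card h1).trans (Finset.card_biUnion_le_card_mul _ _ _ ?_)
  intro q hq
  induction q using Sym2.ind with
  | _ k l =>
    have hkl : k ≠ l := (show H.Adj k l from mem_HE.1 hq).ne
    let ι : Bool → α := fun i => cond i k l
    have hι : Function.Injective ι := by
      intro i j hij
      cases i <;> cases j <;> simp_all [ι]
    let O : Finset (Bool → V) := Finset.univ.filter (fun σ => s(σ true, σ false) ∈ U)
    have h2 := card_comp_le hι O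
    have h3 : O.card ≤ 2 * U.card := by
      refine (Finset.card_le_mul_card_image_of_maps_to
        (f := fun σ : Bool → V => s(σ true, σ false)) (t := U)
        (fun σ hσ => (Finset.mem_filter.1 hσ).2) 2 ?_)
      intro e _
      induction e using Sym2.ind with
      | _ x y =>
        refine (Finset.card_le_card ?_).trans (Finset.card_le_two
          (a := fun i : Bool => cond i x y) (b := fun i : Bool => cond i y x))
        intro σ hσ
        have h4 := (Finset.mem_filter.1 hσ).2
        rw [Sym2.eq_iff] at h4
        rw [Finset.mem_insert, Finset.mem_singleton]
        rcases h4 with ⟨a1, a2⟩ | ⟨a1, a2⟩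
        · left; funext i; cases i
          · exact a2
          · exact a1
        · right; funext i; cases i
          · exact a2
          · exact a1
    rw [Fintype.card_bool] at h2
    refine le_trans (le_of_eq ?_) (h2.trans (Nat.mul_le_mul_right _ h3))
    congr 1
    ext ψ
    rw [Finset.mem_filter, Finset.mem_filter, Finset.mem_filter]
    simp [ι]

lemma round_two {α : Type*} [Fintype α] {H : SimpleGraph α} (hH : Strictly2Balanced H)
    {u w : α} (huw : H.Adj u w) {c : ℝ} (hc : 0 < c) :
    ∃ δ : ℝ, 0 < δ ∧ ∃ κ : ℝ, 0 < κ ∧ ∃ n0 : ℕ, ∀ (V : Type) [Fintype V] [DecidableEq V],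
      n0 ≤ Fintype.card V → ∀ (E : Finset (Sym2 V)), (∀ q : Sym2 V, ¬ q.IsDiag → q ∈ E) →
      ∀ p p2 : ℝ, 0 < p → p / 2 ≤ p2 → p2 ≤ p → p ≤ 1 →
      1 ≤ (Fintype.card V : ℝ) * p2 ^ (d2 H) → ∀ (f : Sym2 V → ZMod 2) (U : Finset (Sym2 V)),
      (U.card : ℝ) ≤ δ * (Fintype.card V : ℝ) ^ 2 →
      EX E p2 (fun s => if Good H f U (c / 2 * ((Fintype.card V : ℝ) ^ 2 * p)) s then 0 else 1) ≤
        Real.exp (-(κ * ((Fintype.card V : ℝ) ^ 2 * p))) := by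
  obtain ⟨γ, hγ, n1, hst⟩ := stability huw (η := c / 16) (by positivity)
  set v := Fintype.card α with hv
  have hHE : (0 : ℝ) < (HE H).card := by
    exact_mod_cast (by have := two_le_HE hH; omega : 0 < (HE H).card)
  have hv3 : 3 ≤ v := by rw [hv, ← Nat.card_eq_fintype_card]; exact hH.1
  set D : ℝ := 4 * ((v : ℝ) + 1) ^ v with hD
  have hDpos : 0 < D := by positivity
  refine ⟨min (γ / (4 * (HE H).card)) (c / 16), by positivity, min (γ / (4 * D)) (c / 4),
    by positivity, n1 + 1, ?_⟩
  intro V _ _ hn E hE p p2 hp hp2 hp2' hp1 hΩ f U hU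
  set N : ℝ := (Fintype.card V : ℝ) with hN
  have hVpos : 0 < Fintype.card V := by omega
  have hNpos : 0 < N := by rw [hN]; exact_mod_cast hVpos
  have hp20 : 0 < p2 := by linarith
  have hp21 : p2 ≤ 1 := by linarith
  set N' : ℝ := N ^ 2 * p with hN'
  have hN'pos : 0 < N' := by positivity
  set O := Finset.univ.filter (fun ψ : α → V => Function.Injective ψ ∧
        ∑ e ∈ HE H, f (Sym2.map ψ e) = 1) with hO
  by_cases hcase : (O.card : ℝ) < γ * N ^ v
  · obtain ⟨g, t, hg, ht, hgt⟩ := hst V (by omega) f hcase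
    set M := Finset.univ.filter (fun e : Sym2 V => ¬ e.IsDiag ∧ f e ≠ gs g e + t) with hM
    have h1 : EX E p2 (fun s => if Good H f U (c / 2 * N') s then 0 else 1) ≤
        EX E p2 (fun s => if c / 2 * N' ≤ ((s ∩ (U ∪ M)).card : ℝ) then 1 else 0) := by
      refine EX_mono hp20.le hp21 fun s _ => ?_
      by_cases hle : c / 2 * N' ≤ ((s ∩ (U ∪ M)).card : ℝ)
      · rw [if_pos hle]; split_ifs <;> norm_num
      · rw [if_neg hle, if_pos]
        exact Or.inr ⟨g, t, hg, ht, not_le.1 hle⟩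
    refine h1.trans ((EX_tail E (U ∪ M) hp20.le hp21).trans (Real.exp_le_exp.2 ?_))
    have h2 : ((U ∪ M).card : ℝ) ≤ c / 8 * N ^ 2 := by
      have h3 : ((U ∪ M).card : ℝ) ≤ U.card + M.card := by exact_mod_cast Finset.card_union_le U M
      have h4 : (U.card : ℝ) ≤ c / 16 * N ^ 2 :=
        hU.trans (mul_le_mul_of_nonneg_right (min_le_right _ _) (by positivity))
      calc ((U ∪ M).card : ℝ) ≤ _ := h3
        _ ≤ c / 16 * N ^ 2 + c / 16 * N ^ 2 := add_le_add h4 hgt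
        _ = _ := by ring
    have h5 : 2 * p2 * ((U ∪ M).card : ℝ) ≤ 2 * p * (c / 8 * N ^ 2) := by gcongr
    have h6 : min (γ / (4 * D)) (c / 4) * N' ≤ c / 4 * N' :=
      mul_le_mul_of_nonneg_right (min_le_right _ _) hN'pos.le
    have h7 : 2 * p * (c / 8 * N ^ 2) = c / 4 * N' := by rw [hN']; ring
    linarith
  · rw [not_lt] at hcase
    set I := O.filter (fun ψ => Disjoint (TF (HE H) ψ) U) with hI
    have hIinj : ∀ ψ ∈ I, Function.Injective ψ := fun ψ hψ =>
      (Finset.mem_filter.1 (Finset.mem_filter.1 hψ).1).2.1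
    have hkill := kill H U
    have hIc : γ / 2 * N ^ v ≤ I.card := by
      have h1 : O.card ≤ I.card +
          (Finset.univ.filter (fun ψ : α → V => ¬ Disjoint (TF (HE H) ψ) U)).card := by
        rw [← Finset.card_filter_add_card_filter_not
          (s := O) (fun ψ => Disjoint (TF (HE H) ψ) U)]
        refine Nat.add_le_add_left (Finset.card_le_card ?_) _
        intro ψ hψ
        exact Finset.mem_filter.2 ⟨Finset.mem_univ _, (Finset.mem_filter.1 hψ).2⟩
      have h2 : (O.card : ℝ) ≤ I.card + (HE H).card * (2 * U.card * N ^ (v - 2)) := by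
        rw [hN]
        exact_mod_cast h1.trans (Nat.add_le_add_left hkill _)
      have h3 : (HE H).card * (2 * U.card * N ^ (v - 2)) ≤ γ / 2 * N ^ v := by
        have h4 : (U.card : ℝ) ≤ γ / (4 * (HE H).card) * N ^ 2 :=
          hU.trans (mul_le_mul_of_nonneg_right (min_le_left _ _) (by positivity))
        calc (HE H).card * (2 * U.card * N ^ (v - 2))
            ≤ (HE H).card * (2 * (γ / (4 * (HE H).card) * N ^ 2) * N ^ (v - 2)) := by gcongr
          _ = γ / 2 * (N ^ (v - 2) * N ^ 2) := by field_simp; ring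
          _ = γ / 2 * N ^ v := by rw [← pow_add, Nat.sub_add_cancel (by omega)]
      linarith
    have h1 : EX E p2 (fun s => if Good H f U (c / 2 * N') s then 0 else 1) ≤
        EX E p2 (fun s => if ∃ ψ ∈ I, TF (HE H) ψ ⊆ s then 0 else 1) := by
      refine EX_mono hp20.le hp21 fun s _ => ?_
      by_cases hex : ∃ ψ ∈ I, TF (HE H) ψ ⊆ s
      · rw [if_pos hex, if_pos]
        obtain ⟨ψ, hψ, hs⟩ := hex
        obtain ⟨hψO, hdis⟩ := Finset.mem_filter.1 hψ
        exact Or.inl ⟨ψ, hIinj ψ hψ, (Finset.mem_filter.1 hψO).2.2, hs, hdis⟩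
      · rw [if_neg hex]; split_ifs <;> norm_num
    refine h1.trans ((fam2 hH hE hp20 hp21 hVpos hΩ I hIinj hIc).trans (Real.exp_le_exp.2 ?_))
    rw [neg_le_neg_iff, ← hv, ← hN, ← hD]
    calc min (γ / (4 * D)) (c / 4) * N' ≤ γ / (4 * D) * N' :=
          mul_le_mul_of_nonneg_right (min_le_left _ _) hN'pos.le
      _ = γ / 2 / D * (N ^ 2 * (p / 2)) := by rw [hN']; field_simp; ring
      _ ≤ γ / 2 / D * (N ^ 2 * p2) := by gcongr

end RoundTwo


section RoundOne

/-- The pair `e` is covered by `s`. -/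
def Cov {α V : Type*} [Fintype α] [DecidableEq V] (H : SimpleGraph α) (a b : α)
    (s : Finset (Sym2 V)) (e : Sym2 V) : Prop :=
  ∃ ψ : α → V, (Function.Injective ψ ∧ s(ψ a, ψ b) = e) ∧ TF ((HE H).erase s(a, b)) ψ ⊆ s

/-- The prediction for the value on `e`. -/
def ff {α V : Type*} [Fintype α] [DecidableEq V] (H : SimpleGraph α) (a b : α)
    (s x : Finset (Sym2 V)) (e : Sym2 V) : ZMod 2 :=
  if h : Cov H a b s e then
    ∑ q ∈ (HE H).erase s(a, b), if Sym2.map h.choose q ∈ x then 1 else 0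
  else 0

/-- The uncovered pairs. -/
def UU {α V : Type*} [Fintype α] [DecidableEq V] (H : SimpleGraph α) (a b : α)
    (E s : Finset (Sym2 V)) : Finset (Sym2 V) := E.filter (fun e => ¬ Cov H a b s e)

lemma ff_eq {α V : Type*} [Fintype α] [Fintype V] [DecidableEq V] {H : SimpleGraph α} {a b : α}
    (hab : H.Adj a b) {G : SimpleGraph V} {s1 s2 : Finset (Sym2 V)}
    (hG : ∀ e, e ∈ G.edgeSet ↔ e ∈ s1 ∪ s2) {X : EdgeVec V} (hX : X ∈ perpIn G (hSpace H G))
    {e : Sym2 V} (he : e ∈ s1 ∪ s2) (hcov : Cov H a b s1 e) :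
    X e = ff H a b s1 (s1.filter (fun e => X e ≠ 0)) e := by
  unfold ff
  rw [dif_pos hcov]
  obtain ⟨⟨hinj, hee⟩, hsub⟩ := hcov.choose_spec
  set ψ := hcov.choose
  have habE : s(a, b) ∈ HE H := mem_HE.2 hab
  have h1 := perp_copy (H := H) hX hinj (by
    intro q hq
    obtain ⟨r, hr, rfl⟩ := Finset.mem_image.1 hq
    rw [hG]
    by_cases hrab : r = s(a, b)
    · rw [hrab, Sym2.map_mk, hee]; exact he
    · exact Finset.mem_union_left _
        (hsub (Finset.mem_image.2 ⟨r, Finset.mem_erase.2 ⟨hrab, hr⟩, rfl⟩)))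
  rw [setVec_TF_sum hinj, ← Finset.add_sum_erase _ _ habE, Sym2.map_mk, hee] at h1
  have h2 : ∑ q ∈ (HE H).erase s(a, b),
      (if Sym2.map ψ q ∈ s1.filter (fun e => X e ≠ 0) then (1 : ZMod 2) else 0) =
      ∑ q ∈ (HE H).erase s(a, b), X (Sym2.map ψ q) := by
    refine Finset.sum_congr rfl fun q hq => ?_
    have hq1 : Sym2.map ψ q ∈ s1 := hsub (Finset.mem_image.2 ⟨q, hq, rfl⟩)
    have z1 : ∀ c : ZMod 2, c ≠ 0 → c = 1 := by decide
    by_cases h0 : X (Sym2.map ψ q) = 0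
    · rw [if_neg, h0]
      intro h; exact (Finset.mem_filter.1 h).2 h0
    · rw [if_pos (Finset.mem_filter.2 ⟨hq1, h0⟩), z1 _ h0]
  rw [h2]
  have z2 : ∀ c d : ZMod 2, c + d = 0 → c = d := by decide
  exact z2 _ _ h1

lemma det_good {α V : Type*} [Fintype α] [Fintype V] [DecidableEq V] {H : SimpleGraph α} {a b : α}
    (hab : H.Adj a b) {G : SimpleGraph V} {E s1 s2 : Finset (Sym2 V)} (hs1 : s1 ⊆ E)
    (hs2 : s2 ⊆ E) (hd : ∀ e ∈ E, ¬ e.IsDiag)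
    (hG : ∀ e, e ∈ G.edgeSet ↔ e ∈ s1 ∪ s2) {X : EdgeVec V} (hX : X ∈ perpIn G (hSpace H G))
    {K : ℝ} (hK : (s1.card : ℝ) < K)
    (hgood : Good H (ff H a b s1 (s1.filter (fun e => X e ≠ 0))) (UU H a b E s1) K s2) :
    ∃ (g : V → ZMod 2) (t : ZMod 2),
      (IsEulerianGraph H ∨ g = 0) ∧ (Odd (eCount H) → t = 0) ∧
      ((Finset.univ.filter (fun e => e ∈ G.edgeSet ∧ X e ≠ gs g e + t)).card : ℝ) < K + K := by
  have hff : ∀ e ∈ s2, e ∉ UU H a b E s1 →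
      X e = ff H a b s1 (s1.filter (fun e => X e ≠ 0)) e := by
    intro e he hU
    refine ff_eq hab hG hX (Finset.mem_union_right _ he) ?_
    by_contra hc
    exact hU (Finset.mem_filter.2 ⟨hs2 he, hc⟩)
  rcases hgood with ⟨ψ, hψ, hodd, hsub, hdis⟩ | ⟨g, t, hg, ht, hlt⟩
  · exfalso
    have h1 := perp_copy (H := H) hX hψ (fun e he => (hG e).2
      (Finset.mem_union_right _ (hsub he)))
    rw [Finset.sum_congr rfl (fun e he => hff e (hsub he)
      (Finset.disjoint_left.1 hdis he)), setVec_TF_sum hψ, hodd] at h1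
    exact one_ne_zero h1
  · refine ⟨g, t, hg, ht, ?_⟩
    set M := UU H a b E s1 ∪ Finset.univ.filter (fun e : Sym2 V => ¬ e.IsDiag ∧
      ff H a b s1 (s1.filter (fun e => X e ≠ 0)) e ≠ gs g e + t) with hM
    have hsub : Finset.univ.filter (fun e => e ∈ G.edgeSet ∧ X e ≠ gs g e + t) ⊆
        s1 ∪ (s2 ∩ M) := by
      intro e he
      obtain ⟨h1, h2⟩ := (Finset.mem_filter.1 he).2
      rcases Finset.mem_union.1 ((hG e).1 h1) with h3 | h3
      · exact Finset.mem_union_left _ h3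
      · refine Finset.mem_union_right _ (Finset.mem_inter.2 ⟨h3, ?_⟩)
        by_cases hU : e ∈ UU H a b E s1
        · exact Finset.mem_union_left _ hU
        · refine Finset.mem_union_right _ (Finset.mem_filter.2 ⟨Finset.mem_univ _,
            hd e (hs2 h3), ?_⟩)
          rw [← hff e h3 hU]; exact h2
    have h4 : ((Finset.univ.filter (fun e => e ∈ G.edgeSet ∧ X e ≠ gs g e + t)).card : ℝ) ≤
        s1.card + (s2 ∩ M).card := by
      exact_mod_cast (Finset.card_le_card hsub).trans (Finset.card_union_le _ _)
    linarith

lemma round_one {α V : Type*} [Fintype α] [Fintype V] [DecidableEq V] {H : SimpleGraph α}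
    (hH : Strictly2Balanced H) {E : Finset (Sym2 V)} (hE : ∀ q : Sym2 V, ¬ q.IsDiag → q ∈ E)
    (hd : ∀ e ∈ E, ¬ e.IsDiag) (hEc : (E.card : ℝ) ≤ (Fintype.card V : ℝ) ^ 2)
    {p : ℝ} (h0 : 0 < p) (h1 : p ≤ 1)
    (hΩ : 1 ≤ (Fintype.card V : ℝ) * p ^ (d2 H)) {a b : α} (hab : H.Adj a b)
    (hNv : 2 * Fintype.card α ≤ Fintype.card V) {δ : ℝ} (hδ : 0 < δ)
    (hV : 0 < Fintype.card V) :
    EX E p (fun s => if δ * (Fintype.card V : ℝ) ^ 2 < (UU H a b E s).card then 1 else 0) ≤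
      Real.exp (-((Fintype.card V : ℝ) * p ^ (d2 H) /
        (4 * ((Fintype.card α : ℝ) + 1) ^ Fintype.card α * 2 ^ (Fintype.card α - 2)))) / δ := by
  set N : ℝ := (Fintype.card V : ℝ) with hN
  have hNpos : 0 < N := by rw [hN]; exact_mod_cast hV
  set Q := Real.exp (-(N * p ^ (d2 H) /
        (4 * ((Fintype.card α : ℝ) + 1) ^ Fintype.card α * 2 ^ (Fintype.card α - 2)))) with hQ
  have hm : EX E p (fun s => if δ * N ^ 2 < (UU H a b E s).card then 1 else 0) ≤
      EX E p (fun s => (δ * N ^ 2)⁻¹ * ∑ e ∈ E, if Cov H a b s e then 0 else 1) := by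
    refine EX_mono h0.le h1 fun s _ => ?_
    have e1 : (∑ e ∈ E, if Cov H a b s e then (0 : ℝ) else 1) = (UU H a b E s).card := by
      unfold UU
      rw [Finset.card_filter]
      push_cast
      refine Finset.sum_congr rfl fun e _ => ?_
      by_cases h : Cov H a b s e <;> simp [h]
    rw [e1]
    split_ifs with h
    · rw [inv_mul_eq_div, le_div_iff₀ (by positivity)]; linarith
    · positivity
  refine hm.trans ?_
  rw [EX_mul, EX_sum]
  have hb : ∀ e ∈ E, EX E p (fun s => if Cov H a b s e then 0 else 1) ≤ Q := by
    intro e he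
    have hde := hd e he
    induction e using Sym2.ind with
    | _ x y =>
      have hxy : x ≠ y := by simpa using hde
      refine le_trans (EX_mono h0.le h1 fun s _ => ?_) (fam1 hH hE h0 h1 hΩ hab hxy hNv)
      by_cases hex : ∃ ψ : α → V, (Function.Injective ψ ∧ ψ a = x ∧ ψ b = y) ∧
        TF ((HE H).erase s(a, b)) ψ ⊆ s
      · rw [if_pos hex, if_pos]
        obtain ⟨ψ, ⟨hi, hx, hy⟩, hs⟩ := hex
        exact ⟨ψ, ⟨hi, by rw [hx, hy]⟩, hs⟩
      · rw [if_neg hex]; split_ifs <;> norm_num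
  have hQ0 : 0 < Q := Real.exp_pos _
  calc (δ * N ^ 2)⁻¹ * ∑ e ∈ E, EX E p (fun s => if Cov H a b s e then 0 else 1)
      ≤ (δ * N ^ 2)⁻¹ * (E.card * Q) := by
        gcongr
        rw [← nsmul_eq_mul]
        exact Finset.sum_le_card_nsmul _ _ _ hb
    _ ≤ (δ * N ^ 2)⁻¹ * (N ^ 2 * Q) := by gcongr
    _ = Q / δ := by field_simp

lemma main_bound {α : Type*} [Fintype α] {H : SimpleGraph α} (hH : Strictly2Balanced H)
    {c : ℝ} (hc : 0 < c) :
    ∃ ε : ℝ, 0 < ε ∧ ∃ δ : ℝ, 0 < δ ∧ ∃ C : ℝ, 0 < C ∧ ∃ κ : ℝ, 0 < κ ∧ ∃ n0 : ℕ,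
      ∀ n : ℕ, n0 ≤ n → ∀ p : ℝ, 0 < p → p ≤ 1 → 1 ≤ (n : ℝ) * (ε * p) ^ (d2 H) →
      EX (⊤ : SimpleGraph (Fin n)).edgeFinset p (fun s =>
        if SimpleGraph.fromEdgeSet (↑s : Set (Sym2 (Fin n))) ∈
          {G : SimpleGraph (Fin n) | memT H G ∨ ∃ X ∈ perpIn G (hSpace H G),
            X ∉ perpIn G (wSpace H G) ∧ (wt X : ℝ) < c * (n : ℝ) ^ 2 * p} then 0 else 1) ≤
      Real.exp (-(ε * ((n : ℝ) ^ 2 * p))) + Real.exp (-((n : ℝ) * (ε * p) ^ (d2 H) / C)) / δ +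
        Real.exp (-(κ * ((n : ℝ) ^ 2 * p))) := by
  obtain ⟨q, hq⟩ : (HE H).Nonempty := Finset.card_pos.1 (by have := two_le_HE hH; omega)
  induction q using Sym2.ind with
  | _ a b =>
  have hab : H.Adj a b := mem_HE.1 hq
  obtain ⟨δ, hδ, κ, hκ, n1, hr2⟩ := round_two hH hab hc
  set ε := min (1 / 2) (min (c / 4) (κ / 4)) with hε
  have hεpos : 0 < ε := by positivity
  have hε1 : ε ≤ 1 / 2 := min_le_left _ _
  have hε2 : ε ≤ c / 4 := (min_le_right _ _).trans (min_le_left _ _)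
  have hε3 : ε ≤ κ / 4 := (min_le_right _ _).trans (min_le_right _ _)
  refine ⟨ε, hεpos, δ, hδ, 4 * ((Fintype.card α : ℝ) + 1) ^ Fintype.card α *
    2 ^ (Fintype.card α - 2), by positivity, κ / 2, by positivity,
    n1 + 2 * Fintype.card α + 1, ?_⟩
  intro n hn p hp hp1 hΩ
  set E := (⊤ : SimpleGraph (Fin n)).edgeFinset with hEdef
  have hE : ∀ q : Sym2 (Fin n), ¬ q.IsDiag → q ∈ E := by
    intro q hq; rw [hEdef]; simpa using hq
  have hd : ∀ e ∈ E, ¬ e.IsDiag := by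
    intro e he; rw [hEdef] at he; simpa using he
  have hnpos : (0 : ℝ) < n := by exact_mod_cast (by omega : 0 < n)
  have hEc2 : 2 * (E.card : ℝ) ≤ (n : ℝ) ^ 2 := by
    have h1 : E.card = n.choose 2 := by
      have := SimpleGraph.card_edgeFinset_top_eq_card_choose_two (V := Fin n)
      rw [Fintype.card_fin] at this
      rw [← this, hEdef]
    rw [h1, Nat.cast_choose_two]
    nlinarith
  have hEc : (E.card : ℝ) ≤ (n : ℝ) ^ 2 := by
    have : (0 : ℝ) ≤ E.card := by positivity
    linarith
  set N' : ℝ := (n : ℝ) ^ 2 * p with hN'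
  have hN'pos : 0 < N' := by positivity
  set p1 := ε * p with hp1def
  have hp10 : 0 < p1 := by positivity
  have hp1h : p1 ≤ 1 / 2 := by
    calc p1 ≤ 1 / 2 * 1 := by rw [hp1def]; gcongr
      _ = 1 / 2 := by ring
  have hp1p : p1 ≤ p / 2 := by
    calc p1 ≤ 1 / 2 * p := by rw [hp1def]; gcongr
      _ = p / 2 := by ring
  set p2 := (p - p1) / (1 - p1) with hp2def
  have h1p1 : 0 < 1 - p1 := by linarith
  have hp2a : p / 2 ≤ p2 := by
    rw [hp2def, le_div_iff₀ h1p1]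
    nlinarith
  have hp2b : p2 ≤ p := by
    rw [hp2def, div_le_iff₀ h1p1]
    nlinarith
  have hp20 : 0 < p2 := by linarith
  have hp21 : p2 ≤ 1 := by linarith
  have hpp : 1 - p = (1 - p1) * (1 - p2) := by
    rw [hp2def]; field_simp; ring
  have hΩ2 : 1 ≤ (Fintype.card (Fin n) : ℝ) * p2 ^ (d2 H) := by
    rw [Fintype.card_fin]
    refine hΩ.trans ?_
    gcongr
    · exact (d2_pos hH).le
    · linarith
  have hr2' := hr2 (Fin n) (by rw [Fintype.card_fin]; omega) E hE p p2 hp hp2a hp2b hp1 hΩ2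
  have hr1 := round_one (V := Fin n) hH hE hd (by rw [Fintype.card_fin]; exact hEc) hp10
    (by linarith) (by rw [Fintype.card_fin]; exact hΩ) hab (by rw [Fintype.card_fin]; omega) hδ
    (by rw [Fintype.card_fin]; omega)
  simp only [Fintype.card_fin] at hr2' hr1
  rw [← hN'] at hr2'
  rw [EX_union E hpp]
  set A : Finset (Sym2 (Fin n)) → ℝ := fun s1 =>
    if 2 * ε * N' ≤ ((s1 ∩ E).card : ℝ) then 1 else 0 with hA
  set B : Finset (Sym2 (Fin n)) → ℝ := fun s1 =>
    if δ * (n : ℝ) ^ 2 < (UU H a b E s1).card then 1 else 0 with hB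
  have hAE : EX E p1 A ≤ Real.exp (-(ε * N')) := by
    refine (EX_tail E E hp10.le (by linarith)).trans (Real.exp_le_exp.2 ?_)
    have : 2 * p1 * (E.card : ℝ) ≤ ε * N' := by
      rw [hp1def, hN']
      calc 2 * (ε * p) * (E.card : ℝ) = (ε * p) * (2 * E.card) := by ring
        _ ≤ (ε * p) * (n : ℝ) ^ 2 := by gcongr
        _ = _ := by ring
    linarith
  have hinner : ∀ s1 ⊆ E, EX E p2 (fun s2 =>
      if SimpleGraph.fromEdgeSet (↑(s1 ∪ s2) : Set (Sym2 (Fin n))) ∈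
          {G : SimpleGraph (Fin n) | memT H G ∨ ∃ X ∈ perpIn G (hSpace H G),
            X ∉ perpIn G (wSpace H G) ∧ (wt X : ℝ) < c * (n : ℝ) ^ 2 * p} then 0 else 1) ≤
      A s1 + B s1 + Real.exp (-(κ / 2 * N')) := by
    intro s1 hs1
    have hA0 : 0 ≤ A s1 := by rw [hA]; dsimp only; split_ifs <;> norm_num
    have hB0 : 0 ≤ B s1 := by rw [hB]; dsimp only; split_ifs <;> norm_num
    have hexp0 := (Real.exp_pos (-(κ / 2 * N'))).le
    have hle1 : EX E p2 (fun s2 =>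
      if SimpleGraph.fromEdgeSet (↑(s1 ∪ s2) : Set (Sym2 (Fin n))) ∈
          {G : SimpleGraph (Fin n) | memT H G ∨ ∃ X ∈ perpIn G (hSpace H G),
            X ∉ perpIn G (wSpace H G) ∧ (wt X : ℝ) < c * (n : ℝ) ^ 2 * p} then (0:ℝ) else 1) ≤
        1 := by
      refine le_trans (EX_mono hp20.le hp21 fun s _ => ?_) (EX_const E p2 1).le
      split_ifs
      · exact zero_le_one
      · exact le_rfl
    by_cases hAc : 2 * ε * N' ≤ ((s1 ∩ E).card : ℝ)
    · have : A s1 = 1 := by rw [hA]; simp only [if_pos hAc]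
      linarith
    by_cases hBc : δ * (n : ℝ) ^ 2 < (UU H a b E s1).card
    · have : B s1 = 1 := by rw [hB]; simp only [if_pos hBc]
      linarith
    rw [Finset.inter_eq_left.2 hs1, not_le] at hAc
    rw [not_lt] at hBc
    have hs1K : (s1.card : ℝ) < c / 2 * N' := by
      have : 2 * ε * N' ≤ c / 2 * N' := by
        apply mul_le_mul_of_nonneg_right _ hN'pos.le; linarith
      linarith
    have h3 : EX E p2 (fun s2 =>
      if SimpleGraph.fromEdgeSet (↑(s1 ∪ s2) : Set (Sym2 (Fin n))) ∈
          {G : SimpleGraph (Fin n) | memT H G ∨ ∃ X ∈ perpIn G (hSpace H G),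
            X ∉ perpIn G (wSpace H G) ∧ (wt X : ℝ) < c * (n : ℝ) ^ 2 * p} then (0:ℝ) else 1) ≤
        EX E p2 (fun s2 => ∑ x ∈ s1.powerset,
          if Good H (ff H a b s1 x) (UU H a b E s1) (c / 2 * N') s2 then 0 else 1) := by
      refine EX_mono hp20.le hp21 fun s2 hs2 => ?_
      have hnn : ∀ x ∈ s1.powerset, (0 : ℝ) ≤
          if Good H (ff H a b s1 x) (UU H a b E s1) (c / 2 * N') s2 then 0 else 1 := by
        intro x _; split_ifs <;> norm_num
      by_cases hall : ∀ x ∈ s1.powerset, Good H (ff H a b s1 x) (UU H a b E s1) (c / 2 * N') s2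
      · rw [if_pos]
        · exact Finset.sum_nonneg hnn
        · have hG : ∀ e, e ∈ (SimpleGraph.fromEdgeSet
              (↑(s1 ∪ s2) : Set (Sym2 (Fin n)))).edgeSet ↔ e ∈ s1 ∪ s2 := by
            intro e
            rw [SimpleGraph.edgeSet_fromEdgeSet, Set.mem_sdiff]
            constructor
            · intro h; exact Finset.mem_coe.1 h.1
            · intro h
              refine ⟨Finset.mem_coe.2 h, fun h' => ?_⟩
              exact hd e (Finset.union_subset hs1 hs2 h) (by simpa using h')
          have hKK : c * (n : ℝ) ^ 2 * p = c / 2 * N' + c / 2 * N' := by rw [hN']; ring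
          rw [hKK]
          exact witness fun X hX => det_good hab hs1 hs2 hd hG hX hs1K
            (hall _ (Finset.mem_powerset.2 (Finset.filter_subset _ _)))
      · push Not at hall
        obtain ⟨x, hx, hxn⟩ := hall
        refine le_trans ?_ (Finset.single_le_sum hnn hx)
        rw [if_neg hxn]
        split_ifs <;> norm_num
    refine h3.trans ?_
    rw [EX_sum]
    have h4 : ∑ x ∈ s1.powerset, EX E p2 (fun s2 =>
        if Good H (ff H a b s1 x) (UU H a b E s1) (c / 2 * N') s2 then (0 : ℝ) else 1) ≤
        s1.powerset.card • Real.exp (-(κ * N')) :=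
      Finset.sum_le_card_nsmul _ _ _ fun x _ => hr2' _ _ hBc
    have h5 : ((s1.powerset.card : ℕ) : ℝ) ≤ Real.exp (κ / 2 * N') := by
      rw [Finset.card_powerset]
      push_cast
      calc (2 : ℝ) ^ s1.card ≤ (Real.exp 1) ^ s1.card := by
            gcongr
            have := Real.add_one_le_exp 1; linarith
        _ = Real.exp (s1.card) := by rw [← Real.exp_nat_mul, mul_one]
        _ ≤ _ := by
            apply Real.exp_le_exp.2
            have : 2 * ε * N' ≤ κ / 2 * N' := by
              apply mul_le_mul_of_nonneg_right _ hN'pos.le; linarith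
            linarith
    have h6 : s1.powerset.card • Real.exp (-(κ * N')) ≤ Real.exp (-(κ / 2 * N')) := by
      rw [nsmul_eq_mul]
      calc _ ≤ Real.exp (κ / 2 * N') * Real.exp (-(κ * N')) := by gcongr
        _ = _ := by rw [← Real.exp_add]; congr 1; ring
    linarith
  refine (EX_mono hp10.le (by linarith) hinner).trans ?_
  rw [EX_add, EX_add, EX_const]
  linarith

end RoundOne


lemma erProb_eq_one_sub (n : ℕ) (p : ℝ) (A : Set (SimpleGraph (Fin n))) :
    erProb n p A = 1 - EX (⊤ : SimpleGraph (Fin n)).edgeFinset p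
      (fun s => if SimpleGraph.fromEdgeSet (↑s : Set (Sym2 (Fin n))) ∈ A then 0 else 1) := by
  have h1 := EX_const (⊤ : SimpleGraph (Fin n)).edgeFinset p (1 : ℝ)
  have h2 := EX_sub (⊤ : SimpleGraph (Fin n)).edgeFinset p (fun _ => (1 : ℝ))
    (fun s => if SimpleGraph.fromEdgeSet (↑s : Set (Sym2 (Fin n))) ∈ A then 0 else 1)
  rw [h1] at h2
  rw [← h2]
  unfold erProb EX
  refine Finset.sum_congr rfl fun s _ => ?_
  beta_reduce
  by_cases h : SimpleGraph.fromEdgeSet (↑s : Set (Sym2 (Fin n))) ∈ A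
  · rw [if_pos h, if_pos h, sub_zero, mul_one]
  · rw [if_neg h, if_neg h, sub_self, mul_zero]

/-- Lemma 2.4: for fixed `c > 0` and `p ≫ n^{-1/m₂(H)}`, w.h.p. either
`C_H(G) = W_H(G)` or some `X ∈ C_H^⊥(G) ∖ W_H^⊥(G)` has `|X| < c·n²·p`. -/
theorem stmt7 {α : Type*} [Fintype α] (H : SimpleGraph α) (hH : Strictly2Balanced H)
    (hPT : NotPathOrTriangle H) (c : ℝ) (hc : 0 < c)
    (p : ℕ → ℝ) (hp : ∀ n, p n ∈ Set.Icc (0 : ℝ) 1)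
    (hgrow : Filter.Tendsto (fun n => p n * (n : ℝ) ^ (1 / m2 H))
      Filter.atTop Filter.atTop) :
    Filter.Tendsto (fun n => erProb n (p n)
      {G | memT H G ∨ ∃ X ∈ perpIn G (hSpace H G),
        X ∉ perpIn G (wSpace H G) ∧ (wt X : ℝ) < c * (n : ℝ) ^ 2 * p n})
      Filter.atTop (nhds 1) := by
  obtain ⟨ε, hε, δ, hδ, C, hC, κ, hκ, n0, hmain⟩ := main_bound hH hc
  rw [m2_eq hH] at hgrow
  have hd := d2_pos hH
  have hd2 := half_le_d2 hH
  have hN : Filter.Tendsto (fun n : ℕ => (n : ℝ) ^ 2 * p n) Filter.atTop Filter.atTop := by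
    refine Filter.tendsto_atTop_mono' _ ?_ hgrow
    filter_upwards [Filter.eventually_ge_atTop 1] with n hn
    have hn1 : (1 : ℝ) ≤ n := by exact_mod_cast hn
    have h : (n : ℝ) ^ (1 / d2 H) ≤ (n : ℝ) ^ (2 : ℝ) := by
      apply Real.rpow_le_rpow_of_exponent_le hn1
      rw [div_le_iff₀ hd]; linarith
    rw [Real.rpow_two] at h
    rw [mul_comm]
    exact mul_le_mul_of_nonneg_right h (hp n).1
  have hΩ : Filter.Tendsto (fun n : ℕ => (n : ℝ) * (ε * p n) ^ (d2 H))
      Filter.atTop Filter.atTop := by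
    have h1 : Filter.Tendsto (fun n : ℕ => ε ^ (d2 H) * (p n * (n : ℝ) ^ (1 / d2 H)) ^ (d2 H))
        Filter.atTop Filter.atTop :=
      ((tendsto_rpow_atTop hd).comp hgrow).const_mul_atTop (Real.rpow_pos_of_pos hε _)
    refine h1.congr fun n => ?_
    have hn : (0 : ℝ) ≤ n := Nat.cast_nonneg n
    rw [Real.mul_rpow (hp n).1 (Real.rpow_nonneg hn _), ← Real.rpow_mul hn,
      one_div_mul_cancel hd.ne', Real.rpow_one, Real.mul_rpow hε.le (hp n).1]
    ring
  have hR : Filter.Tendsto (fun n : ℕ => Real.exp (-(ε * ((n : ℝ) ^ 2 * p n))) +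
      Real.exp (-((n : ℝ) * (ε * p n) ^ (d2 H) / C)) / δ +
        Real.exp (-(κ * ((n : ℝ) ^ 2 * p n)))) Filter.atTop (nhds 0) := by
    have e1 := Real.tendsto_exp_neg_atTop_nhds_zero.comp (hN.const_mul_atTop hε)
    have e2 := (Real.tendsto_exp_neg_atTop_nhds_zero.comp (hΩ.atTop_div_const hC)).div_const δ
    have e3 := Real.tendsto_exp_neg_atTop_nhds_zero.comp (hN.const_mul_atTop hκ)
    have := (e1.add e2).add e3
    simpa [Function.comp_def] using this
  have hbad : Filter.Tendsto (fun n : ℕ => EX (⊤ : SimpleGraph (Fin n)).edgeFinset (p n)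
      (fun s => if SimpleGraph.fromEdgeSet (↑s : Set (Sym2 (Fin n))) ∈
          {G : SimpleGraph (Fin n) | memT H G ∨ ∃ X ∈ perpIn G (hSpace H G),
            X ∉ perpIn G (wSpace H G) ∧ (wt X : ℝ) < c * (n : ℝ) ^ 2 * p n}
        then (0 : ℝ) else 1)) Filter.atTop (nhds 0) := by
    refine tendsto_of_tendsto_of_tendsto_of_le_of_le' tendsto_const_nhds hR ?_ ?_
    · refine Filter.Eventually.of_forall fun n => EX_nonneg (hp n).1 (hp n).2 fun s _ => ?_
      split_ifs
      · exact le_rfl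
      · exact zero_le_one
    · filter_upwards [Filter.eventually_ge_atTop n0, hΩ.eventually_ge_atTop 1,
        hN.eventually_ge_atTop 1] with n hn h1 h2
      have hppos : 0 < p n := by
        refine lt_of_le_of_ne (hp n).1 fun h => ?_
        rw [← h] at h2
        norm_num at h2
      exact hmain n hn (p n) hppos (hp n).2 h1
  have := hbad.const_sub 1
  rw [sub_zero] at this
  refine this.congr fun n => ?_
  rw [erProb_eq_one_sub]
  congr!


end RG
end
end
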